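/- Let (R, m) be a Noetherian local ring of dimension d admitting a dualizing complex, and let M be a maximal Cohen–Macaulay R-module of finite Gorenstein injective dimension. Then M is G–Gorenstein, R is Cohen–Macaulay, and the top local cohomology module H_m^d(M) is Gorenstein injective. -/

import Mathlib

universe u

namespace GG

open RingTheory.Sequence

variable (R : Type u) [CommRing R]

/-- A module `N` is Gorenstein injective if it is a kernel in a `Hom(Inj,−)`-exact exact
doubly infinite complex of injective modules. -/
def IsGorensteinInjective (N : Type u) [AddCommGroup N] [Module R N] : Prop :=
  ∃ (X : ℤ → ModuleCat.{u} R) (d : ∀ n : ℤ, X n →ₗ[R] X (n + 1)),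
    (∀ n, Module.Injective R (X n)) ∧
    (∀ n, LinearMap.range (d n) = LinearMap.ker (d (n + 1))) ∧
    (∀ (I : ModuleCat.{u} R), Module.Injective R I →
      ∀ (n : ℤ) (φ : I →ₗ[R] X (n + 1)), (d (n + 1)).comp φ = 0 →
        ∃ ψ : I →ₗ[R] X n, (d n).comp ψ = φ) ∧
    Nonempty (N ≃ₗ[R] LinearMap.ker (d 0))

/-- A module `N` is Gorenstein projective if it is a kernel in a `Hom(−,Proj)`-exact exact
doubly infinite complex of projective modules. -/
def IsGorensteinProjective (N : Type u) [AddCommGroup N] [Module R N] : Prop :=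
  ∃ (X : ℤ → ModuleCat.{u} R) (d : ∀ n : ℤ, X n →ₗ[R] X (n + 1)),
    (∀ n, Module.Projective R (X n)) ∧
    (∀ n, LinearMap.range (d n) = LinearMap.ker (d (n + 1))) ∧
    (∀ (P : ModuleCat.{u} R), Module.Projective R P →
      ∀ (n : ℤ) (φ : X (n + 1) →ₗ[R] P), φ.comp (d n) = 0 →
        ∃ ψ : X (n + 1 + 1) →ₗ[R] P, ψ.comp (d (n + 1)) = φ) ∧
    Nonempty (N ≃ₗ[R] LinearMap.ker (d 0))

/-- A module `N` is Gorenstein flat if it is a kernel in an `(Inj ⊗ −)`-exact exact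
doubly infinite complex of flat modules. -/
def IsGorensteinFlat (N : Type u) [AddCommGroup N] [Module R N] : Prop :=
  ∃ (X : ℤ → ModuleCat.{u} R) (d : ∀ n : ℤ, X n →ₗ[R] X (n + 1)),
    (∀ n, Module.Flat R (X n)) ∧
    (∀ n, LinearMap.range (d n) = LinearMap.ker (d (n + 1))) ∧
    (∀ (I : ModuleCat.{u} R), Module.Injective R I →
      ∀ n : ℤ, LinearMap.range (LinearMap.lTensor (R := R) I (d n)) =
        LinearMap.ker (LinearMap.lTensor (R := R) I (d (n + 1)))) ∧
    Nonempty (N ≃ₗ[R] LinearMap.ker (d 0))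

/-- Existence of a right resolution of length `≤ n` by modules satisfying `P`. -/
def CoresolutionLE (P : ModuleCat.{u} R → Prop) (M : Type u) [AddCommGroup M] [Module R M]
    (n : ℕ) : Prop :=
  ∃ (G : ℕ → ModuleCat.{u} R) (d : ∀ i : ℕ, G i →ₗ[R] G (i + 1)) (ε : M →ₗ[R] G 0),
    (∀ i, P (G i)) ∧ Function.Injective ε ∧
    LinearMap.range ε = LinearMap.ker (d 0) ∧
    (∀ i, LinearMap.range (d i) = LinearMap.ker (d (i + 1))) ∧
    (∀ i, n < i → ∀ x : G i, x = 0)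

/-- Existence of a left resolution of length `≤ n` by modules satisfying `P`. -/
def ResolutionLE (P : ModuleCat.{u} R → Prop) (M : Type u) [AddCommGroup M] [Module R M]
    (n : ℕ) : Prop :=
  ∃ (G : ℕ → ModuleCat.{u} R) (d : ∀ i : ℕ, G (i + 1) →ₗ[R] G i) (ε : G 0 →ₗ[R] M),
    (∀ i, P (G i)) ∧ Function.Surjective ε ∧
    LinearMap.ker ε = LinearMap.range (d 0) ∧
    (∀ i, LinearMap.ker (d i) = LinearMap.range (d (i + 1))) ∧
    (∀ i, n < i → ∀ x : G i, x = 0)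

/-- `Gid_R M ≤ n`. -/
def gidLE (M : Type u) [AddCommGroup M] [Module R M] (n : ℕ) : Prop :=
  CoresolutionLE R (fun N => IsGorensteinInjective R N) M n

/-- `id_R M ≤ n`. -/
def idLE (M : Type u) [AddCommGroup M] [Module R M] (n : ℕ) : Prop :=
  CoresolutionLE R (fun N => Module.Injective R N) M n

/-- `pd_R M ≤ n`. -/
def pdLE (M : Type u) [AddCommGroup M] [Module R M] (n : ℕ) : Prop :=
  ResolutionLE R (fun N => Module.Projective R N) M n

/-- `fd_R M ≤ n`. -/
def fdLE (M : Type u) [AddCommGroup M] [Module R M] (n : ℕ) : Prop :=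
  ResolutionLE R (fun N => Module.Flat R N) M n

/-- `Gfd_R M ≤ n`. -/
def gfdLE (M : Type u) [AddCommGroup M] [Module R M] (n : ℕ) : Prop :=
  ResolutionLE R (fun N => IsGorensteinFlat R N) M n

/-- Gorenstein injective dimension, as an extended natural number. -/
noncomputable def gid (M : Type u) [AddCommGroup M] [Module R M] : ℕ∞ :=
  sInf {c : ℕ∞ | ∃ n : ℕ, c = n ∧ gidLE R M n}

/-- The depth of a module over a local ring: the supremum of the lengths of regular
sequences contained in the maximal ideal. -/
noncomputable def mdepth [IsLocalRing R] (M : Type u) [AddCommGroup M] [Module R M] : ℕ∞ :=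
  sSup {c : ℕ∞ | ∃ rs : List R, c = rs.length ∧
    (∀ r ∈ rs, r ∈ IsLocalRing.maximalIdeal R) ∧ RingTheory.Sequence.IsRegular M rs}

/-- The Krull dimension of a module: the Krull dimension of its support. -/
noncomputable def mdim (M : Type u) [AddCommGroup M] [Module R M] : WithBot ℕ∞ :=
  Order.krullDim ↥(Module.support R M)

/-- The height of a prime in the support of `M`. -/
noncomputable def htM (M : Type u) [AddCommGroup M] [Module R M] (p : PrimeSpectrum R) : ℕ∞ :=
  ⨆ h : p ∈ Module.support R M, Order.height (⟨p, h⟩ : ↥(Module.support R M))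

/-- A Cohen–Macaulay module over a local ring: depth equals Krull dimension. -/
def IsCMModule [IsLocalRing R] (M : Type u) [AddCommGroup M] [Module R M] : Prop :=
  (mdepth R M : WithBot ℕ∞) = mdim R M

/-- A maximal Cohen–Macaulay module over a local ring. -/
def IsMaximalCM [IsLocalRing R] (M : Type u) [AddCommGroup M] [Module R M] : Prop :=
  IsCMModule R M ∧ mdim R M = ringKrullDim R

/-- A Cohen–Macaulay local ring. -/
def IsCMLocalRing [IsLocalRing R] : Prop :=
  (mdepth R R : WithBot ℕ∞) = ringKrullDim R

/-- A Gorenstein local ring: a Noetherian local ring of finite self-injective dimension. -/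
def IsGorensteinLocalRing [IsLocalRing R] : Prop :=
  IsNoetherianRing R ∧ ∃ n : ℕ, idLE R R n

/-- A regular local ring: Noetherian, and the maximal ideal is generated by `dim R` elements. -/
def IsRegularLocal [IsLocalRing R] : Prop :=
  IsNoetherianRing R ∧ ∃ s : Finset R, Ideal.span (s : Set R) = IsLocalRing.maximalIdeal R ∧
    (s.card : WithBot ℕ∞) = ringKrullDim R

/-- A (not necessarily local) Gorenstein ring: all localizations at primes are Gorenstein. -/
def IsGorensteinRing : Prop :=
  ∀ p : PrimeSpectrum R, ∃ n : ℕ,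
    idLE (Localization.AtPrime p.asIdeal) (Localization.AtPrime p.asIdeal) n

/-- `R` admits a dualizing complex; by Kawasaki's theorem this is equivalent to being a
homomorphic image of a finite-dimensional Gorenstein ring. -/
def HasDualizingComplex : Prop :=
  ∃ Q : CommRingCat.{u}, IsNoetherianRing Q ∧ ringKrullDim Q < ⊤ ∧ IsGorensteinRing Q ∧
    ∃ f : Q →+* R, Function.Surjective f

section Cousin

/-- The product of the localizations of `N` at the primes in `S`. -/
noncomputable abbrev locProd (S : Set (PrimeSpectrum R)) (N : Type u) [AddCommGroup N]
    [Module R N] : Type u :=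
  Π p : S, LocalizedModule p.1.asIdeal.primeCompl N

/-- The submodule of the product of localizations consisting of finitely supported families;
this is the direct sum `⊕_{p ∈ S} N_p`. -/
noncomputable def finSupp (S : Set (PrimeSpectrum R)) (N : Type u) [AddCommGroup N]
    [Module R N] : Submodule R (locProd R S N) where
  carrier := {f | {p : S | f p ≠ 0}.Finite}
  add_mem' := by
    intro f g hf hg
    refine (hf.union hg).subset ?_
    intro p hp
    by_contra h
    simp only [Set.mem_union, Set.mem_setOf_eq, not_or, not_not] at h
    exact hp (by simp [Pi.add_apply, h.1, h.2])
  zero_mem' := by simp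
  smul_mem' := by
    intro c f hf
    refine hf.subset ?_
    intro p hp
    by_contra h
    simp only [Set.mem_setOf_eq, not_not] at h
    exact hp (by simp [Pi.smul_apply, h])

/-- The canonical map `N → ∏_{p ∈ S} N_p`. -/
noncomputable def thetaFull (S : Set (PrimeSpectrum R)) (N : Type u) [AddCommGroup N]
    [Module R N] : N →ₗ[R] locProd R S N :=
  LinearMap.pi fun p => LocalizedModule.mkLinearMap p.1.asIdeal.primeCompl N

/-- The cokernel of `N → ⊕_{p ∈ S} N_p` (computed inside the direct sum). -/
noncomputable abbrev nextKType (S : Set (PrimeSpectrum R)) (N : Type u) [AddCommGroup N]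
    [Module R N] : Type u :=
  ↥(finSupp R S N) ⧸
    (Submodule.comap (finSupp R S N).subtype (LinearMap.range (thetaFull R S N)))

/-- The sequence of "kernel/cokernel" modules in the inductive construction
of the Cousin complex of `M` with respect to the filtration `F`. -/
noncomputable def cousinK (F : ℕ → Set (PrimeSpectrum R)) (M : ModuleCat.{u} R) :
    ℕ → ModuleCat.{u} R
  | 0 => M
  | n + 1 => ModuleCat.of R (nextKType R (F n \ F (n + 1)) (cousinK F M n))

/-- The `n`-th term `M^n = ⊕_{p ∈ ∂F_n} (coker d^{n-2})_p` of the Cousin complex. -/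
noncomputable abbrev cousinC (F : ℕ → Set (PrimeSpectrum R)) (M : ModuleCat.{u} R) (n : ℕ) :
    Type u :=
  ↥(finSupp R (F n \ F (n + 1)) (cousinK R F M n))

/-- The canonical map from the `n`-th cokernel into the product of its localizations. -/
noncomputable def cousinTheta (F : ℕ → Set (PrimeSpectrum R)) (M : ModuleCat.{u} R) (n : ℕ) :
    (cousinK R F M n) →ₗ[R] locProd R (F n \ F (n + 1)) (cousinK R F M n) :=
  thetaFull R _ _

/-- The (full) `n`-th differential of the Cousin complex, from `M^n` to the product at
level `n+1` (it lands inside the direct sum `M^{n+1}`). -/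
noncomputable def cousinD (F : ℕ → Set (PrimeSpectrum R)) (M : ModuleCat.{u} R) (n : ℕ) :
    (cousinC R F M n) →ₗ[R] locProd R (F (n + 1) \ F (n + 2)) (cousinK R F M (n + 1)) :=
  (cousinTheta R F M (n + 1)).comp
    (Submodule.mkQ (Submodule.comap (finSupp R (F n \ F (n + 1)) (cousinK R F M n)).subtype
      (LinearMap.range (thetaFull R (F n \ F (n + 1)) (cousinK R F M n)))))

/-- `F` is a filtration of `Spec R`: descending, and every element of `∂F_n = F_n \ F_{n+1}`
is a minimal member of `F_n`. -/
def IsFiltration (F : ℕ → Set (PrimeSpectrum R)) : Prop :=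
  (∀ n, F (n + 1) ⊆ F n) ∧
    ∀ n, ∀ p ∈ F n \ F (n + 1), ∀ q ∈ F n, q ≤ p → q = p

/-- The filtration `F` admits `M`. -/
def Admits (F : ℕ → Set (PrimeSpectrum R)) (M : Type u) [AddCommGroup M] [Module R M] : Prop :=
  Module.support R M ⊆ F 0

/-- The `M`-height filtration `K_i = {p ∈ Supp M | ht_M p ≥ i}`. -/
noncomputable def heightFiltration (M : Type u) [AddCommGroup M] [Module R M] :
    ℕ → Set (PrimeSpectrum R) :=
  fun i => {p | p ∈ Module.support R M ∧ (i : ℕ∞) ≤ htM R M p}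

/-- The Cousin complex `C(F, M)` is exact at `M, M⁰, …, M^t`
(together with the well-definedness of the differentials into the direct sums). -/
def CousinPartiallyExact (F : ℕ → Set (PrimeSpectrum R)) (M : ModuleCat.{u} R) (t : ℕ) : Prop :=
  (∀ n, LinearMap.range (cousinTheta R F M n) ≤ finSupp R (F n \ F (n + 1)) (cousinK R F M n)) ∧
  Function.Injective (cousinTheta R F M 0) ∧
  (∀ n ≤ t, LinearMap.ker (cousinD R F M n) =
    Submodule.comap (finSupp R (F n \ F (n + 1)) (cousinK R F M n)).subtype
      (LinearMap.range (cousinTheta R F M n)))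

/-- The Cousin complex `C(F, M)` is exact and all of its terms satisfy `P`, i.e. it provides
a `P`-resolution of `M`. -/
def CousinResolves (F : ℕ → Set (PrimeSpectrum R)) (M : ModuleCat.{u} R)
    (P : ModuleCat.{u} R → Prop) : Prop :=
  (∀ n, LinearMap.range (cousinTheta R F M n) ≤ finSupp R (F n \ F (n + 1)) (cousinK R F M n)) ∧
  Function.Injective (cousinTheta R F M 0) ∧
  (∀ n, LinearMap.ker (cousinD R F M n) =
    Submodule.comap (finSupp R (F n \ F (n + 1)) (cousinK R F M n)).subtype
      (LinearMap.range (cousinTheta R F M n))) ∧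
  (∀ n, P (ModuleCat.of R (cousinC R F M n)))

/-- A G–Gorenstein module: a nonzero finitely generated module whose Cousin complex with
respect to the `M`-height filtration is a Gorenstein injective resolution. -/
def IsGGorenstein (M : ModuleCat.{u} R) : Prop :=
  (∃ x : M, x ≠ 0) ∧ Module.Finite R M ∧
    CousinResolves R (heightFiltration R M) M (fun N => IsGorensteinInjective R N)

/-- A Gorenstein module: a nonzero finitely generated module whose Cousin complex with
respect to the `M`-height filtration is an injective resolution. -/
def IsGorensteinModule (M : ModuleCat.{u} R) : Prop :=
  (∃ x : M, x ≠ 0) ∧ Module.Finite R M ∧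
    CousinResolves R (heightFiltration R M) M (fun N => Module.Injective R N)

end Cousin

/-- A system of parameters of a local ring. -/
def IsSOP [IsLocalRing R] (rs : List R) : Prop :=
  (rs.length : WithBot ℕ∞) = ringKrullDim R ∧
    (∀ r ∈ rs, r ∈ IsLocalRing.maximalIdeal R) ∧
    IsLocalRing.maximalIdeal R ≤ (Ideal.span {r | r ∈ rs}).radical

/-- A balanced big Cohen–Macaulay module: every system of parameters of `R` is a regular
sequence on `M`. -/
def IsBalancedBigCM [IsLocalRing R] (M : Type u) [AddCommGroup M] [Module R M] : Prop :=
  ∀ rs : List R, IsSOP R rs → RingTheory.Sequence.IsRegular M rs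

end GG

section PartPA
namespace GGP
open CategoryTheory Abelian

section A
variable (R : Type u) [CommRing R]

/-- vanishing of Ext -/
def van (X Y : Type u) [AddCommGroup X] [Module R X] [AddCommGroup Y] [Module R Y] (i : ℕ) : Prop :=
  Subsingleton (Abelian.Ext (ModuleCat.of R X) (ModuleCat.of R Y) i)

/-- short exact sequences -/
structure SES {A B C : Type u} [AddCommGroup A] [Module R A] [AddCommGroup B] [Module R B]
    [AddCommGroup C] [Module R C] (f : A →ₗ[R] B) (g : B →ₗ[R] C) : Prop where
  inj : Function.Injective f
  exact : Function.Exact f g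
  surj : Function.Surjective g
end A

section
variable {R : Type u} [CommRing R]
variable {A B C X Y : Type u} [AddCommGroup A] [Module R A] [AddCommGroup B] [Module R B]
    [AddCommGroup C] [Module R C] [AddCommGroup X] [Module R X] [AddCommGroup Y] [Module R Y]
variable {f : A →ₗ[R] B} {g : B →ₗ[R] C}

theorem van_iff {i : ℕ} : van R X Y i ↔
    ∀ e : Abelian.Ext (ModuleCat.of R X) (ModuleCat.of R Y) i, e = 0 := by
  unfold van
  exact ⟨fun h e => Subsingleton.elim _ _, fun h => ⟨fun a b => by rw [h a, h b]⟩⟩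

/-- the short complex of a SES -/
noncomputable abbrev SES.sc (h : SES R f g) : ShortComplex (ModuleCat.{u} R) :=
  ShortComplex.mk (ModuleCat.ofHom f) (ModuleCat.ofHom g) (by
    ext x; simpa using h.exact.apply_apply_eq_zero x)

theorem SES.se (h : SES R f g) : h.sc.ShortExact where
  exact := by
    rw [ShortComplex.ShortExact.moduleCat_exact_iff_function_exact]
    exact h.exact
  mono_f := (ModuleCat.mono_iff_injective _).2 h.inj
  epi_g := (ModuleCat.epi_iff_surjective _).2 h.surj

theorem SES.contra_mid (h : SES R f g) {i : ℕ} (hA : van R A Y i) (hC : van R C Y i) :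
    van R B Y i := by
  rw [van_iff] at *
  intro e
  obtain ⟨x, rfl⟩ := Ext.contravariant_sequence_exact₂ h.se _ e (hA _)
  rw [hC x, Ext.comp_zero]

theorem SES.contra_left (h : SES R f g) {i : ℕ} (hB : van R B Y i) (hC : van R C Y (i+1)) :
    van R A Y i := by
  rw [van_iff] at *
  intro e
  obtain ⟨x, rfl⟩ := Ext.contravariant_sequence_exact₁ h.se _ e (add_comm _ _) (hC _)
  rw [hB x, Ext.comp_zero]

theorem SES.contra_right (h : SES R f g) {i : ℕ} (hA : van R A Y i) (hB : van R B Y (i+1)) :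
    van R C Y (i+1) := by
  rw [van_iff] at *
  intro e
  obtain ⟨x, rfl⟩ := Ext.contravariant_sequence_exact₃ h.se _ e (hB _) (add_comm _ _)
  rw [hA x, Ext.comp_zero]

theorem SES.co_mid (h : SES R f g) {i : ℕ} (hA : van R X A i) (hC : van R X C i) :
    van R X B i := by
  rw [van_iff] at *
  intro e
  obtain ⟨x, rfl⟩ := Ext.covariant_sequence_exact₂ _ h.se e (hC _)
  rw [hA x, Ext.zero_comp]

theorem SES.co_right (h : SES R f g) {i : ℕ} (hB : van R X B i) (hA : van R X A (i+1)) :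
    van R X C i := by
  rw [van_iff] at *
  intro e
  obtain ⟨x, rfl⟩ := Ext.covariant_sequence_exact₃ _ h.se e rfl (hA _)
  rw [hB x, Ext.zero_comp]

theorem SES.co_left (h : SES R f g) {i : ℕ} (hC : van R X C i) (hB : van R X B (i+1)) :
    van R X A (i+1) := by
  rw [van_iff] at *
  intro e
  obtain ⟨x, rfl⟩ := Ext.covariant_sequence_exact₁ _ h.se e (hB _) rfl
  rw [hC x, Ext.zero_comp]

theorem van_zero_iff : van R X Y 0 ↔ ∀ f : X →ₗ[R] Y, f = 0 := by
  rw [van_iff]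
  constructor
  · intro h f
    have := h (Ext.mk₀ (ModuleCat.ofHom f))
    rw [Ext.mk₀_eq_zero_iff] at this
    have := congrArg ModuleCat.Hom.hom this
    simpa using this
  · intro h e
    obtain ⟨f, rfl⟩ := Ext.homEquiv₀.symm.surjective e
    have : f = 0 := by
      ext x
      rw [h f.hom]; rfl
    subst this
    simp

theorem SES.contra_right0 (h : SES R f g) (hB : van R B Y 0) : van R C Y 0 := by
  rw [van_zero_iff] at *
  intro k
  ext x
  obtain ⟨y, rfl⟩ := h.surj x
  exact LinearMap.congr_fun (hB (k ∘ₗ g)) y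

theorem SES.co_left0 (h : SES R f g) (hB : van R X B 0) : van R X A 0 := by
  rw [van_zero_iff] at *
  intro k
  ext x
  apply h.inj
  simpa using LinearMap.congr_fun (hB (f ∘ₗ k)) x

theorem van_proj [Module.Projective R X] {i : ℕ} : van R X Y (i+1) := by
  rw [van_iff]; intro e
  have : Projective (ModuleCat.of R X) := (IsProjective.iff_projective X).1 inferInstance
  exact Ext.eq_zero_of_projective _

theorem van_inj (hY : Module.Injective R Y) {i : ℕ} : van R X Y (i+1) := by
  rw [van_iff]; intro e
  have : Injective (ModuleCat.of R Y) := (Module.injective_iff_injective_object R Y).1 hY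
  exact Ext.eq_zero_of_injective _

theorem van_retract_left (s : X →ₗ[R] A) (r : A →ₗ[R] X) (hrs : r ∘ₗ s = LinearMap.id) {i : ℕ}
    (h : van R A Y i) : van R X Y i := by
  rw [van_iff] at *
  intro z
  have : z = (Ext.mk₀ (ModuleCat.ofHom s)).comp ((Ext.mk₀ (ModuleCat.ofHom r)).comp z (zero_add _)) (zero_add _) := by
    rw [Ext.mk₀_comp_mk₀_assoc, ← ModuleCat.ofHom_comp, hrs]; simp
  rw [this, h ((Ext.mk₀ (ModuleCat.ofHom r)).comp z (zero_add _)), Ext.comp_zero]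

theorem van_retract_right (s : Y →ₗ[R] A) (r : A →ₗ[R] Y) (hrs : r ∘ₗ s = LinearMap.id) {i : ℕ}
    (h : van R X A i) : van R X Y i := by
  rw [van_iff] at *
  intro z
  have : z = (z.comp (Ext.mk₀ (ModuleCat.ofHom s)) (add_zero _)).comp (Ext.mk₀ (ModuleCat.ofHom r)) (add_zero _) := by
    rw [Ext.comp_assoc_of_third_deg_zero, Ext.mk₀_comp_mk₀, ← ModuleCat.ofHom_comp, hrs]; simp
  rw [this, h (z.comp (Ext.mk₀ (ModuleCat.ofHom s)) (add_zero _)), Ext.zero_comp]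

theorem van_congr_left (e : X ≃ₗ[R] A) {i : ℕ} (h : van R A Y i) : van R X Y i :=
  van_retract_left e.toLinearMap e.symm.toLinearMap (by ext; simp) h

theorem van_congr_right (e : Y ≃ₗ[R] A) {i : ℕ} (h : van R X A i) : van R X Y i :=
  van_retract_right e.toLinearMap e.symm.toLinearMap (by ext; simp) h

/-- extension property from vanishing -/
theorem SES.extend (h : SES R f g) (hC : van R C Y 1) (k : A →ₗ[R] Y) :
    ∃ k' : B →ₗ[R] Y, k' ∘ₗ f = k := by
  rw [van_iff] at hC
  obtain ⟨x, hx⟩ := Ext.contravariant_sequence_exact₁ h.se _ (Ext.mk₀ (ModuleCat.ofHom k)) (add_comm _ _) (hC _)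
  obtain ⟨k', rfl⟩ := Ext.homEquiv₀.symm.surjective x
  refine ⟨k'.hom, ?_⟩
  have h2 : Ext.mk₀ (ModuleCat.ofHom f ≫ k') = Ext.mk₀ (ModuleCat.ofHom k) := by
    rw [← hx, Ext.homEquiv₀_symm_apply, Ext.mk₀_comp_mk₀]
  have := Ext.homEquiv₀.symm.injective h2
  exact congrArg ModuleCat.Hom.hom this

theorem SES.van1_of_extend (h : SES R f g) (hB : van R B Y 1)
    (H : ∀ k : A →ₗ[R] Y, ∃ k' : B →ₗ[R] Y, k' ∘ₗ f = k) : van R C Y 1 := by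
  rw [van_iff] at *
  intro e
  obtain ⟨x, rfl⟩ := Ext.contravariant_sequence_exact₃ h.se _ e (hB _) (add_comm _ _)
  obtain ⟨k, rfl⟩ := Ext.homEquiv₀.symm.surjective x
  obtain ⟨k', hk'⟩ := H k.hom
  have : k = h.sc.f ≫ ModuleCat.ofHom k' := by
    ext x; exact (LinearMap.congr_fun hk' x).symm
  rw [this, Ext.homEquiv₀_symm_apply, ← Ext.mk₀_comp_mk₀, ← Ext.comp_assoc (a₁₂ := 1) (h₁₂ := rfl), ShortComplex.ShortExact.extClass_comp, Ext.zero_comp]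
  · simp

theorem SES.lift (h : SES R f g) (hA : van R X A 1) (k : X →ₗ[R] C) :
    ∃ k' : X →ₗ[R] B, g ∘ₗ k' = k := by
  rw [van_iff] at hA
  obtain ⟨x, hx⟩ := Ext.covariant_sequence_exact₃ _ h.se (Ext.mk₀ (ModuleCat.ofHom k)) rfl (hA _)
  obtain ⟨k', rfl⟩ := Ext.homEquiv₀.symm.surjective x
  refine ⟨k'.hom, ?_⟩
  have h2 : Ext.mk₀ (k' ≫ ModuleCat.ofHom g) = Ext.mk₀ (ModuleCat.ofHom k) := by
    rw [← hx, Ext.homEquiv₀_symm_apply, Ext.mk₀_comp_mk₀]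
  have := Ext.homEquiv₀.symm.injective h2
  exact congrArg ModuleCat.Hom.hom this

theorem SES.van1_of_lift (h : SES R f g) (hB : van R X B 1)
    (H : ∀ k : X →ₗ[R] C, ∃ k' : X →ₗ[R] B, g ∘ₗ k' = k) : van R X A 1 := by
  rw [van_iff] at *
  intro e
  obtain ⟨x, rfl⟩ := Ext.covariant_sequence_exact₁ _ h.se e (hB _) rfl
  obtain ⟨k, rfl⟩ := Ext.homEquiv₀.symm.surjective x
  obtain ⟨k', hk'⟩ := H k.hom
  have : k = ModuleCat.ofHom k' ≫ h.sc.g := by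
    ext x; exact (LinearMap.congr_fun hk' x).symm
  rw [this, Ext.homEquiv₀_symm_apply, ← Ext.mk₀_comp_mk₀, Ext.comp_assoc (a₂₃ := 1) (h₂₃ := rfl), ShortComplex.ShortExact.comp_extClass, Ext.comp_zero]
  · simp

theorem van_subsingleton_left [Subsingleton X] {i : ℕ} : van R X Y i := by
  cases i with
  | zero => rw [van_zero_iff]; intro f; ext x; rw [Subsingleton.elim x 0]; simp
  | succ i => exact van_proj

theorem van_subsingleton_right [Subsingleton Y] {i : ℕ} : van R X Y i := by
  cases i with
  | zero => rw [van_zero_iff]; intro f; ext x; exact Subsingleton.elim _ _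
  | succ i =>
    refine van_inj ⟨fun {X' Y'} _ _ _ _ f hf g => ⟨0, fun x => Subsingleton.elim _ _⟩⟩

theorem SES.ofKer (g : B →ₗ[R] C) (hg : Function.Surjective g) :
    SES R (LinearMap.ker g).subtype g :=
  ⟨Subtype.val_injective, LinearMap.exact_subtype_ker_map g, hg⟩

theorem SES.ofQuot (f : A →ₗ[R] B) (hf : Function.Injective f) :
    SES R f (LinearMap.range f).mkQ :=
  ⟨hf, fun y => by simp, Submodule.mkQ_surjective _⟩

theorem SES.ofSub (S : Submodule R B) : SES R S.subtype S.mkQ :=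
  ⟨Subtype.val_injective, fun y => by simp, Submodule.mkQ_surjective _⟩

theorem SES.prod : SES R (LinearMap.inl R A B) (LinearMap.snd R A B) :=
  ⟨LinearMap.inl_injective, Function.Exact.inl_snd, LinearMap.snd_surjective⟩

theorem van_pi_left {i : ℕ} (h : van R X Y i) (n : ℕ) : van R (Fin n → X) Y i := by
  induction n with
  | zero => exact van_subsingleton_left
  | succ n ih =>
    exact van_congr_left (Fin.consLinearEquiv R (fun _ : Fin (n+1) => X)).symm
      (SES.prod.contra_mid h ih)

theorem van_pi_right {i : ℕ} (h : van R X Y i) (n : ℕ) : van R X (Fin n → Y) i := by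
  induction n with
  | zero => exact van_subsingleton_right
  | succ n ih =>
    exact van_congr_right (Fin.consLinearEquiv R (fun _ : Fin (n+1) => Y)).symm
      (SES.prod.co_mid h ih)

end
end GGP

end PartPA

section PartPA2
namespace GGP
open CategoryTheory Abelian IsLocalRing

section
variable {R : Type u} [CommRing R]
variable {A B C X Y : Type u} [AddCommGroup A] [Module R A] [AddCommGroup B] [Module R B]
    [AddCommGroup C] [Module R C] [AddCommGroup X] [Module R X] [AddCommGroup Y] [Module R Y]
variable {f : A →ₗ[R] B} {g : B →ₗ[R] C}

theorem subsingleton_of_smul_surj [IsLocalRing R] {N : Type*} [AddCommGroup N] [Module R N]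
    [Module.Finite R N] {x : R} (hx : x ∈ maximalIdeal R) (h : ∀ n : N, ∃ n', x • n' = n) :
    Subsingleton N := by
  have : (⊤ : Submodule R N) = ⊥ := by
    apply Submodule.eq_bot_of_le_smul_of_le_jacobson_bot (maximalIdeal R) ⊤ Module.Finite.fg_top
    · intro n _
      obtain ⟨n', rfl⟩ := h n
      exact Submodule.smul_mem_smul hx trivial
    · rw [IsLocalRing.jacobson_eq_maximalIdeal _ bot_ne_top]
  exact (Submodule.subsingleton_iff R).1 (subsingleton_of_bot_eq_top this.symm)

theorem van_nak_left [IsLocalRing R] [IsNoetherianRing R] [Module.Finite R X] [Module.Finite R Y]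
    {x : R} (hx : x ∈ maximalIdeal R) {g : X →ₗ[R] C} (h : SES R (x • LinearMap.id : X →ₗ[R] X) g)
    {i : ℕ} (hv : van R C Y (i+1)) : van R X Y i := by
  have := ModuleCat.finite_ext R (ModuleCat.of R X) (ModuleCat.of R Y) i
  refine subsingleton_of_smul_surj (R := R) hx ?_
  intro e
  rw [van_iff] at hv
  obtain ⟨z, hz⟩ := Ext.contravariant_sequence_exact₁ h.se _ e (add_comm _ _) (hv _)
  refine ⟨z, ?_⟩
  have h2 : h.sc.f = x • 𝟙 (ModuleCat.of R X) := by ext y; rfl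
  rw [← hz, h2, Ext.mk₀_smul, Ext.smul_comp, Ext.mk₀_id_comp]

theorem van_nak_right [IsLocalRing R] [IsNoetherianRing R] [Module.Finite R X] [Module.Finite R Y]
    {x : R} (hx : x ∈ maximalIdeal R) {g : Y →ₗ[R] C} (h : SES R (x • LinearMap.id : Y →ₗ[R] Y) g)
    {i : ℕ} (hv : van R X C i) : van R X Y i := by
  have := ModuleCat.finite_ext R (ModuleCat.of R X) (ModuleCat.of R Y) i
  refine subsingleton_of_smul_surj (R := R) hx ?_
  intro e
  rw [van_iff] at hv
  obtain ⟨z, hz⟩ := Ext.covariant_sequence_exact₂ _ h.se e (hv _)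
  refine ⟨z, ?_⟩
  have h2 : h.sc.f = x • 𝟙 (ModuleCat.of R Y) := by ext y; rfl
  rw [← hz, h2, Ext.mk₀_smul, Ext.comp_smul, Ext.comp_mk₀_id]
end
end GGP

end PartPA2

section PartPC
namespace GGP
open CategoryTheory Abelian IsLocalRing TensorProduct

section
variable {R : Type u} [CommRing R]
variable {A B C X Y : Type u} [AddCommGroup A] [Module R A] [AddCommGroup B] [Module R B]
    [AddCommGroup C] [Module R C] [AddCommGroup X] [Module R X] [AddCommGroup Y] [Module R Y]
variable {f : A →ₗ[R] B} {g : B →ₗ[R] C}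

theorem SES.char (h : SES R f g) : SES R (CharacterModule.dual g) (CharacterModule.dual f) where
  inj := CharacterModule.dual_injective_of_surjective g h.surj
  surj := CharacterModule.dual_surjective_of_injective f h.inj
  exact := by
    intro c
    constructor
    · intro hc
      have hker : ∀ x ∈ LinearMap.ker g, c x = 0 := by
        intro x hx
        obtain ⟨y, rfl⟩ := (h.exact x).1 hx
        exact DFunLike.congr_fun hc y
      let e := g.quotKerEquivOfSurjective h.surj
      let c2 : (B ⧸ (LinearMap.ker g).toAddSubgroup) →+ AddCircle (1:ℚ) :=
        QuotientAddGroup.lift _ (c : B →+ AddCircle (1:ℚ)) hker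
      refine ⟨(c2.comp (e.symm.toLinearMap.toAddMonoidHom : C →+ _) : C →+ _), ?_⟩
      ext x
      change c2 (e.symm (g x)) = c x
      have : e.symm (g x) = Submodule.Quotient.mk x := by
        rw [LinearEquiv.symm_apply_eq]; rfl
      rw [this]; rfl
    · rintro ⟨c, rfl⟩
      ext x
      change c (g (f x)) = 0
      rw [h.exact.apply_apply_eq_zero]
      exact map_zero (c : C →+ _)

theorem lTensor_inj_iff_char (W : Type u) [AddCommGroup W] [Module R W] (f : A →ₗ[R] B) :
    Function.Injective (f.lTensor W) ↔ ∀ k : W →ₗ[R] CharacterModule A,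
      ∃ k' : W →ₗ[R] CharacterModule B, CharacterModule.dual f ∘ₗ k' = k := by
  have key : ∀ k' : W →ₗ[R] CharacterModule B,
      CharacterModule.homEquiv (CharacterModule.dual f ∘ₗ k') =
        CharacterModule.dual (f.lTensor W) (CharacterModule.homEquiv k') := by
    intro k'
    ext x
    induction x with
    | zero => rw [map_zero, map_zero]
    | add x y hx hy => rw [map_add, map_add, hx, hy]
    | tmul x y => rfl
  rw [← CharacterModule.dual_surjective_iff_injective]
  constructor
  · intro h k
    obtain ⟨c, hc⟩ := h (CharacterModule.homEquiv k)
    refine ⟨CharacterModule.homEquiv.symm c, ?_⟩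
    apply CharacterModule.homEquiv.injective
    rw [key, LinearEquiv.apply_symm_apply, hc]
  · intro h c
    obtain ⟨k', hk'⟩ := h (CharacterModule.homEquiv.symm c)
    refine ⟨CharacterModule.homEquiv k', ?_⟩
    rw [← key, hk', LinearEquiv.apply_symm_apply]

theorem SES.lTensor_inj (h : SES R f g) {W : Type u} [AddCommGroup W] [Module R W]
    (hv : van R W (CharacterModule C) 1) : Function.Injective (f.lTensor W) := by
  rw [lTensor_inj_iff_char]
  intro k
  exact h.char.lift hv k

theorem SES.van_char_of_inj (h : SES R f g) {W : Type u} [AddCommGroup W] [Module R W]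
    (hB : van R W (CharacterModule B) 1) (hi : Function.Injective (f.lTensor W)) :
    van R W (CharacterModule C) 1 := by
  refine h.char.van1_of_lift hB ?_
  rwa [lTensor_inj_iff_char] at hi

/-- Hom(W, SES) is exact given lifts. -/
theorem SES.hom (h : SES R f g) {W : Type u} [AddCommGroup W] [Module R W]
    (H : ∀ k : W →ₗ[R] C, ∃ k' : W →ₗ[R] B, g ∘ₗ k' = k) :
    SES R (LinearMap.compRight R f : (W →ₗ[R] A) →ₗ[R] (W →ₗ[R] B))
      (LinearMap.compRight R g : (W →ₗ[R] B) →ₗ[R] (W →ₗ[R] C)) where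
  inj := by
    intro a b hab
    ext x
    exact h.inj (LinearMap.congr_fun hab x)
  surj := H
  exact := by
    intro k
    constructor
    · intro hk
      have : ∀ x, k x ∈ LinearMap.range f := fun x => (h.exact _).1 (LinearMap.congr_fun hk x)
      let e := LinearEquiv.ofInjective f h.inj
      refine ⟨e.symm.toLinearMap ∘ₗ k.codRestrict _ this, ?_⟩
      ext x
      change f (e.symm _) = _
      have := e.apply_symm_apply (k.codRestrict _ this x)
      exact congrArg Subtype.val this
    · rintro ⟨k, rfl⟩
      ext x
      exact h.exact.apply_apply_eq_zero _

/-- the evaluation map -/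
noncomputable def ev (W G : Type u) [AddCommGroup W] [Module R W] [AddCommGroup G] [Module R G] :
    W ⊗[R] (W →ₗ[R] G) →ₗ[R] G := TensorProduct.lift (LinearMap.applyₗ)

@[simp] theorem ev_tmul (W G : Type u) [AddCommGroup W] [Module R W] [AddCommGroup G] [Module R G]
    (w : W) (φ : W →ₗ[R] G) : ev W G (w ⊗ₜ[R] φ) = φ w := rfl

theorem ev_nat (W : Type u) [AddCommGroup W] [Module R W] (f : A →ₗ[R] B)
    (x : W ⊗[R] (W →ₗ[R] A)) :
    ev W B ((LinearMap.compRight R f).lTensor W x) = f (ev W A x) := by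
  induction x with
  | zero => simp
  | add x y hx hy => simp only [map_add, hx, hy]
  | tmul x y => simp

/-- the Bass class of a module -/
structure Bass (R : Type u) [CommRing R] (W G : Type u) [AddCommGroup W] [Module R W]
    [AddCommGroup G] [Module R G] : Prop where
  ext : ∀ i, van R W G (i+1)
  tor : ∀ i, van R W (CharacterModule (W →ₗ[R] G)) (i+1)
  bij : Function.Bijective (ev W G : W ⊗[R] (W →ₗ[R] G) →ₗ[R] G)

theorem Bass.congr {W : Type u} [AddCommGroup W] [Module R W] (e : A ≃ₗ[R] B) (h : Bass R W B) :
    Bass R W A where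
  ext i := van_congr_right e (h.ext i)
  tor i := van_congr_right (CharacterModule.congr (LinearEquiv.congrRight e)) (h.tor i)
  bij := by
    have h2 : ∀ x, e (ev W A x) = ev W B ((LinearEquiv.congrRight e).lTensor W x) := by
      intro x
      rw [← LinearEquiv.coe_coe, ← ev_nat]; rfl
    have : (ev W A : W ⊗[R] (W →ₗ[R] A) → A) =
        e.symm ∘ ev W B ∘ (LinearEquiv.congrRight e).lTensor W := by
      funext x
      simp [← h2]
    rw [this]
    exact e.symm.bijective.comp (h.bij.comp (LinearEquiv.bijective _))

theorem Bass.kernel {W : Type u} [AddCommGroup W] [Module R W] (h : SES R f g)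
    (hB : Bass R W B) (hC : Bass R W C)
    (H : ∀ k : W →ₗ[R] C, ∃ k' : W →ₗ[R] B, g ∘ₗ k' = k) : Bass R W A where
  ext i := by
    cases i with
    | zero => exact h.van1_of_lift (hB.ext 0) H
    | succ i => exact h.co_left (hC.ext i) (hB.ext (i+1))
  tor i := (h.hom H).char.co_right (hB.tor i) (hC.tor (i+1))
  bij := by
    have hi := (h.hom H).lTensor_inj (W := W) (hC.tor 0)
    have hex := lTensor_exact W (h.hom H).exact (h.hom H).surj
    constructor
    · rw [injective_iff_map_eq_zero]
      intro x hx
      apply hi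
      rw [map_zero]
      apply hB.bij.1
      rw [ev_nat, hx, map_zero, map_zero]
    · intro z
      obtain ⟨b, hb⟩ := hB.bij.2 (f z)
      have : ((LinearMap.compRight R g).lTensor W b) = 0 := by
        apply hC.bij.1
        rw [ev_nat, hb, map_zero, h.exact.apply_apply_eq_zero]
      obtain ⟨a, rfl⟩ := (hex b).1 this
      refine ⟨a, h.inj ?_⟩
      rw [← ev_nat, hb]

theorem Bass.chain {W : Type u} [AddCommGroup W] [Module R W]
    (Z X : ℤ → ModuleCat.{u} R) (ι : ∀ k, Z k →ₗ[R] X k) (π : ∀ k, X k →ₗ[R] Z (k+1))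
    (h : ∀ k, SES R (ι k) (π k)) (hX : ∀ k, Bass R W (X k))
    (H : ∀ k, ∀ t : W →ₗ[R] Z (k+1), ∃ t' : W →ₗ[R] X k, π k ∘ₗ t' = t) (k : ℤ) :
    Bass R W (Z k) := by
  have hsurj : ∀ k, Function.Surjective (ev W (Z k) : W ⊗[R] (W →ₗ[R] Z k) →ₗ[R] Z k) := by
    intro k
    obtain ⟨k, rfl⟩ : ∃ j, k = j + 1 := ⟨k-1, by ring⟩
    intro z
    obtain ⟨x, rfl⟩ := (h k).surj z
    obtain ⟨y, rfl⟩ := (hX k).bij.2 x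
    exact ⟨_, ev_nat W (π k) y⟩
  have hinj : ∀ k, Function.Injective (ev W (Z k) : W ⊗[R] (W →ₗ[R] Z k) →ₗ[R] Z k) := by
    intro k
    obtain ⟨k, rfl⟩ : ∃ j, k = j + 1 := ⟨k-1, by ring⟩
    rw [injective_iff_map_eq_zero]
    intro u hu
    obtain ⟨v, rfl⟩ := LinearMap.lTensor_surjective W ((h k).hom (H k)).surj u
    rw [ev_nat] at hu
    obtain ⟨z, hz⟩ := ((h k).exact _).1 hu
    obtain ⟨w, rfl⟩ := hsurj k z
    rw [← ev_nat] at hz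
    rw [← (hX k).bij.1 hz]
    exact (lTensor_exact W ((h k).hom (H k)).exact ((h k).hom (H k)).surj).apply_apply_eq_zero w
  have htor1 : ∀ k, van R W (CharacterModule (W →ₗ[R] Z k)) 1 := by
    intro k
    obtain ⟨k, rfl⟩ : ∃ j, k = j + 1 := ⟨k-1, by ring⟩
    refine ((h k).hom (H k)).van_char_of_inj ((hX k).tor 0) ?_
    intro a b hab
    have := congrArg (ev W (X k)) hab
    rw [ev_nat, ev_nat] at this
    exact hinj k ((h k).inj this)
  refine ⟨?_, ?_, hinj k, hsurj k⟩
  · intro i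
    induction i generalizing k with
    | zero => exact (h k).van1_of_lift ((hX k).ext 0) (H k)
    | succ i ih => exact (h k).co_left (ih (k+1)) ((hX k).ext (i+1))
  · intro i
    induction i generalizing k with
    | zero => exact htor1 k
    | succ i ih =>
      obtain ⟨k, rfl⟩ : ∃ j, k = j + 1 := ⟨k-1, by ring⟩
      exact ((h k).hom (H k)).char.co_left (ih k) ((hX k).tor (i+1))

end
end GGP

end PartPC

section PartPB
namespace GGP
open CategoryTheory Abelian IsLocalRing TensorProduct

section
variable {R : Type u} [CommRing R]
variable {A B C X Y : Type u} [AddCommGroup A] [Module R A] [AddCommGroup B] [Module R B]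
    [AddCommGroup C] [Module R C] [AddCommGroup X] [Module R X] [AddCommGroup Y] [Module R Y]

theorem inj_ext {J : Type u} [AddCommGroup J] [Module R J] (hJ : Module.Injective R J)
    (f : A →ₗ[R] B) (hf : Function.Injective f) (k : A →ₗ[R] J) : ∃ k' : B →ₗ[R] J, k' ∘ₗ f = k := by
  obtain ⟨h, hh⟩ := hJ.out f hf k
  exact ⟨h, LinearMap.ext hh⟩

theorem inj_of_ext {J : Type u} [AddCommGroup J] [Module R J]
    (h : ∀ (A B : ModuleCat.{u} R) (f : A →ₗ[R] B), Function.Injective f → ∀ k : A →ₗ[R] J,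
      ∃ k' : B →ₗ[R] J, k' ∘ₗ f = k) : Module.Injective R J := by
  refine ⟨fun {X' Y'} _ _ _ _ f hf g => ?_⟩
  obtain ⟨k', hk'⟩ := h (ModuleCat.of R X') (ModuleCat.of R Y') f hf g
  exact ⟨k', fun x => LinearMap.congr_fun hk' x⟩

theorem inj_retract {J : Type u} [AddCommGroup J] [Module R J] (hJ : Module.Injective R J)
    (s : A →ₗ[R] J) (r : J →ₗ[R] A) (h : r ∘ₗ s = LinearMap.id) : Module.Injective R A := by
  refine inj_of_ext fun A' B' f hf k => ?_
  obtain ⟨k', hk'⟩ := inj_ext hJ f hf (s ∘ₗ k)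
  refine ⟨r ∘ₗ k', ?_⟩
  rw [LinearMap.comp_assoc, hk', ← LinearMap.comp_assoc, h, LinearMap.id_comp]

theorem inj_congr (e : A ≃ₗ[R] B) (hB : Module.Injective R B) : Module.Injective R A :=
  inj_retract hB e.toLinearMap e.symm.toLinearMap (by ext; simp)

theorem inj_subsingleton [Subsingleton A] : Module.Injective R A :=
  inj_of_ext fun _ _ _ _ _ => ⟨0, by ext; exact Subsingleton.elim _ _⟩

variable (R) in
theorem exists_inj (Z : Type u) [AddCommGroup Z] [Module R Z] :
    ∃ (J : ModuleCat.{u} R) (ι : Z →ₗ[R] J), Module.Injective R J ∧ Function.Injective ι := by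
  obtain ⟨P⟩ := EnoughInjectives.presentation (ModuleCat.of R Z)
  refine ⟨P.J, P.f.hom, ?_, ?_⟩
  · have := P.injective
    exact (Module.injective_iff_injective_object R P.J).2 this
  · exact (ModuleCat.mono_iff_injective _).1 P.mono

/-- essential submodule -/
def Ess (f : A →ₗ[R] B) : Prop :=
  Function.Injective f ∧ ∀ b : B, b ≠ 0 → ∃ r : R, r • b ≠ 0 ∧ r • b ∈ LinearMap.range f

theorem Ess.inj_of_comp {f : A →ₗ[R] B} (hf : Ess f) (k : B →ₗ[R] C)
    (h : Function.Injective (k ∘ₗ f)) : Function.Injective k := by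
  rw [injective_iff_map_eq_zero]
  intro b hb
  by_contra hne
  obtain ⟨r, h1, a, ha⟩ := hf.2 b hne
  apply h1
  have : (k ∘ₗ f) a = 0 := by
    rw [LinearMap.comp_apply, ha, map_smul, hb, smul_zero]
  rw [← ha, h (this.trans (map_zero _).symm), map_zero]

variable (R) in
theorem exists_hull (Z : Type u) [AddCommGroup Z] [Module R Z] :
    ∃ (J : ModuleCat.{u} R) (ι : Z →ₗ[R] J), Module.Injective R J ∧ Ess ι := by
  obtain ⟨I, ι, hI, hι⟩ := exists_inj R Z
  set Z0 := LinearMap.range ι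
  -- maximal essential extension
  let S : Set (Submodule R I) := {E | Z0 ≤ E ∧ ∀ b ∈ E, b ≠ 0 → ∃ r : R, r • b ≠ 0 ∧ r • b ∈ Z0}
  have hS0 : Z0 ∈ S := ⟨le_rfl, fun b hb hne => ⟨1, by simpa using hne, by simpa using hb⟩⟩
  obtain ⟨E, hZE, hE⟩ := zorn_le_nonempty₀ S (by
    intro c hc hchain y hy
    refine ⟨sSup c, ⟨(hc hy).1.trans (le_sSup hy), ?_⟩, fun z hz => le_sSup hz⟩
    intro b hb hne
    rw [Submodule.mem_sSup_of_directed ⟨y, hy⟩ hchain.directedOn] at hb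
    obtain ⟨z, hz, hbz⟩ := hb
    exact (hc hz).2 b hbz hne) Z0 hS0
  -- maximal complement
  let T : Set (Submodule R I) := {D | Disjoint E D}
  obtain ⟨D, -, hD⟩ := zorn_le_nonempty₀ T (by
    intro c hc hchain y hy
    refine ⟨sSup c, ?_, fun z hz => le_sSup hz⟩
    change Disjoint E _
    rw [Submodule.disjoint_def]
    intro b hbE hb
    rw [Submodule.mem_sSup_of_directed ⟨y, hy⟩ hchain.directedOn] at hb
    obtain ⟨z, hz, hbz⟩ := hb
    exact Submodule.disjoint_def.1 (hc hz) b hbE hbz) ⊥ (disjoint_bot_right)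
  have hdis : Disjoint E D := hD.prop
  have hess : Ess (D.mkQ ∘ₗ E.subtype) := by
    constructor
    · rw [injective_iff_map_eq_zero]
      intro x hx
      have : (x : I) ∈ D := by simpa using hx
      exact Subtype.ext (Submodule.disjoint_def.1 hdis _ x.2 this)
    · intro b hb
      obtain ⟨b, rfl⟩ := D.mkQ_surjective b
      have hbD : b ∉ D := by simpa using hb
      have : ¬ Disjoint E (D ⊔ Submodule.span R {b}) := by
        intro hh
        have := hD.le_of_ge (y := D ⊔ Submodule.span R {b}) hh le_sup_left
        exact hbD (this (Submodule.mem_sup_right (Submodule.mem_span_singleton_self b)))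
      rw [Submodule.disjoint_def] at this
      push Not at this
      obtain ⟨x, hxE, hx, hx0⟩ := this
      obtain ⟨y, hy, z, hz, rfl⟩ := Submodule.mem_sup.1 hx
      obtain ⟨r, rfl⟩ := Submodule.mem_span_singleton.1 hz
      have h1 : r • D.mkQ b = D.mkQ (y + r • b) := by
        rw [map_add, map_smul, show D.mkQ y = 0 from (Submodule.Quotient.mk_eq_zero D).2 hy, zero_add]
      refine ⟨r, ?_, ⟨⟨_, hxE⟩, ?_⟩⟩
      · rw [h1]
        intro h0
        have : y + r • b ∈ D := (Submodule.Quotient.mk_eq_zero D).1 h0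
        exact hx0 (Submodule.disjoint_def.1 hdis _ hxE this)
      · rw [h1]; rfl
  obtain ⟨k, hk⟩ := inj_ext hI (D.mkQ ∘ₗ E.subtype) hess.1 E.subtype
  have hkinj : Function.Injective k := hess.inj_of_comp k (by rw [hk]; exact E.injective_subtype)
  have hrange : LinearMap.range k ≤ E := by
    refine hE.le_of_ge (y := LinearMap.range k) ⟨?_, ?_⟩ ?_
    · intro z hz
      exact ⟨_, LinearMap.congr_fun hk ⟨z, hZE hz⟩⟩
    · rintro _ ⟨q, rfl⟩ hne
      have hq : q ≠ 0 := fun h => hne (by rw [h, map_zero])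
      obtain ⟨r, h1, e, he⟩ := hess.2 q hq
      have he' : r • k q = e := by rw [← map_smul, ← he]; exact LinearMap.congr_fun hk e
      have hne' : (e : I) ≠ 0 := by
        rw [← he']
        intro h0
        exact h1 (hkinj (by rw [map_smul, h0, map_zero]))
      obtain ⟨s, h2, h3⟩ := hE.prop.2 e e.2 hne'
      exact ⟨s * r, by rwa [mul_smul, he'], by rwa [mul_smul, he']⟩
    · intro z hz
      exact ⟨_, LinearMap.congr_fun hk ⟨z, hz⟩⟩
  refine ⟨ModuleCat.of R E, ι.codRestrict E fun z => hZE ⟨z, rfl⟩, ?_, ?_, ?_⟩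
  · refine inj_retract hI E.subtype ((k.codRestrict E fun q => hrange ⟨q, rfl⟩) ∘ₗ D.mkQ) ?_
    ext x
    exact LinearMap.congr_fun hk x
  · intro a b hab
    exact hι (congrArg Subtype.val hab)
  · rintro ⟨b, hb⟩ hne
    obtain ⟨r, h1, z, hz⟩ := hE.prop.2 b hb (fun h => hne (Subtype.ext h))
    exact ⟨r, fun h => h1 (congrArg Subtype.val h), z, Subtype.ext hz⟩

/-- `I`-power torsion -/
def tors (I : Ideal R) (M : Type u) [AddCommGroup M] [Module R M] : Submodule R M where
  carrier := {x | ∃ n : ℕ, ∀ r ∈ I ^ n, r • x = 0}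
  zero_mem' := ⟨0, by simp⟩
  add_mem' := by
    rintro a b ⟨n, hn⟩ ⟨k, hk⟩
    refine ⟨n + k, fun r hr => ?_⟩
    rw [smul_add, hn r (Ideal.pow_le_pow_right (by omega) hr),
      hk r (Ideal.pow_le_pow_right (by omega) hr), add_zero]
  smul_mem' := by
    rintro c x ⟨n, hn⟩
    exact ⟨n, fun r hr => by rw [smul_comm, hn r hr, smul_zero]⟩

theorem mem_tors {I : Ideal R} {x : X} : x ∈ tors I X ↔ ∃ n : ℕ, ∀ r ∈ I ^ n, r • x = 0 := Iff.rfl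

theorem tors_fg_bound (I : Ideal R) (S : Submodule R X) (hS : S.FG) (h : S ≤ tors I X) :
    ∃ n : ℕ, ∀ r ∈ I ^ n, ∀ x ∈ S, r • x = 0 := by
  obtain ⟨t, rfl⟩ := hS
  have : ∀ x ∈ t, ∃ n : ℕ, ∀ r ∈ I ^ n, r • x = 0 := fun x hx => h (Submodule.subset_span hx)
  choose! n hn using this
  refine ⟨t.sup n, fun r hr x hx => ?_⟩
  induction hx using Submodule.span_induction with
  | mem x hx => exact hn x hx r (Ideal.pow_le_pow_right (Finset.le_sup hx) hr)
  | zero => simp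
  | add x y _ _ h1 h2 => rw [smul_add, h1, h2, add_zero]
  | smul a x _ h => rw [smul_comm, h, smul_zero]

theorem tors_inj [IsNoetherianRing R] (I : Ideal R) (hX : Module.Injective R X) :
    Module.Injective R (tors I X) := by
  apply Module.Baer.injective
  intro a φ
  -- bound
  obtain ⟨n, hn⟩ := tors_fg_bound I (LinearMap.range ((tors I X).subtype ∘ₗ φ))
    (by rw [LinearMap.range_eq_map]; exact Submodule.FG.map _ Module.Finite.fg_top)
    (by rintro _ ⟨y, rfl⟩; exact (φ y).2)
  obtain ⟨k, hk⟩ := Ideal.exists_pow_inf_eq_pow_smul I a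
  have hAR : ∀ y : a, (y : R) ∈ I ^ (n + k) → φ y = 0 := by
    intro y hy
    have h1 := hk (n + k) (by omega)
    have h2 : (y : R) ∈ I ^ (n + k) • (⊤ : Submodule R R) ⊓ a := ⟨by simpa using hy, y.2⟩
    rw [h1, Nat.add_sub_cancel] at h2
    have h3 : (y : R) ∈ I ^ n • a := Submodule.smul_mono le_rfl inf_le_right h2
    have h4 : y ∈ I ^ n • (⊤ : Submodule R a) := by
      have : (I ^ n • (⊤ : Submodule R a)).map a.subtype = I ^ n • a := by
        rw [Submodule.map_smul'', Submodule.map_top, Submodule.range_subtype]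
      rw [← this] at h3
      obtain ⟨z, hz, hzy⟩ := h3
      rwa [← Subtype.ext hzy]
    have h5 : I ^ n • (⊤ : Submodule R a) ≤ LinearMap.ker φ := by
      rw [Submodule.smul_le]
      intro r hr z _
      rw [LinearMap.mem_ker, map_smul]
      exact Subtype.ext (hn r hr _ ⟨z, rfl⟩)
    exact h5 h4
  let S : Submodule R a := Submodule.comap a.subtype (I ^ (n + k))
  have hS : S ≤ LinearMap.ker φ := fun y hy => hAR y hy
  let j : (a ⧸ S) →ₗ[R] (R ⧸ I ^ (n+k)) := Submodule.mapQ S (I ^ (n + k)) a.subtype le_rfl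
  have hj : Function.Injective j := by
    rw [← LinearMap.ker_eq_bot]
    rw [Submodule.ker_mapQ]
    exact Submodule.mkQ_map_self _
  obtain ⟨ψ, hψ⟩ := inj_ext hX j hj ((tors I X).subtype ∘ₗ S.liftQ φ hS)
  let e : X := ψ (Submodule.Quotient.mk 1)
  have he : e ∈ tors I X := ⟨n + k, fun r hr => by
    rw [← map_smul, ← Submodule.Quotient.mk_smul, (Submodule.Quotient.mk_eq_zero _).2 (by simpa using hr), map_zero]⟩
  refine ⟨LinearMap.toSpanSingleton R _ ⟨e, he⟩, fun x hx => Subtype.ext ?_⟩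
  have := LinearMap.congr_fun hψ (Submodule.Quotient.mk ⟨x, hx⟩)
  change ψ (Submodule.Quotient.mk x) = φ ⟨x, hx⟩ at this
  rw [← this]
  change x • ψ _ = _
  rw [← map_smul, ← Submodule.Quotient.mk_smul]
  simp
end
end GGP

end PartPB

section PartPB2
namespace GGP
open CategoryTheory Abelian IsLocalRing TensorProduct

/-- coinduced module -/
def Co (A R J : Type u) [CommRing A] [CommRing R] [Algebra A R] [AddCommGroup J] [Module A J] :
    Type u := R →ₗ[A] J

namespace Co
variable {A R J : Type u} [CommRing A] [CommRing R] [Algebra A R] [AddCommGroup J] [Module A J]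
variable {B C X Y : Type u} [AddCommGroup B] [Module A B] [AddCommGroup C] [Module A C]
  [AddCommGroup X] [Module A X] [Module R X] [IsScalarTower A R X] [AddCommGroup Y] [Module A Y]

noncomputable instance : AddCommGroup (Co A R J) := inferInstanceAs (AddCommGroup (R →ₗ[A] J))
noncomputable instance : Module A (Co A R J) := inferInstanceAs (Module A (R →ₗ[A] J))
instance : FunLike (Co A R J) R J := inferInstanceAs (FunLike (R →ₗ[A] J) R J)

theorem ext {φ ψ : Co A R J} (h : ∀ s, φ s = ψ s) : φ = ψ := LinearMap.ext h
@[simp] theorem add_apply (φ ψ : Co A R J) (s : R) : (φ + ψ) s = φ s + ψ s := rfl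
@[simp] theorem zero_apply (s : R) : (0 : Co A R J) s = 0 := rfl
theorem smulA_apply (a : A) (φ : Co A R J) (s : R) : (a • φ) s = a • φ s := rfl
theorem map_add (φ : Co A R J) (s t : R) : φ (s + t) = φ s + φ t := LinearMap.map_add φ s t
theorem map_zero (φ : Co A R J) : φ 0 = 0 := LinearMap.map_zero φ
theorem map_smulA (φ : Co A R J) (a : A) (s : R) : φ (a • s) = a • φ s := LinearMap.map_smul φ a s

noncomputable instance : Module R (Co A R J) where
  smul r φ := (φ : R →ₗ[A] J) ∘ₗ LinearMap.mulLeft A r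
  one_smul φ := ext fun s => congrArg φ (one_mul s)
  mul_smul a b φ := ext fun s => congrArg φ (show a * b * s = b * (a * s) by ring)
  smul_zero a := rfl
  smul_add a φ ψ := rfl
  add_smul a b φ := ext fun s => by
    change φ ((a + b) * s) = φ (a * s) + φ (b * s)
    rw [add_mul, map_add]
  zero_smul φ := ext fun s => by
    change φ (0 * s) = 0
    rw [zero_mul, map_zero]

theorem smul_apply (r : R) (φ : Co A R J) (s : R) : (r • φ) s = φ (r * s) := rfl

instance : IsScalarTower A R (Co A R J) := ⟨fun a r φ => ext fun s => by
  rw [smulA_apply, smul_apply, smul_apply, ← map_smulA, smul_mul_assoc]⟩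

/-- evaluation at one -/
noncomputable def ev1 : Co A R J →ₗ[A] J where
  toFun φ := φ 1
  map_add' _ _ := rfl
  map_smul' _ _ := rfl

@[simp] theorem ev1_apply (φ : Co A R J) : ev1 φ = φ 1 := rfl

theorem ext1 {φ ψ : Co A R J} (h : ∀ r : R, ev1 (r • φ) = ev1 (r • ψ)) : φ = ψ :=
  ext fun s => by simpa [smul_apply] using h s

/-- adjunction -/
noncomputable def adj (f : X →ₗ[A] J) : X →ₗ[R] Co A R J where
  toFun x := { toFun := fun s => f (s • x)
               map_add' := fun s t => by rw [add_smul, _root_.map_add]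
               map_smul' := fun a s => by rw [smul_assoc, f.map_smul]; rfl }
  map_add' x y := ext fun s => by
    change f (s • (x + y)) = f (s • x) + f (s • y)
    rw [smul_add, _root_.map_add]
  map_smul' r x := ext fun s => by
    change f (s • r • x) = f ((r * s) • x)
    rw [smul_smul, mul_comm]

@[simp] theorem adj_apply (f : X →ₗ[A] J) (x : X) (s : R) : adj f x s = f (s • x) := rfl

theorem ev1_adj (f : X →ₗ[A] J) : ev1 ∘ₗ (adj f : X →ₗ[R] Co A R J).restrictScalars A = f := by
  ext x; simp

theorem adj_ev1 (φ : X →ₗ[R] Co A R J) : adj (ev1 ∘ₗ φ.restrictScalars A) = φ := by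
  ext x; apply ext; intro s; simp [smul_apply]

/-- functoriality -/
noncomputable def map (f : B →ₗ[A] C) : Co A R B →ₗ[R] Co A R C where
  toFun φ := f ∘ₗ (φ : R →ₗ[A] B)
  map_add' _ _ := ext fun s => _root_.map_add f _ _
  map_smul' _ _ := rfl

@[simp] theorem map_apply (f : B →ₗ[A] C) (φ : Co A R B) (s : R) : map f φ s = f (φ s) := rfl

theorem inj (hJ : Module.Injective A J) : Module.Injective R (Co A R J) := by
  refine inj_of_ext fun X Y f hf k => ?_
  letI := Module.compHom X (algebraMap A R)
  letI := Module.compHom Y (algebraMap A R)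
  haveI : IsScalarTower A R X := IsScalarTower.of_algebraMap_smul fun _ _ => rfl
  haveI : IsScalarTower A R Y := IsScalarTower.of_algebraMap_smul fun _ _ => rfl
  obtain ⟨k', hk'⟩ := inj_ext hJ (f.restrictScalars A) hf (ev1 ∘ₗ k.restrictScalars A)
  refine ⟨adj k', ?_⟩
  ext x
  apply ext
  intro s
  have := LinearMap.congr_fun hk' (s • x)
  simpa [smul_apply] using this

theorem ses {f : B →ₗ[A] J} {g : J →ₗ[A] C} (h : SES A f g)
    (H : ∀ k : R →ₗ[A] C, ∃ k' : R →ₗ[A] J, g ∘ₗ k' = k) :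
    SES R (map f : Co A R B →ₗ[R] _) (map g : Co A R J →ₗ[R] _) where
  inj := (h.hom H).inj
  exact := (h.hom H).exact
  surj := (h.hom H).surj

theorem lift {f : B →ₗ[A] J} {g : J →ₗ[A] C}
    (H : ∀ k : X →ₗ[A] C, ∃ k' : X →ₗ[A] J, g ∘ₗ k' = k) (k : X →ₗ[R] Co A R C) :
    ∃ k' : X →ₗ[R] Co A R J, map g ∘ₗ k' = k := by
  obtain ⟨k', hk'⟩ := H (ev1 ∘ₗ k.restrictScalars A)
  refine ⟨adj k', ?_⟩
  ext x; apply ext; intro s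
  have := LinearMap.congr_fun hk' (s • x)
  simpa [smul_apply] using this

theorem lift' {f : B →ₗ[A] J} {g : J →ₗ[A] C}
    (H : ∀ k : X →ₗ[R] Co A R C, ∃ k' : X →ₗ[R] Co A R J, map g ∘ₗ k' = k) (k : X →ₗ[A] C) :
    ∃ k' : X →ₗ[A] J, g ∘ₗ k' = k := by
  obtain ⟨k', hk'⟩ := H (adj k)
  refine ⟨ev1 ∘ₗ k'.restrictScalars A, ?_⟩
  ext x
  have := DFunLike.congr_fun (LinearMap.congr_fun hk' x) 1
  simpa using this

theorem van (hR : ∀ i, van A R Y (i+1)) (i : ℕ) (h : GGP.van A X Y i) :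
    GGP.van R X (Co A R Y) i := by
  induction i generalizing Y with
  | zero =>
    rw [van_zero_iff] at h ⊢
    intro φ
    rw [← adj_ev1 φ, h (ev1 ∘ₗ φ.restrictScalars A)]
    ext x; apply ext; intro s; simp
  | succ i ih =>
    obtain ⟨J, ι, hJ, hι⟩ := exists_inj A Y
    have hs := SES.ofQuot ι hι
    have hH := ses (R := R) hs (fun k => hs.lift (hR 0) k)
    cases i with
    | zero => exact hH.van1_of_lift (van_inj (inj hJ)) (lift (f := ι) fun k => hs.lift h k)
    | succ i =>
      refine hH.co_left (ih ?_ ?_) (van_inj (inj hJ))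
      · intro i; exact hs.co_right (van_inj hJ) (hR (i+1))
      · exact hs.co_right (van_inj hJ) h
end Co
end GGP

end PartPB2

section PartPD
namespace GGP
open CategoryTheory Abelian IsLocalRing TensorProduct

section
variable {R : Type u} [CommRing R]
variable {U V W X : Type u} [AddCommGroup U] [Module R U] [AddCommGroup V] [Module R V]
    [AddCommGroup W] [Module R W] [AddCommGroup X] [Module R X]

variable (U W X) in
/-- Hom evaluation -/
noncomputable def hev : U ⊗[R] (W →ₗ[R] X) →ₗ[R] ((U →ₗ[R] W) →ₗ[R] X) :=
  TensorProduct.lift ((LinearMap.llcomp R (U →ₗ[R] W) W X).flip ∘ₗ LinearMap.applyₗ)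

@[simp] theorem hev_tmul (u : U) (φ : W →ₗ[R] X) (θ : U →ₗ[R] W) :
    hev U W X (u ⊗ₜ φ) θ = φ (θ u) := rfl

theorem hev_nat (f : U →ₗ[R] V) (x : U ⊗[R] (W →ₗ[R] X)) (θ : V →ₗ[R] W) :
    hev V W X (f.rTensor _ x) θ = hev U W X x (θ ∘ₗ f) := by
  induction x with
  | zero => simp
  | add x y hx hy => simp [hx, hy]
  | tmul x y => simp

theorem hev_inj [IsNoetherianRing R] [Module.Finite R U] (hX : Module.Injective R X) :
    Function.Injective (hev (R := R) U W X) := by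
  obtain ⟨n, p, hp⟩ := Module.Finite.exists_fin' R U
  obtain ⟨m, q0, hq0⟩ := Module.Finite.exists_fin' R (LinearMap.ker p)
  rw [injective_iff_map_eq_zero]
  intro x hx
  obtain ⟨φ, rfl⟩ : ∃ φ : Fin n → (W →ₗ[R] X), x = ∑ i, p (Pi.single i 1) ⊗ₜ φ i := by
    clear hx
    induction x with
    | zero => exact ⟨0, by simp⟩
    | add x y hx hy =>
      obtain ⟨a, rfl⟩ := hx
      obtain ⟨b, rfl⟩ := hy
      exact ⟨a + b, by simp [TensorProduct.tmul_add, Finset.sum_add_distrib]⟩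
    | tmul u φ =>
      obtain ⟨v, rfl⟩ := hp u
      refine ⟨fun i => v i • φ, ?_⟩
      conv_lhs => rw [← Finset.univ_sum_single v]
      rw [map_sum, TensorProduct.sum_tmul]
      refine Finset.sum_congr rfl fun i _ => ?_
      rw [TensorProduct.tmul_smul, TensorProduct.smul_tmul', ← map_smul]
      congr 2
      ext j; by_cases h : j = i
      · subst h; simp
      · simp [h]
  let q : (Fin m → R) →ₗ[R] (Fin n → R) := (LinearMap.ker p).subtype ∘ₗ q0
  have hpq : ∀ v, p v = 0 ↔ ∃ w, q w = v := by
    intro v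
    constructor
    · intro hv
      obtain ⟨w, hw⟩ := hq0 ⟨v, hv⟩
      exact ⟨w, by simp [q, hw]⟩
    · rintro ⟨w, rfl⟩
      exact (q0 w).2
  -- the map W^n → W^m
  let a : Fin n → Fin m → R := fun i j => q (Pi.single j 1) i
  let T : (Fin n → W) →ₗ[R] (Fin m → W) :=
    LinearMap.pi fun j => ∑ i, a i j • LinearMap.proj i
  let Φ : (Fin n → W) →ₗ[R] X := ∑ i, φ i ∘ₗ LinearMap.proj i
  have hT : ∀ w j, T w j = ∑ i, a i j • w i := by intro w j; simp [T]
  have hker : LinearMap.ker T ≤ LinearMap.ker Φ := by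
    intro w hw
    -- w defines a map U → W
    let t : (Fin n → R) →ₗ[R] W := Fintype.linearCombination R w
    have ht : LinearMap.ker p ≤ LinearMap.ker t := by
      intro v hv
      obtain ⟨z, rfl⟩ := (hpq v).1 hv
      have : t ∘ₗ q = 0 := by
        ext j
        have := congrFun (LinearMap.mem_ker.1 hw) j
        rw [hT] at this
        simpa [t, Fintype.linearCombination_apply] using this
      exact LinearMap.congr_fun this z
    obtain ⟨θ, hθ⟩ : ∃ θ : U →ₗ[R] W, θ ∘ₗ p = t := by
      refine ⟨(LinearMap.ker p).liftQ t ht ∘ₗ (p.quotKerEquivOfSurjective hp).symm.toLinearMap, ?_⟩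
      ext v
      have : (p.quotKerEquivOfSurjective hp).symm (p (Pi.single v 1)) = Submodule.Quotient.mk (Pi.single v 1) := by
        rw [LinearEquiv.symm_apply_eq]; rfl
      simp [this]
    have h1 := LinearMap.congr_fun hx θ
    have h2 : ∀ i, θ (p (Pi.single i 1)) = w i := by
      intro i
      rw [← LinearMap.comp_apply, hθ]; simp [t, Fintype.linearCombination_apply_single]
    simpa [Φ, h2] using h1
  obtain ⟨ψ, hψ⟩ : ∃ ψ : (Fin m → W) →ₗ[R] X, ψ ∘ₗ T = Φ := by
    obtain ⟨ψ, hψ⟩ := inj_ext hX ((LinearMap.ker T).liftQ T le_rfl)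
      (LinearMap.ker_eq_bot.1 (Submodule.ker_liftQ_eq_bot _ _ _ le_rfl)) ((LinearMap.ker T).liftQ Φ hker)
    refine ⟨ψ, LinearMap.ext fun w => ?_⟩
    exact LinearMap.congr_fun hψ (Submodule.Quotient.mk w)
  apply TensorProduct.sum_tmul_eq_zero_of_vanishesTrivially
  refine ⟨m, a, fun j => ψ ∘ₗ LinearMap.single R (fun _ => W) j, ?_, ?_⟩
  · intro i
    ext w
    have := LinearMap.congr_fun hψ (Pi.single i w)
    have e1 : Φ (Pi.single i w) = φ i w := by
      simp [Φ, Pi.single_apply, apply_ite]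
    have e2 : T (Pi.single i w) = ∑ j, a i j • LinearMap.single R (fun _ => W) j w := by
      ext j
      rw [hT]
      simp [Pi.single_apply, smul_ite]
    rw [← e1, ← this]
    simp [e2]
  · intro j
    have : ∑ i, a i j • (Pi.single i 1 : Fin n → R) = q (Pi.single j 1) := by
      ext i; simp [a, Pi.single_apply]
    rw [← (hpq (q (Pi.single j 1))).2 ⟨_, rfl⟩, ← this]
    simp

theorem hev_surj [Module.Finite R U] (hX : Module.Injective R X) :
    Function.Surjective (hev (R := R) U W X) := by
  obtain ⟨n, p, hp⟩ := Module.Finite.exists_fin' R U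
  intro F
  let T : (U →ₗ[R] W) →ₗ[R] (Fin n → W) := LinearMap.pi fun i => LinearMap.applyₗ (p (Pi.single i 1))
  have hT : Function.Injective T := by
    rw [injective_iff_map_eq_zero]
    intro θ h
    have : θ ∘ₗ p = 0 := by
      ext i
      simpa [T] using congrFun h i
    ext u
    obtain ⟨v, rfl⟩ := hp u
    exact LinearMap.congr_fun this v
  obtain ⟨Φ, hΦ⟩ := inj_ext hX T hT F
  refine ⟨∑ i, p (Pi.single i 1) ⊗ₜ (Φ ∘ₗ LinearMap.single R (fun _ => W) i), ?_⟩
  ext θ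
  rw [← hΦ]
  have : T θ = ∑ i, LinearMap.single R (fun _ => W) i (θ (p (Pi.single i 1))) := by
    exact (Finset.univ_sum_single (T θ)).symm
  simp [this]

/-- injectivity of tensoring -/
theorem hev_rTensor_inj [IsNoetherianRing R] [Module.Finite R U] (hX : Module.Injective R X)
    (f : U →ₗ[R] V) (H : ∀ k : U →ₗ[R] W, ∃ k' : V →ₗ[R] W, k' ∘ₗ f = k) :
    Function.Injective (f.rTensor (W →ₗ[R] X)) := by
  rw [injective_iff_map_eq_zero]
  intro x hx
  apply hev_inj hX
  ext θ
  obtain ⟨θ', rfl⟩ := H θ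
  rw [← hev_nat, hx]; simp

theorem flat_hom [IsNoetherianRing R] (hW : Module.Injective R W) (hX : Module.Injective R X) :
    Module.Flat R (W →ₗ[R] X) := by
  rw [Module.Flat.iff_rTensor_injective']
  intro I
  exact hev_rTensor_inj hX I.subtype fun k => inj_ext hW _ I.subtype_injective k

theorem flat_van_char [Module.Flat R V] {i : ℕ} : van R W (CharacterModule V) (i+1) :=
  van_inj (Module.Flat.iff_characterModule_injective.1 inferInstance)

end
end GGP

end PartPD

section PartPD2
namespace GGP
open CategoryTheory Abelian IsLocalRing TensorProduct

section
variable {R : Type u} [CommRing R]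
variable {A B C X Y : Type u} [AddCommGroup A] [Module R A] [AddCommGroup B] [Module R B]
    [AddCommGroup C] [Module R C] [AddCommGroup X] [Module R X] [AddCommGroup Y] [Module R Y]
variable {f : A →ₗ[R] B} {g : B →ₗ[R] C}

/-- contravariant hom of a short exact sequence -/
theorem SES.homc (h : SES R f g) (H : ∀ k : A →ₗ[R] X, ∃ k' : B →ₗ[R] X, k' ∘ₗ f = k) :
    SES R (LinearMap.lcomp R X g) (LinearMap.lcomp R X f) where
  inj := by
    intro a b hab
    ext c
    obtain ⟨y, rfl⟩ := h.surj c
    exact LinearMap.congr_fun hab y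
  exact := by
    intro k
    constructor
    · intro hk
      have hker : LinearMap.ker g ≤ LinearMap.ker k := by
        intro x hx
        obtain ⟨y, rfl⟩ := (h.exact x).1 hx
        exact LinearMap.congr_fun hk y
      refine ⟨(LinearMap.ker g).liftQ k hker ∘ₗ (g.quotKerEquivOfSurjective h.surj).symm.toLinearMap, ?_⟩
      ext v
      have : (g.quotKerEquivOfSurjective h.surj).symm (g v) = Submodule.Quotient.mk v := by
        rw [LinearEquiv.symm_apply_eq]; rfl
      simp [this]
    · rintro ⟨k, rfl⟩
      ext x
      simp [h.exact.apply_apply_eq_zero]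
  surj := by
    intro k
    obtain ⟨k', hk'⟩ := H k
    exact ⟨k', by ext x; exact LinearMap.congr_fun hk' x⟩

end

section
variable (R : Type u) [CommRing R] [IsLocalRing R]

/-- Matlis module -/
structure Mat (E : Type u) [AddCommGroup E] [Module R E] (e0 : E) : Prop where
  inj : Module.Injective R E
  tor : ∀ e : E, e ∈ tors (maximalIdeal R) E
  ne : e0 ≠ 0
  soc : ∀ r ∈ maximalIdeal R, r • e0 = 0
  gen : ∀ e : E, (∀ r ∈ maximalIdeal R, r • e = 0) → ∃ r : R, e = r • e0

theorem isFiniteLength_quot_pow [IsNoetherianRing R] (s : ℕ) :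
    IsFiniteLength R (R ⧸ (maximalIdeal R) ^ s) := by
  rw [isFiniteLength_iff_isNoetherian_isArtinian]
  refine ⟨inferInstance, ?_⟩
  have : IsArtinianRing (R ⧸ (maximalIdeal R) ^ s) := by
    rw [isArtinianRing_iff_krullDimLE_zero]
    apply Ring.KrullDimLE.mk₀
    intro I hI
    have h1 : (I.comap (Ideal.Quotient.mk _)).IsPrime := Ideal.IsPrime.comap _
    have h2 : maximalIdeal R ≤ I.comap (Ideal.Quotient.mk ((maximalIdeal R) ^ s)) := by
      apply h1.le_of_pow_le (n := s)
      intro x hx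
      rw [Ideal.mem_comap, Ideal.Quotient.eq_zero_iff_mem.2 hx]
      exact I.zero_mem
    have h3 := IsLocalRing.eq_maximalIdeal (Ideal.IsMaximal.mk ⟨h1.ne_top, fun J hJ => by
      by_contra hne
      exact absurd (IsLocalRing.le_maximalIdeal hne) (not_le_of_gt (lt_of_le_of_lt h2 hJ))⟩ :
        (I.comap (Ideal.Quotient.mk ((maximalIdeal R) ^ s))).IsMaximal)
    have h4 : I = (I.comap (Ideal.Quotient.mk _)).map (Ideal.Quotient.mk ((maximalIdeal R) ^ s)) :=
      (Ideal.map_comap_of_surjective _ Ideal.Quotient.mk_surjective I).symm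
    rw [h4, h3]
    apply (Ideal.map_eq_top_or_isMaximal_of_surjective _ Ideal.Quotient.mk_surjective
      (maximalIdeal.isMaximal R)).resolve_left
    have h5 := h4
    rw [h3] at h5
    rw [← h5]; exact hI.ne_top
  exact isArtinian_of_surjective_algebraMap (R := R ⧸ (maximalIdeal R) ^ s)
    (Ideal.Quotient.mk_surjective)

variable {R} {E : Type u} [AddCommGroup E] [Module R E] {e0 : E}
variable {N X Y : Type u} [AddCommGroup N] [Module R N] [AddCommGroup X] [Module R X]
  [AddCommGroup Y] [Module R Y]

theorem Mat.length_le (hE : Mat R E e0) (hN : IsFiniteLength R N) :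
    Module.length R (N →ₗ[R] E) ≤ Module.length R N := by
  induction hN with
  | of_subsingleton => simp
  | @of_simple_quotient N _ _ S hs _ ih =>
    have hses := SES.ofSub S
    rw [Module.length_eq_add_of_exact _ _ hses.inj hses.surj hses.exact]
    have h2 := hses.homc (X := E) fun k => inj_ext hE.inj _ hses.inj k
    rw [Module.length_eq_add_of_exact _ _ h2.inj h2.surj h2.exact, add_comm]
    gcongr
    obtain ⟨I, hI, ⟨e⟩⟩ := isSimpleModule_iff_quot_maximal.mp hs
    obtain rfl := IsLocalRing.eq_maximalIdeal hI
    let h0 : (R ⧸ maximalIdeal R) →ₗ[R] E := (maximalIdeal R).liftQ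
      (LinearMap.toSpanSingleton R E e0) (fun r hr => hE.soc r hr)
    let T : (R ⧸ maximalIdeal R) →ₗ[R] ((N ⧸ S) →ₗ[R] E) := (maximalIdeal R).liftQ
      (LinearMap.toSpanSingleton R _ (h0 ∘ₗ e.toLinearMap)) (by
        intro r hr
        rw [LinearMap.mem_ker]
        refine LinearMap.ext fun x => ?_
        obtain ⟨y, hy⟩ := Ideal.Quotient.mk_surjective (e x)
        change r • h0 (e x) = 0
        rw [← hy, ← map_smul]
        change h0 (Ideal.Quotient.mk _ (r * y)) = 0
        rw [Ideal.Quotient.eq_zero_iff_mem.2 (Ideal.mul_mem_right _ _ hr), map_zero])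
    rw [e.length_eq]
    refine Module.length_le_of_surjective T fun k => ?_
    obtain ⟨r, hr⟩ := hE.gen (k (e.symm (Ideal.Quotient.mk _ 1))) (by
      intro r hr
      rw [← map_smul, ← map_smul]
      have : r • Ideal.Quotient.mk (maximalIdeal R) 1 = 0 := by
        change Ideal.Quotient.mk (maximalIdeal R) (r * 1) = 0
        rw [Ideal.Quotient.eq_zero_iff_mem, mul_one]; exact hr
      rw [this]; simp)
    refine ⟨Ideal.Quotient.mk _ r, ?_⟩
    have h1 : T (Ideal.Quotient.mk _ r) = r • (h0 ∘ₗ e.toLinearMap) := rfl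
    rw [h1]
    refine LinearMap.ext fun x => ?_
    obtain ⟨y, rfl⟩ := e.symm.surjective x
    obtain ⟨y, rfl⟩ := Ideal.Quotient.mk_surjective y
    have h3 : Ideal.Quotient.mk (maximalIdeal R) y = y • Ideal.Quotient.mk (maximalIdeal R) 1 := by
      change _ = Ideal.Quotient.mk (maximalIdeal R) (y * 1)
      rw [mul_one]
    have h4 : h0 (Ideal.Quotient.mk (maximalIdeal R) 1) = e0 := by
      change (1 : R) • e0 = e0
      simp
    rw [h3]
    simp only [map_smul, LinearMap.smul_apply, LinearMap.comp_apply, LinearEquiv.coe_coe,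
      LinearEquiv.apply_symm_apply, h4]
    rw [hr]

/-- submodule killed by a power -/
def kil (I : Ideal R) (s : ℕ) (X : Type u) [AddCommGroup X] [Module R X] : Submodule R X where
  carrier := {x | ∀ r ∈ I ^ s, r • x = 0}
  zero_mem' := by simp
  add_mem' := by
    intro a b ha hb r hr
    rw [smul_add, ha r hr, hb r hr, add_zero]
  smul_mem' := by
    intro c x hx r hr
    rw [smul_comm, hx r hr, smul_zero]

/-- homs from a cyclic module -/
noncomputable def homKil (s : ℕ) :
    kil (maximalIdeal R) s X ≃ₗ[R] ((R ⧸ (maximalIdeal R) ^ s) →ₗ[R] X) :=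
  LinearEquiv.ofBijective
    { toFun := fun x : kil (maximalIdeal R) s X =>
        ((maximalIdeal R) ^ s).liftQ (LinearMap.toSpanSingleton R X x.1) (fun r hr => x.2 r hr)
      map_add' := by
        intro x y
        refine LinearMap.ext fun z => ?_
        obtain ⟨z, rfl⟩ := Ideal.Quotient.mk_surjective z
        exact smul_add z (x : X) (y : X)
      map_smul' := by
        intro c x
        refine LinearMap.ext fun z => ?_
        obtain ⟨z, rfl⟩ := Ideal.Quotient.mk_surjective z
        exact smul_comm z c (x : X) }
    (by
      constructor
      · intro x y hxy
        have := LinearMap.congr_fun hxy (Ideal.Quotient.mk _ 1)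
        have h2 : (1 : R) • (x : X) = (1 : R) • (y : X) := this
        ext; simpa using h2
      · intro k
        refine ⟨⟨k (Ideal.Quotient.mk _ 1), ?_⟩, ?_⟩
        · intro r hr
          rw [← map_smul]
          have : r • Ideal.Quotient.mk ((maximalIdeal R) ^ s) 1 = 0 := by
            change Ideal.Quotient.mk _ (r * 1) = 0
            rw [Ideal.Quotient.eq_zero_iff_mem, mul_one]; exact hr
          rw [this, map_zero]
        · ext
          change (1 : R) • k (Ideal.Quotient.mk _ 1) = _
          rw [one_smul]; rfl)

theorem Mat.cogen (hE : Mat R E e0) (y : Y) (hy : y ≠ 0) : ∃ φ : Y →ₗ[R] E, φ y ≠ 0 := by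
  have hle : LinearMap.ker (LinearMap.toSpanSingleton R Y y) ≤ maximalIdeal R := by
    apply IsLocalRing.le_maximalIdeal
    rw [Ideal.ne_top_iff_one]
    simpa using hy
  have : LinearMap.ker (LinearMap.toSpanSingleton R Y y) ≤ LinearMap.ker (LinearMap.toSpanSingleton R E e0) :=
    fun r hr => hE.soc r (hle hr)
  obtain ⟨φ, hφ⟩ := inj_ext hE.inj
    ((LinearMap.ker (LinearMap.toSpanSingleton R Y y)).liftQ _ le_rfl)
    (LinearMap.ker_eq_bot.1 (Submodule.ker_liftQ_eq_bot _ _ _ le_rfl))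
    ((LinearMap.ker (LinearMap.toSpanSingleton R Y y)).liftQ (LinearMap.toSpanSingleton R E e0) this)
  refine ⟨φ, ?_⟩
  have h := LinearMap.congr_fun hφ (Submodule.Quotient.mk 1)
  have h2 : φ ((1 : R) • y) = (1 : R) • e0 := h
  rw [one_smul, one_smul] at h2
  rw [h2]; exact hE.ne

theorem Mat.kil_fl [IsNoetherianRing R] (hE : Mat R E e0) (s : ℕ) :
    Module.length R (kil (maximalIdeal R) s E) ≤ Module.length R (R ⧸ (maximalIdeal R) ^ s) := by
  rw [(homKil s).length_eq]
  exact hE.length_le (isFiniteLength_quot_pow R s)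

theorem Mat.kil_ifl [IsNoetherianRing R] (hE : Mat R E e0) (s : ℕ) :
    IsFiniteLength R (kil (maximalIdeal R) s E) := by
  rw [← Module.length_ne_top_iff]
  exact ne_top_of_le_ne_top (Module.length_ne_top_iff.2 (isFiniteLength_quot_pow R s)) (hE.kil_fl s)

theorem Mat.kil_fin [IsNoetherianRing R] (hE : Mat R E e0) (s : ℕ) :
    Module.Finite R (kil (maximalIdeal R) s E) := by
  have := (isFiniteLength_iff_isNoetherian_isArtinian.1 (hE.kil_ifl s)).1
  infer_instance

theorem Mat.ann [IsNoetherianRing R] (hE : Mat R E e0) (s : ℕ) (r : R)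
    (h : ∀ e ∈ kil (maximalIdeal R) s E, r • e = 0) : r ∈ (maximalIdeal R) ^ s := by
  by_contra hr
  obtain ⟨φ, hφ⟩ := hE.cogen (Ideal.Quotient.mk ((maximalIdeal R) ^ s) r)
    (by rwa [Ne, Ideal.Quotient.eq_zero_iff_mem])
  apply hφ
  have := h _ ((homKil s).symm φ).2
  rw [← Submodule.coe_smul, ← map_smul] at this
  have h2 := (LinearEquiv.map_eq_zero_iff _).1 (Subtype.ext this : (homKil s).symm (r • φ) = 0)
  have h3 := LinearMap.congr_fun h2 (Ideal.Quotient.mk _ 1)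
  rw [LinearMap.smul_apply, ← map_smul] at h3
  refine Eq.trans ?_ h3
  congr 1
  change _ = Ideal.Quotient.mk ((maximalIdeal R) ^ s) (r * 1)
  rw [mul_one]

/-- every hom from the truncation is a scalar -/
theorem Mat.scalar [IsNoetherianRing R] (hE : Mat R E e0) (s : ℕ)
    (θ : kil (maximalIdeal R) s E →ₗ[R] E) : ∃ r : R, ∀ x, θ x = r • (x : E) := by
  let T : (R ⧸ (maximalIdeal R) ^ s) →ₗ[R] (kil (maximalIdeal R) s E →ₗ[R] E) :=
    ((maximalIdeal R) ^ s).liftQ (LinearMap.toSpanSingleton R _ (kil (maximalIdeal R) s E).subtype) (by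
      intro r hr
      rw [LinearMap.mem_ker]
      ext x
      exact x.2 r hr)
  have hT : Function.Injective T := by
    rw [injective_iff_map_eq_zero]
    intro x hx
    obtain ⟨r, rfl⟩ := Ideal.Quotient.mk_surjective x
    rw [Ideal.Quotient.eq_zero_iff_mem]
    exact hE.ann s r fun e he => LinearMap.congr_fun hx ⟨e, he⟩
  have hlen : Module.length R (kil (maximalIdeal R) s E →ₗ[R] E) ≤
      Module.length R (LinearMap.range T) := by
    rw [← (LinearEquiv.ofInjective T hT).length_eq]
    exact (hE.length_le (hE.kil_ifl s)).trans (hE.kil_fl s)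
  have hfl : IsFiniteLength R (kil (maximalIdeal R) s E →ₗ[R] E) := by
    rw [← Module.length_ne_top_iff]
    exact ne_top_of_le_ne_top (Module.length_ne_top_iff.2 (hE.kil_ifl s)) (hE.length_le (hE.kil_ifl s))
  obtain ⟨_, _⟩ := isFiniteLength_iff_isNoetherian_isArtinian.1 hfl
  have htop : LinearMap.range T = ⊤ := by
    by_contra hne
    exact absurd hlen (not_le_of_gt (Submodule.length_lt hne))
  obtain ⟨x, hx⟩ : θ ∈ LinearMap.range T := by rw [htop]; trivial
  obtain ⟨r, rfl⟩ := Ideal.Quotient.mk_surjective x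
  exact ⟨r, fun y => (LinearMap.congr_fun hx y).symm⟩

theorem Mat.bass [IsNoetherianRing R] (hE : Mat R E e0) (hX : Module.Injective R X)
    (hXt : ∀ x : X, x ∈ tors (maximalIdeal R) X) : Bass R E X where
  ext i := van_inj hX
  tor i := by
    have := flat_hom hE.inj hX
    exact flat_van_char
  bij := by
    have hfl := flat_hom hE.inj hX
    have key : ∀ s (x : kil (maximalIdeal R) s E ⊗[R] (E →ₗ[R] X)),
        ev E X ((kil (maximalIdeal R) s E).subtype.rTensor _ x) = hev _ E X x (Submodule.subtype _) := by
      intro s x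
      induction x with
      | zero => simp
      | add x y hx hy => simp [hx, hy]
      | tmul x y => simp [ev_tmul]
    constructor
    · rw [injective_iff_map_eq_zero]
      intro z hz
      obtain ⟨s, x, rfl⟩ : ∃ s, ∃ x : kil (maximalIdeal R) s E ⊗[R] (E →ₗ[R] X),
          (kil (maximalIdeal R) s E).subtype.rTensor _ x = z := by
        clear hz
        induction z with
        | zero => exact ⟨0, 0, by simp⟩
        | tmul e φ =>
          obtain ⟨s, hs⟩ := hE.tor e
          exact ⟨s, (⟨e, hs⟩ : kil (maximalIdeal R) s E) ⊗ₜ φ, by simp⟩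
        | add x y hx hy =>
          obtain ⟨s, x, rfl⟩ := hx
          obtain ⟨t, y, rfl⟩ := hy
          have hs : kil (maximalIdeal R) s E ≤ kil (maximalIdeal R) (s+t) E :=
            fun x hx r hr => hx r (Ideal.pow_le_pow_right (by omega) hr)
          have ht : kil (maximalIdeal R) t E ≤ kil (maximalIdeal R) (s+t) E :=
            fun x hx r hr => hx r (Ideal.pow_le_pow_right (by omega) hr)
          refine ⟨s+t, (Submodule.inclusion hs).rTensor _ x + (Submodule.inclusion ht).rTensor _ y, ?_⟩
          rw [map_add, ← LinearMap.comp_apply, ← LinearMap.comp_apply, ← LinearMap.rTensor_comp,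
            ← LinearMap.rTensor_comp]
          rfl
      rw [key] at hz
      have := hE.kil_fin s
      have hx : x = 0 := by
        apply hev_inj hX
        ext θ
        obtain ⟨r, hr⟩ := hE.scalar s θ
        have : θ = r • (kil (maximalIdeal R) s E).subtype := by ext x; simp [hr]
        rw [this, map_smul, hz]; simp
      rw [hx, map_zero]
    · intro x
      obtain ⟨s, hs⟩ := hXt x
      have := hE.kil_fin s
      -- the map (E_s → E) → X
      let T : (R ⧸ (maximalIdeal R) ^ s) →ₗ[R] (kil (maximalIdeal R) s E →ₗ[R] E) :=
        ((maximalIdeal R) ^ s).liftQ (LinearMap.toSpanSingleton R _ (kil (maximalIdeal R) s E).subtype) (by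
          intro r hr
          rw [LinearMap.mem_ker]
          ext x
          exact x.2 r hr)
      have hT : Function.Injective T := by
        rw [injective_iff_map_eq_zero]
        intro x hx
        obtain ⟨r, rfl⟩ := Ideal.Quotient.mk_surjective x
        rw [Ideal.Quotient.eq_zero_iff_mem]
        exact hE.ann s r fun e he => LinearMap.congr_fun hx ⟨e, he⟩
      obtain ⟨F, hF⟩ := inj_ext hX T hT (homKil s ⟨x, hs⟩)
      obtain ⟨z, rfl⟩ := hev_surj hX F
      refine ⟨(kil (maximalIdeal R) s E).subtype.rTensor _ z, ?_⟩
      rw [key]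
      have h1 := LinearMap.congr_fun hF (Ideal.Quotient.mk _ 1)
      have h2 : T (Ideal.Quotient.mk _ 1) = (kil (maximalIdeal R) s E).subtype := by
        exact one_smul R ((kil (maximalIdeal R) s E).subtype)
      rw [LinearMap.comp_apply, h2] at h1
      rw [h1]
      change (1 : R) • x = x
      rw [one_smul]

variable (R) in
theorem exists_mat [IsNoetherianRing R] : ∃ (E : ModuleCat.{u} R) (e0 : E), Mat R E e0 := by
  obtain ⟨J, ι, hJ, hess⟩ := exists_hull R (R ⧸ maximalIdeal R)
  have hk : ∀ r ∈ maximalIdeal R, ∀ x : R ⧸ maximalIdeal R, r • x = 0 := by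
    intro r hr x
    obtain ⟨y, rfl⟩ := Ideal.Quotient.mk_surjective x
    change Ideal.Quotient.mk (maximalIdeal R) (r * y) = 0
    rw [Ideal.Quotient.eq_zero_iff_mem]; exact Ideal.mul_mem_right _ _ hr
  have hmem : ∀ x, ι x ∈ tors (maximalIdeal R) J := fun x => ⟨1, fun r hr => by
    rw [pow_one] at hr
    rw [← map_smul, hk r hr, map_zero]⟩
  refine ⟨ModuleCat.of R (tors (maximalIdeal R) J), ⟨ι (Ideal.Quotient.mk _ 1), hmem _⟩,
    tors_inj _ hJ, ?_, ?_, ?_, ?_⟩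
  · rintro ⟨e, n, hn⟩
    exact ⟨n, fun r hr => Subtype.ext (hn r hr)⟩
  · intro h
    have h1 : ι (Ideal.Quotient.mk _ 1) = 0 := congrArg Subtype.val h
    have h2 := hess.1 (h1.trans (map_zero ι).symm)
    rw [Ideal.Quotient.eq_zero_iff_mem] at h2
    exact (maximalIdeal.isMaximal R).ne_top ((Ideal.eq_top_iff_one _).2 h2)
  · intro r hr
    apply Subtype.ext
    change r • ι (Ideal.Quotient.mk _ 1) = 0
    rw [← map_smul, hk r hr, map_zero]
  · rintro ⟨e, he⟩ hkill
    by_cases h0 : e = 0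
    · exact ⟨0, by apply Subtype.ext; simp [h0]⟩
    obtain ⟨r, hr, x, hx⟩ := hess.2 e h0
    have hr2 : IsUnit r := by
      by_contra hu
      exact hr (congrArg Subtype.val (hkill r ((mem_maximalIdeal r).2 hu)))
    obtain ⟨y, rfl⟩ := Ideal.Quotient.mk_surjective x
    obtain ⟨v, hv⟩ := hr2.exists_left_inv
    refine ⟨v * y, ?_⟩
    apply Subtype.ext
    change e = (v * y) • ι (Ideal.Quotient.mk _ 1)
    have h3 : Ideal.Quotient.mk (maximalIdeal R) y = y • Ideal.Quotient.mk (maximalIdeal R) 1 := by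
      change _ = Ideal.Quotient.mk (maximalIdeal R) (y * 1)
      rw [mul_one]
    rw [h3, map_smul] at hx
    rw [mul_smul, hx, smul_smul, hv, one_smul]

/-- Lemma N -/
theorem lemN [IsNoetherianRing R] {A B : Type u} [AddCommGroup A] [Module R A] [AddCommGroup B]
    [Module R B] (f : A →ₗ[R] B) (hEt : ∀ e : E, e ∈ tors (maximalIdeal R) E)
    (hEm : (maximalIdeal R) • (⊤ : Submodule R E) ≠ ⊤)
    (hA : Bass R E A) (hB : Bass R E B)
    (hW : LinearMap.range f ⊔ (maximalIdeal R) • (⊤ : Submodule R B) = ⊤) (k : E →ₗ[R] B) :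
    ∃ k' : E →ₗ[R] A, f ∘ₗ k' = k := by
  set m := maximalIdeal R
  let F : (E →ₗ[R] A) →ₗ[R] (E →ₗ[R] B) := LinearMap.compRight R f
  -- Step 1 : range F ⊔ m Hom = ⊤
  have step1 : LinearMap.range F ⊔ m • (⊤ : Submodule R (E →ₗ[R] B)) = ⊤ := by
    by_contra hne
    let Q := (E →ₗ[R] B) ⧸ (LinearMap.range F ⊔ m • (⊤ : Submodule R (E →ₗ[R] B)))
    obtain ⟨b, hb⟩ : ∃ b, b ∉ LinearMap.range F ⊔ m • (⊤ : Submodule R (E →ₗ[R] B)) := by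
      by_contra h; push Not at h
      exact hne (eq_top_iff.2 fun x _ => h x)
    obtain ⟨e, he⟩ : ∃ e, e ∉ m • (⊤ : Submodule R E) := by
      by_contra h; push Not at h
      exact hEm (eq_top_iff.2 fun x _ => h x)
    -- E ⊗ Hom(E,B) → E/mE ⊗ Q
    let q1 := (m • (⊤ : Submodule R E)).mkQ
    let q2 := (LinearMap.range F ⊔ m • (⊤ : Submodule R (E →ₗ[R] B))).mkQ
    let T := TensorProduct.map q1 q2
    have hTF : ∀ x, T (F.lTensor E x) = 0 := by
      intro x
      induction x with
      | zero => simp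
      | add x y hx hy => rw [map_add, map_add, hx, hy, add_zero]
      | tmul x y =>
        have : q2 (F y) = 0 := (Submodule.Quotient.mk_eq_zero _).2 (Submodule.mem_sup_left ⟨y, rfl⟩)
        simp [T, this]
    have hTm : ∀ r ∈ m, ∀ x, T (r • x) = 0 := by
      intro r hr x
      induction x with
      | zero => simp
      | add x y hx hy => rw [smul_add, map_add, hx, hy, add_zero]
      | tmul x y =>
        have : q1 (r • x) = 0 := (Submodule.Quotient.mk_eq_zero _).2
          (Submodule.smul_mem_smul hr trivial)
        rw [TensorProduct.smul_tmul']
        simp only [T, TensorProduct.map_tmul, this, TensorProduct.zero_tmul]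
    have hT0 : ∀ x, T x = 0 := by
      -- via the isomorphism
      have h1 : ∀ y : B, ∃ x, ev E B x = y ∧ T x = 0 := by
        intro y
        have hy : y ∈ LinearMap.range f ⊔ m • (⊤ : Submodule R B) := by rw [hW]; trivial
        obtain ⟨y1, ⟨a, rfl⟩, y2, hy2, rfl⟩ := Submodule.mem_sup.1 hy
        obtain ⟨xa, rfl⟩ := hA.bij.2 a
        obtain ⟨x2, hx2, hx20⟩ : ∃ x, ev E B x = y2 ∧ T x = 0 := by
          clear hy
          induction hy2 using Submodule.smul_induction_on' with
          | smul r hr n _ =>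
            obtain ⟨x, rfl⟩ := hB.bij.2 n
            exact ⟨r • x, map_smul _ _ _, hTm r hr x⟩
          | add x _ y _ hx hy =>
            obtain ⟨x1, rfl, h1⟩ := hx
            obtain ⟨x2, rfl, h2⟩ := hy
            exact ⟨x1 + x2, map_add _ _ _, by rw [map_add, h1, h2, add_zero]⟩
        refine ⟨F.lTensor E xa + x2, ?_, by rw [map_add, hTF, hx20, add_zero]⟩
        rw [map_add, hx2]
        congr 1
        exact ev_nat E f xa
      intro x
      obtain ⟨x', hx', h0⟩ := h1 (ev E B x)
      rw [← hB.bij.1 hx']; exact h0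
    have h2 := hT0 (e ⊗ₜ b)
    -- E/mE ⊗ Q over the residue field
    let k := R ⧸ m
    letI : Field k := Ideal.Quotient.field m
    have hq1 : q1 e ≠ 0 := fun h => he ((Submodule.Quotient.mk_eq_zero _).1 h)
    have hq2 : q2 b ≠ 0 := fun h => hb ((Submodule.Quotient.mk_eq_zero _).1 h)
    have tb1 : Module.IsTorsionBySet R (E ⧸ (m • (⊤ : Submodule R E))) m := by
      rintro x ⟨r, hr⟩
      obtain ⟨x, rfl⟩ := Submodule.mkQ_surjective _ x
      change r • Submodule.mkQ _ x = 0
      rw [← map_smul]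
      exact (Submodule.Quotient.mk_eq_zero _).2 (Submodule.smul_mem_smul hr trivial)
    have tb2 : Module.IsTorsionBySet R Q m := by
      rintro x ⟨r, hr⟩
      obtain ⟨x, rfl⟩ := Submodule.mkQ_surjective _ x
      change r • Submodule.mkQ _ x = 0
      rw [← map_smul]
      exact (Submodule.Quotient.mk_eq_zero _).2
        (Submodule.mem_sup_right (Submodule.smul_mem_smul hr trivial))
    letI := tb1.module
    letI := tb2.module
    haveI : IsScalarTower R k (E ⧸ (m • (⊤ : Submodule R E))) := tb1.isScalarTower
    haveI : IsScalarTower R k Q := tb2.isScalarTower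
    obtain ⟨l1, hl1⟩ : ∃ l : (E ⧸ (m • (⊤ : Submodule R E))) →ₗ[k] k, l (q1 e) ≠ 0 :=
      Module.Projective.exists_dual_ne_zero k hq1
    obtain ⟨l2, hl2⟩ : ∃ l : Q →ₗ[k] k, l (q2 b) ≠ 0 :=
      Module.Projective.exists_dual_ne_zero k hq2
    have h3 := congrArg (LinearMap.mul' R k) (congrArg (TensorProduct.map (l1.restrictScalars R) (l2.restrictScalars R)) h2)
    simp only [T, TensorProduct.map_tmul, map_zero, LinearMap.mul'_apply] at h3
    exact (mul_ne_zero hl1 hl2) h3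
  -- Step 2: approximations
  have step2 : ∀ s, ∀ b ∈ m ^ s • (⊤ : Submodule R (E →ₗ[R] B)),
      ∃ a ∈ m ^ s • (⊤ : Submodule R (E →ₗ[R] A)), b - F a ∈ m ^ (s+1) • (⊤ : Submodule R (E →ₗ[R] B)) := by
    intro s b hb
    induction hb using Submodule.smul_induction_on' with
    | smul r hr n _ =>
      have hn : n ∈ LinearMap.range F ⊔ m • (⊤ : Submodule R (E →ₗ[R] B)) := by rw [step1]; trivial
      obtain ⟨y1, ⟨a, rfl⟩, y2, hy2, rfl⟩ := Submodule.mem_sup.1 hn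
      refine ⟨r • a, Submodule.smul_mem_smul hr trivial, ?_⟩
      rw [map_smul, smul_add, add_sub_cancel_left, pow_succ, Submodule.mul_smul]
      exact Submodule.smul_mem_smul hr hy2
    | add x _ y _ hx hy =>
      obtain ⟨a, ha, h1⟩ := hx
      obtain ⟨c, hc, h2⟩ := hy
      refine ⟨a + c, add_mem ha hc, ?_⟩
      rw [map_add, add_sub_add_comm]
      exact add_mem h1 h2
  choose! α hα hα2 using step2
  let bs : ℕ → (E →ₗ[R] B) := fun n => Nat.rec k (fun s b => b - F (α s b)) n
  have hbs : ∀ s, bs s ∈ m ^ s • (⊤ : Submodule R (E →ₗ[R] B)) := by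
    intro s
    induction s with
    | zero => simp
    | succ s ih => exact hα2 s _ ih
  let as : ℕ → (E →ₗ[R] A) := fun s => α s (bs s)
  have has : ∀ s, as s ∈ m ^ s • (⊤ : Submodule R (E →ₗ[R] A)) := fun s => hα s _ (hbs s)
  have hvan : ∀ {C : Type u} [AddCommGroup C] [Module R C] (s : ℕ) (φ : E →ₗ[R] C),
      φ ∈ m ^ s • (⊤ : Submodule R (E →ₗ[R] C)) → ∀ e ∈ kil m s E, φ e = 0 := by
    intro C _ _ s φ hφ e he
    induction hφ using Submodule.smul_induction_on' with
    | smul r hr n _ => rw [LinearMap.smul_apply, ← map_smul, he r hr, map_zero]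
    | add x _ y _ hx hy => rw [LinearMap.add_apply, hx, hy, add_zero]
  have hmono : ∀ s t, s ≤ t → kil m s E ≤ kil m t E :=
    fun s t h x hx r hr => hx r (Ideal.pow_le_pow_right h hr)
  have hsum : ∀ n, ∑ s ∈ Finset.range n, F (as s) = k - bs n := by
    intro n
    induction n with
    | zero => simp [bs]
    | succ n ih =>
      rw [Finset.sum_range_succ, ih]
      change _ = k - (bs n - F (as n))
      abel
  choose ν hν using hEt
  have hstab : ∀ e n, e ∈ kil m n E → ∀ n', n ≤ n' →
      ∑ s ∈ Finset.range n', as s e = ∑ s ∈ Finset.range n, as s e := by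
    intro e n he n' hn
    symm
    apply Finset.sum_subset (Finset.range_mono hn)
    intro s _ hs
    exact hvan s _ (has s) e (hmono n s (by simpa using hs) he)
  have hstab2 : ∀ e n, e ∈ kil m n E →
      ∑ s ∈ Finset.range (ν e), as s e = ∑ s ∈ Finset.range n, as s e := by
    intro e n he
    rcases le_total n (ν e) with h | h
    · exact hstab e n he _ h
    · exact (hstab e _ (hν e) _ h).symm
  refine ⟨{ toFun := fun e => ∑ s ∈ Finset.range (ν e), as s e, map_add' := ?_, map_smul' := ?_ }, ?_⟩
  · intro x y
    have hx := hmono _ (ν x + ν y) (by omega) (hν x)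
    have hy := hmono _ (ν x + ν y) (by omega) (hν y)
    rw [hstab2 _ _ hx, hstab2 _ _ hy, hstab2 _ _ (add_mem hx hy), ← Finset.sum_add_distrib]
    simp
  · intro r x
    rw [hstab2 _ _ (Submodule.smul_mem _ r (hν x)), RingHom.id_apply, Finset.smul_sum]
    simp
  · ext e
    have h1 := LinearMap.congr_fun (hsum (ν e)) e
    rw [LinearMap.sub_apply, hvan _ _ (hbs _) e (hν e), sub_zero] at h1
    rw [← h1]
    simp [F]
end
end GGP

end PartPD2

section PartPE
namespace GGP
open CategoryTheory Abelian IsLocalRing TensorProduct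

section
variable {R : Type u} [CommRing R]
variable {A B C X Y : Type u} [AddCommGroup A] [Module R A] [AddCommGroup B] [Module R B]
    [AddCommGroup C] [Module R C] [AddCommGroup X] [Module R X] [AddCommGroup Y] [Module R Y]
variable {f : A →ₗ[R] B} {g : B →ₗ[R] C}

variable (R) in
/-- chain form of Gorenstein injectivity -/
def IsGI (G : Type u) [AddCommGroup G] [Module R G] : Prop :=
  ∃ (Z X : ℤ → ModuleCat.{u} R) (ι : ∀ k, Z k →ₗ[R] X k) (π : ∀ k, X k →ₗ[R] Z (k+1)),
    (∀ k, SES R (ι k) (π k)) ∧ (∀ k, Module.Injective R (X k)) ∧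
    (∀ (I : ModuleCat.{u} R), Module.Injective R I → ∀ k, ∀ t : I →ₗ[R] Z (k+1),
      ∃ t' : I →ₗ[R] X k, π k ∘ₗ t' = t) ∧ Nonempty (G ≃ₗ[R] Z 0)

theorem isGI_iff (G : Type u) [AddCommGroup G] [Module R G] :
    GG.IsGorensteinInjective R G ↔ IsGI R G := by
  constructor
  · rintro ⟨X, d, hX, hd, hl, ⟨e⟩⟩
    have hmem : ∀ k x, d k x ∈ LinearMap.ker (d (k+1)) := by
      intro k x; rw [← hd]; exact ⟨x, rfl⟩
    refine ⟨fun k => ModuleCat.of R (LinearMap.ker (d k)), X, fun k => (LinearMap.ker (d k)).subtype,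
      fun k => (d k).codRestrict _ (hmem k), ?_, hX, ?_, ⟨e⟩⟩
    · intro k
      refine ⟨Subtype.val_injective, ?_, ?_⟩
      · intro x
        constructor
        · intro hx
          exact ⟨⟨x, congrArg Subtype.val hx⟩, rfl⟩
        · rintro ⟨x, rfl⟩
          exact Subtype.ext x.2
      · rintro ⟨x, hx⟩
        rw [← hd] at hx
        obtain ⟨y, rfl⟩ := hx
        exact ⟨y, rfl⟩
    · intro I hI k t
      obtain ⟨ψ, hψ⟩ := hl I hI k ((LinearMap.ker (d (k+1))).subtype ∘ₗ t) (by
        ext x; exact (t x).2)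
      refine ⟨ψ, ?_⟩
      ext x
      exact LinearMap.congr_fun hψ x
  · rintro ⟨Z, X, ι, π, h, hX, hl, ⟨e⟩⟩
    have hk : ∀ k, LinearMap.ker (ι (k+1) ∘ₗ π k) = LinearMap.range (ι k) := by
      intro k
      ext x
      rw [LinearMap.mem_ker, LinearMap.comp_apply, LinearMap.mem_range]
      rw [← Set.mem_range, ← (h k).exact x]
      constructor
      · intro hx; exact (h (k+1)).inj (hx.trans (map_zero _).symm)
      · intro hx; rw [hx, map_zero]
    refine ⟨X, fun k => ι (k+1) ∘ₗ π k, hX, ?_, ?_, ?_⟩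
    · intro k
      rw [hk]
      ext x
      constructor
      · rintro ⟨y, rfl⟩; exact ⟨_, rfl⟩
      · rintro ⟨y, rfl⟩
        obtain ⟨z, rfl⟩ := (h k).surj y
        exact ⟨z, rfl⟩
    · intro I hI k φ hφ
      have h1 : ∀ x, φ x ∈ LinearMap.range (ι (k+1)) := by
        intro x; rw [← hk]; exact LinearMap.congr_fun hφ x
      let e := LinearEquiv.ofInjective (ι (k+1)) (h (k+1)).inj
      obtain ⟨t', ht'⟩ := hl I hI k (e.symm.toLinearMap ∘ₗ φ.codRestrict _ h1)
      refine ⟨t', ?_⟩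
      ext x
      have h2 := LinearMap.congr_fun ht' x
      rw [LinearMap.comp_apply] at h2
      rw [LinearMap.comp_apply, LinearMap.comp_apply, h2]
      exact congrArg Subtype.val (e.apply_symm_apply (φ.codRestrict _ h1 x))
    · exact ⟨e ≪≫ₗ (LinearEquiv.ofInjective (ι 0) (h 0).inj) ≪≫ₗ LinearEquiv.ofEq _ _ (hk 0).symm⟩

theorem gi_van_inj {Z X : ℤ → ModuleCat.{u} R} {ι : ∀ k, Z k →ₗ[R] X k}
    {π : ∀ k, X k →ₗ[R] Z (k+1)} (h : ∀ k, SES R (ι k) (π k)) (hX : ∀ k, Module.Injective R (X k))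
    (I : Type u) [AddCommGroup I] [Module R I]
    (hl : ∀ k, ∀ t : I →ₗ[R] Z (k+1), ∃ t' : I →ₗ[R] X k, π k ∘ₗ t' = t) (i : ℕ) :
    ∀ k, van R I (Z k) (i+1) := by
  induction i with
  | zero => intro k; exact (h k).van1_of_lift (van_inj (hX k)) (hl k)
  | succ i ih => intro k; exact (h k).co_left (ih (k+1)) (van_inj (hX k))

theorem IsGI.van_inj {G : Type u} [AddCommGroup G] [Module R G] (hG : IsGI R G)
    (hX : Module.Injective R X) (i : ℕ) : van R X G (i+1) := by
  obtain ⟨Z, X', ι, π, h, hX', hl, ⟨e⟩⟩ := hG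
  exact van_congr_right e (gi_van_inj h hX' X (hl (ModuleCat.of R X) hX) i 0)

theorem gi_van_pd {Z X : ℤ → ModuleCat.{u} R} {ι : ∀ k, Z k →ₗ[R] X k}
    {π : ∀ k, X k →ₗ[R] Z (k+1)} (h : ∀ k, SES R (ι k) (π k)) (hX : ∀ k, Module.Injective R (X k))
    (P : Type u) [AddCommGroup P] [Module R P] (t : ℕ)
    (hP : ∀ (Y : ModuleCat.{u} R) i, t < i → van R P Y i) (i : ℕ) (k : ℤ) :
    van R P (Z k) (i+1) := by
  have : ∀ n : ℕ, ∀ i k, t ≤ i + n → van R P (Z k) (i+1) := by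
    intro n
    induction n with
    | zero => intro i k hi; exact hP (Z k) (i+1) (by omega)
    | succ n ih =>
      intro i k hi
      obtain ⟨k, rfl⟩ : ∃ j, k = j + 1 := ⟨k-1, by ring⟩
      exact (h k).co_right (GGP.van_inj (hX k)) (ih (i+1) k (by omega))
  exact this t i k (by omega)

theorem IsGI.van_pd {G : Type u} [AddCommGroup G] [Module R G] (hG : IsGI R G)
    (P : Type u) [AddCommGroup P] [Module R P] (t : ℕ)
    (hP : ∀ (Y : ModuleCat.{u} R) i, t < i → van R P Y i) (i : ℕ) : van R P G (i+1) := by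
  obtain ⟨Z, X', ι, π, h, hX', hl, ⟨e⟩⟩ := hG
  exact van_congr_right e (gi_van_pd h hX' P t hP i 0)

/-- power surjectivity -/
def YS (y : R) (N : Type u) [AddCommGroup N] [Module R N] : Prop :=
  ∀ (g : N) (n : ℕ), ∃ (k : ℕ) (h : N), y ^ (k + n) • h = y ^ k • g

theorem ys_inj [IsNoetherianRing R] (y : R) (hX : Module.Injective R X) : YS y X := by
  intro g n
  let a : ℕ →o Ideal R := ⟨fun k => LinearMap.ker (LinearMap.toSpanSingleton R R (y ^ k)), by
    intro i j hij r hr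
    rw [LinearMap.mem_ker, LinearMap.toSpanSingleton_apply, smul_eq_mul] at *
    obtain ⟨c, rfl⟩ := Nat.exists_eq_add_of_le hij
    rw [pow_add, ← mul_assoc, hr, zero_mul]⟩
  obtain ⟨k, hk⟩ := monotone_stabilizes_iff_noetherian.2 ‹_› a
  refine ⟨k, ?_⟩
  have h1 : LinearMap.ker (LinearMap.toSpanSingleton R R (y ^ (k+n))) ≤
      LinearMap.ker (LinearMap.toSpanSingleton R X (y ^ k • g)) := by
    intro r hr
    have h2 : r ∈ a k := by rw [hk (k+n) (by omega)]; exact hr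
    have h3 : r * y ^ k = 0 := h2
    rw [LinearMap.mem_ker, LinearMap.toSpanSingleton_apply, smul_smul, h3, zero_smul]
  obtain ⟨φ, hφ⟩ := inj_ext hX
    ((LinearMap.ker (LinearMap.toSpanSingleton R R (y ^ (k+n)))).liftQ _ le_rfl)
    (LinearMap.ker_eq_bot.1 (Submodule.ker_liftQ_eq_bot _ _ _ le_rfl))
    ((LinearMap.ker (LinearMap.toSpanSingleton R R (y ^ (k+n)))).liftQ _ h1)
  refine ⟨φ 1, ?_⟩
  have h := LinearMap.congr_fun hφ (Submodule.Quotient.mk 1)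
  have h2 : φ ((1 : R) • y ^ (k+n)) = (1 : R) • y ^ k • g := h
  rw [one_smul, one_smul] at h2
  rw [← map_smul, smul_eq_mul, mul_one, h2]

theorem YS.of_surj {y : R} (h : YS y A) (f : A →ₗ[R] B) (hf : Function.Surjective f) : YS y B := by
  intro g n
  obtain ⟨g, rfl⟩ := hf g
  obtain ⟨k, a, ha⟩ := h g n
  exact ⟨k, f a, by rw [← map_smul, ha, map_smul]⟩

/-- torsion for one element -/
abbrev ty (y : R) (N : Type u) [AddCommGroup N] [Module R N] : Submodule R N :=
  tors (Ideal.span {y}) N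

theorem mem_ty {y : R} {x : X} : x ∈ ty y X ↔ ∃ n : ℕ, y ^ n • x = 0 := by
  rw [mem_tors]
  refine exists_congr fun n => ?_
  rw [Ideal.span_singleton_pow]
  constructor
  · intro h; exact h _ (Ideal.mem_span_singleton_self _)
  · intro h r hr
    obtain ⟨c, rfl⟩ := Ideal.mem_span_singleton'.1 hr
    rw [mul_smul, h, smul_zero]

theorem map_ty (y : R) (f : A →ₗ[R] B) : ∀ x ∈ ty y A, f x ∈ ty y B := by
  intro x hx
  rw [mem_ty] at *
  obtain ⟨n, hn⟩ := hx
  exact ⟨n, by rw [← map_smul, hn, map_zero]⟩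

/-- torsion functor -/
noncomputable abbrev tyMap (y : R) (f : A →ₗ[R] B) : ty y A →ₗ[R] ty y B := f.restrict (map_ty y f)

theorem tyMap_coe (y : R) (f : A →ₗ[R] B) (x) : (tyMap y f x : B) = f x := rfl

theorem SES.ty (h : SES R f g) {y : R} (hA : YS y A) : SES R (tyMap y f) (tyMap y g) where
  inj := fun a b hab => Subtype.ext (h.inj (congrArg Subtype.val hab))
  exact := by
    rintro ⟨x, hx⟩
    constructor
    · intro h0
      obtain ⟨a, rfl⟩ := (h.exact x).1 (congrArg Subtype.val h0)
      refine ⟨⟨a, ?_⟩, rfl⟩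
      rw [mem_ty] at *
      obtain ⟨n, hn⟩ := hx
      exact ⟨n, h.inj (by rw [map_smul, hn, map_zero])⟩
    · rintro ⟨a, ha⟩
      apply Subtype.ext
      rw [tyMap_coe, ← ha, tyMap_coe, h.exact.apply_apply_eq_zero]; rfl
  surj := by
    rintro ⟨z, hz⟩
    obtain ⟨n, hn⟩ := mem_ty.1 hz
    obtain ⟨w, rfl⟩ := h.surj z
    rw [← map_smul] at hn
    obtain ⟨v, hv⟩ := (h.exact _).1 hn
    obtain ⟨k, v', hv'⟩ := hA v n
    refine ⟨⟨w - f v', mem_ty.2 ⟨k + n, ?_⟩⟩, ?_⟩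
    · rw [smul_sub, ← map_smul, hv', map_smul, hv, pow_add, mul_smul, sub_self]
    · apply Subtype.ext
      rw [tyMap_coe, map_sub, h.exact.apply_apply_eq_zero, sub_zero]

theorem ty_factor {y : R} (hW : ∀ w : A, w ∈ ty y A) (k : A →ₗ[R] B) (a : A) : k a ∈ ty y B :=
  map_ty y k a (hW a)

/-- lifts from a torsion module -/
theorem ty_lift {y : R} (hW : ∀ w : X, w ∈ ty y X) (g : B →ₗ[R] C)
    (H : ∀ k : X →ₗ[R] C, ∃ k' : X →ₗ[R] B, g ∘ₗ k' = k) (k : X →ₗ[R] ty y C) :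
    ∃ k' : X →ₗ[R] ty y B, tyMap y g ∘ₗ k' = k := by
  obtain ⟨k', hk'⟩ := H ((ty y C).subtype ∘ₗ k)
  refine ⟨k'.codRestrict _ (ty_factor hW k'), ?_⟩
  ext x
  exact LinearMap.congr_fun hk' x

theorem ty_lift' {y : R} (hW : ∀ w : X, w ∈ ty y X) (g : B →ₗ[R] C)
    (H : ∀ k : X →ₗ[R] ty y C, ∃ k' : X →ₗ[R] ty y B, tyMap y g ∘ₗ k' = k) (k : X →ₗ[R] C) :
    ∃ k' : X →ₗ[R] B, g ∘ₗ k' = k := by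
  obtain ⟨k', hk'⟩ := H (k.codRestrict _ (ty_factor hW k))
  refine ⟨(ty y B).subtype ∘ₗ k', ?_⟩
  ext x
  exact congrArg Subtype.val (LinearMap.congr_fun hk' x)

variable (R) in
/-- chains of torsion injectives with lifts from W -/
def CI (S : Set R) (W G : Type u) [AddCommGroup W] [Module R W] [AddCommGroup G] [Module R G] : Prop :=
  ∃ (Z X : ℤ → ModuleCat.{u} R) (ι : ∀ k, Z k →ₗ[R] X k) (π : ∀ k, X k →ₗ[R] Z (k+1)),
    (∀ k, SES R (ι k) (π k)) ∧ (∀ k, Module.Injective R (X k)) ∧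
    (∀ k, ∀ s ∈ S, ∀ x : X k, x ∈ ty s (X k)) ∧
    (∀ k, ∀ t : W →ₗ[R] Z (k+1), ∃ t' : W →ₗ[R] X k, π k ∘ₗ t' = t) ∧ Nonempty (G ≃ₗ[R] Z 0)

variable {W G : Type u} [AddCommGroup W] [Module R W] [AddCommGroup G] [Module R G] {S : Set R}

theorem CI.ys [IsNoetherianRing R] (h : CI R S W G) (y : R) : YS y G := by
  obtain ⟨Z, X, ι, π, h, hX, hS, hl, ⟨e⟩⟩ := h
  have : YS y (Z 0) := by
    have h0 : YS y (Z (-1 + 1)) := (ys_inj y (hX (-1))).of_surj (π (-1)) (h (-1)).surj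
    exact h0
  exact this.of_surj e.symm.toLinearMap e.symm.surjective

theorem CI.ty [IsNoetherianRing R] (h : CI R S W G) (y : R) (hW : ∀ w : W, w ∈ ty y W) :
    CI R (insert y S) W (ty y G) := by
  obtain ⟨Z, X, ι, π, h, hX, hS, hl, ⟨e⟩⟩ := h
  have hys : ∀ k, YS y (Z k) := by
    intro k
    obtain ⟨k, rfl⟩ : ∃ j, k = j + 1 := ⟨k-1, by ring⟩
    exact (ys_inj y (hX k)).of_surj (π k) (h k).surj
  refine ⟨fun k => ModuleCat.of R (GGP.ty y (Z k)), fun k => ModuleCat.of R (GGP.ty y (X k)),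
    fun k => tyMap y (ι k), fun k => tyMap y (π k), fun k => (h k).ty (hys k),
    fun k => tors_inj _ (hX k), ?_, fun k => ty_lift hW _ (hl k), ⟨?_⟩⟩
  · rintro k s hs ⟨x, hx⟩
    rw [mem_ty]
    have : ∃ n, s ^ n • x = 0 := by
      rcases hs with rfl | hs
      · exact mem_ty.1 hx
      · exact mem_ty.1 (hS k s hs x)
    obtain ⟨n, hn⟩ := this
    exact ⟨n, Subtype.ext hn⟩
  · exact LinearEquiv.ofLinear (tyMap y e.toLinearMap) (tyMap y e.symm.toLinearMap)
      (by ext x; simp [tyMap_coe]) (by ext x; simp [tyMap_coe])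

end

section
variable {R : Type u} [CommRing R] [IsLocalRing R] [IsNoetherianRing R]
  {E : Type u} [AddCommGroup E] [Module R E] {e0 : E}

theorem chain_base (hE : Mat R E e0) (hEm : (maximalIdeal R) • (⊤ : Submodule R E) ≠ ⊤)
    (S : Set R) (y : R) (hy : y ∈ maximalIdeal R)
    (hS : ∀ (N : ModuleCat.{u} R) (x : N), (∀ s ∈ insert y S, x ∈ ty s N) → x ∈ tors (maximalIdeal R) N)
    (β γ : ℕ → ModuleCat.{u} R) (ι : ∀ j, β j →ₗ[R] γ j) (π : ∀ j, γ j →ₗ[R] β (j+1))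
    (h : ∀ j, SES R (ι j) (π j)) (hγ : ∀ j, CI R S E (γ j)) (g : ℕ)
    (hg : ∀ j, g < j → Subsingleton (β j)) (j : ℕ) (k : E →ₗ[R] β (j+1)) :
    ∃ k' : E →ₗ[R] γ j, π j ∘ₗ k' = k := by
  have hEy : ∀ e : E, e ∈ ty y E := by
    intro e
    obtain ⟨n, hn⟩ := hE.tor e
    exact mem_ty.2 ⟨n, hn _ (Ideal.pow_mem_pow hy n)⟩
  have hγB : ∀ j, Bass R E (ty y (γ j)) := by
    intro j
    obtain ⟨Z, X, ι, π, h, hX, hXS, hl, ⟨e⟩⟩ := (hγ j).ty y hEy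
    exact Bass.congr e (Bass.chain Z X ι π h
      (fun k => hE.bass (hX k) fun x => hS (X k) x fun s hs => hXS k s hs x) hl 0)
  have hys : ∀ j, YS y (β (j+1)) := fun j => ((hγ j).ys y).of_surj (π j) (h j).surj
  have hβB : ∀ n j, g < j + n → Bass R E (ty y (β (j+1))) := by
    intro n
    induction n with
    | zero =>
      intro j hj
      have := hg (j+1) (by omega)
      have := hE.bass (X := (ty y (β (j+1)) : Type u)) inj_subsingleton
        (fun x => by rw [Subsingleton.elim x 0]; exact zero_mem _)
      exact this
    | succ n ih =>
      intro j hj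
      have h1 := ih (j+1) (by omega)
      have h2 := (h (j+1)).ty (hys j)
      refine Bass.kernel h2 (hγB (j+1)) h1 fun k => ?_
      refine lemN _ hE.tor hEm (hγB (j+1)) h1 ?_ k
      rw [LinearMap.range_eq_top.2 h2.surj, top_sup_eq]
  refine ty_lift' hEy _ (fun k => ?_) k
  refine lemN _ hE.tor hEm (hγB j) (hβB (g+1) j (by omega)) ?_ k
  rw [eq_top_iff]
  rintro ⟨z, hz⟩ -
  obtain ⟨w, rfl⟩ := (h j).surj z
  obtain ⟨n, hn⟩ := mem_ty.1 hz
  obtain ⟨q, v, hv⟩ := (hγ j).ys y w 1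
  have h1 : w - y • v ∈ ty y (γ j) := mem_ty.2 ⟨q, by rw [smul_sub, smul_smul, ← pow_succ, hv, sub_self]⟩
  have h2 : π j v ∈ ty y (β (j+1)) := mem_ty.2 ⟨n + (q + 1), by
    rw [pow_add, mul_smul, ← map_smul, hv, map_smul, smul_comm, hn, smul_zero]⟩
  rw [Submodule.mem_sup]
  refine ⟨_, ⟨⟨_, h1⟩, rfl⟩, y • ⟨π j v, h2⟩, Submodule.smul_mem_smul hy trivial, ?_⟩
  apply Subtype.ext
  simp [tyMap_coe]

theorem chain_red (hE : Mat R E e0) (hEm : (maximalIdeal R) • (⊤ : Submodule R E) ≠ ⊤)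
    (y : R) (hy : y ∈ maximalIdeal R) (T : Set R)
    (hT : ∀ (N : ModuleCat.{u} R) (x : N), (∀ s ∈ T, x ∈ ty s N) → x ∈ tors (maximalIdeal R) N)
    (g : ℕ) (ys : List R) :
    ∀ (S : Set R) (_ : ∀ z ∈ ys, z ∈ maximalIdeal R)
    (_ : ∀ z ∈ T, z ∈ ys ∨ z = y ∨ z ∈ S)
    (β γ : ℕ → ModuleCat.{u} R) (ι : ∀ j, β j →ₗ[R] γ j) (π : ∀ j, γ j →ₗ[R] β (j+1))
    (_ : ∀ j, SES R (ι j) (π j)) (_ : ∀ j, CI R S E (γ j))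
    (_ : ∀ j, g < j → Subsingleton (β j)) (j : ℕ) (_ : ys.length ≤ j) (k : E →ₗ[R] β (j+1)),
    ∃ k' : E →ₗ[R] γ j, π j ∘ₗ k' = k := by
  induction ys with
  | nil =>
    intro S _ hTS β γ ι π h hγ hg j _ k
    refine chain_base hE hEm S y hy (fun N x hx => hT N x fun s hs => hx s ?_) β γ ι π h hγ g hg j k
    rcases hTS s hs with h1 | h1 | h1
    · simp at h1
    · exact Or.inl h1
    · exact Or.inr h1
  | cons z ys ih =>
    intro S hys hTS β γ ι π h hγ hg j hj k
    obtain ⟨j, rfl⟩ : ∃ i, j = i + 1 := ⟨j-1, by simp at hj; omega⟩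
    have hEz : ∀ e : E, e ∈ ty z E := by
      intro e
      obtain ⟨n, hn⟩ := hE.tor e
      exact mem_ty.2 ⟨n, hn _ (Ideal.pow_mem_pow (hys z (by simp)) n)⟩
    refine ty_lift' hEz _ (fun k => ?_) k
    refine ih (insert z S) (fun w hw => hys w (by simp [hw])) ?_
      (fun j => ModuleCat.of R (ty z (β (j+1)))) (fun j => ModuleCat.of R (ty z (γ (j+1))))
      (fun j => tyMap z (ι (j+1))) (fun j => tyMap z (π (j+1)))
      (fun j => (h (j+1)).ty (((hγ j).ys z).of_surj (π j) (h j).surj))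
      (fun j => (hγ (j+1)).ty z hEz) ?_ j (by simpa using hj) k
    · intro w hw
      rcases hTS w hw with h1 | h1 | h1
      · rcases List.mem_cons.1 h1 with rfl | h2
        · exact Or.inr (Or.inr (Set.mem_insert _ _))
        · exact Or.inl h2
      · exact Or.inr (Or.inl h1)
      · exact Or.inr (Or.inr (Set.mem_insert_of_mem _ h1))
    · intro j hj
      have := hg (j+1) (by omega)
      change Subsingleton (ty z (β (j+1)))
      infer_instance
end
end GGP

end PartPE

section PartPE2
namespace GGP
open CategoryTheory Abelian IsLocalRing TensorProduct RingTheory.Sequence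
open scoped Pointwise

theorem wb_add {a : WithBot ℕ∞} {t d : ℕ} (h : a + t = d) : ∃ e : ℕ, a = e ∧ e + t = d := by
  cases a with
  | bot => exact absurd h (by rw [WithBot.bot_add]; exact (WithBot.coe_ne_bot).symm)
  | coe a =>
    cases a with
    | top =>
      have h' : ((⊤ + (t : ℕ∞) : ℕ∞) : WithBot ℕ∞) = ((d : ℕ∞) : WithBot ℕ∞) := h
      rw [WithBot.coe_inj, top_add] at h'
      exact absurd h' (ENat.top_ne_coe d)
    | coe a =>
      have h' : (((a : ℕ∞) + (t : ℕ∞) : ℕ∞) : WithBot ℕ∞) = ((d : ℕ∞) : WithBot ℕ∞) := h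
      rw [WithBot.coe_inj] at h'
      exact ⟨a, rfl, by exact_mod_cast h'⟩

section
variable {R : Type u} [CommRing R]
variable {A B C X Y N : Type u} [AddCommGroup A] [Module R A] [AddCommGroup B] [Module R B]
    [AddCommGroup C] [Module R C] [AddCommGroup X] [Module R X] [AddCommGroup Y] [Module R Y]
    [AddCommGroup N] [Module R N]

theorem ses_smul {x : R} (h : IsSMulRegular N x) :
    SES R (x • LinearMap.id : N →ₗ[R] N) (Submodule.mkQ (x • (⊤ : Submodule R N))) where
  inj := h
  exact := by
    intro n
    rw [Submodule.mkQ_apply, Submodule.Quotient.mk_eq_zero]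
    constructor
    · intro hn
      obtain ⟨y, -, hy⟩ := Submodule.mem_smul_pointwise_iff_exists _ _ _ |>.1 hn
      exact ⟨y, hy⟩
    · rintro ⟨y, rfl⟩
      exact Submodule.smul_mem_pointwise_smul y x ⊤ Submodule.mem_top
  surj := Submodule.mkQ_surjective _

/-- the quotient by a list -/
abbrev LQ (N : Type u) [AddCommGroup N] [Module R N] (rs : List R) : Type u :=
  N ⧸ (Ideal.ofList rs • (⊤ : Submodule R N))

theorem LQ.nil_equiv (N : Type u) [AddCommGroup N] [Module R N] :
    Nonempty (LQ N ([] : List R) ≃ₗ[R] N) :=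
  ⟨Submodule.quotEquivOfEqBot _ (by simp)⟩

/-- recursion -/
noncomputable def LQ.cons_equiv (N : Type u) [AddCommGroup N] [Module R N] (r : R) (rs : List R) :
    LQ N (r :: rs) ≃ₗ[R] LQ (QuotSMulTop r N) rs :=
  Submodule.quotOfListConsSMulTopEquivQuotSMulTopInner N r rs

theorem van_LQ_left (rs : List R) : ∀ (N : Type u) [AddCommGroup N] [Module R N],
    IsWeaklyRegular N rs → ∀ s, (∀ i, s < i → van R N Y i) →
    ∀ i, s + rs.length < i → van R (LQ N rs) Y i := by
  induction rs with
  | nil =>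
    intro N _ _ _ s h i hi
    exact van_congr_left (LQ.nil_equiv N).some (h i (by simpa using hi))
  | cons x rs ih =>
    intro N _ _ hN s h i hi
    rw [isWeaklyRegular_cons_iff] at hN
    refine van_congr_left (LQ.cons_equiv N x rs) (ih _ hN.2 (s+1) ?_ i ?_)
    · intro i hi
      obtain ⟨i, rfl⟩ : ∃ j, i = j + 1 := ⟨i-1, by omega⟩
      exact (ses_smul hN.1).contra_right (h i (by omega)) (h (i+1) (by omega))
    · simp only [List.length_cons] at hi; omega

theorem van_LQ_right (rs : List R) : ∀ (N : Type u) [AddCommGroup N] [Module R N],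
    IsWeaklyRegular N rs → (∀ i, van R X N i) →
    ∀ i, van R X (LQ N rs) i := by
  induction rs with
  | nil =>
    intro N _ _ _ h i
    exact van_congr_right (LQ.nil_equiv N).some (h i)
  | cons x rs ih =>
    intro N _ _ hN h i
    rw [isWeaklyRegular_cons_iff] at hN
    refine van_congr_right (LQ.cons_equiv N x rs) (ih _ hN.2 ?_ i)
    intro i
    exact (ses_smul hN.1).co_right (h _) (h _)

theorem van_LQ_hom {E : Type u} [AddCommGroup E] [Module R E] (hE : Module.Injective R E)
    (rs : List R) : ∀ (N : Type u) [AddCommGroup N] [Module R N],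
    IsWeaklyRegular N rs → (∀ i, van R (N →ₗ[R] E) Y (i+1)) →
    ∀ i, van R (LQ N rs →ₗ[R] E) Y (i+1) := by
  induction rs with
  | nil =>
    intro N _ _ _ h i
    exact van_congr_left (LinearEquiv.congrLeft E R (LQ.nil_equiv N).some) (h i)
  | cons x rs ih =>
    intro N _ _ hN h i
    rw [isWeaklyRegular_cons_iff] at hN
    refine van_congr_left (LinearEquiv.congrLeft E R (LQ.cons_equiv N x rs)) (ih _ hN.2 ?_ i)
    intro i
    have hs := (ses_smul hN.1)
    exact (hs.homc (fun k => inj_ext hE _ hs.inj k)).contra_left (h _) (h _)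

variable [IsLocalRing R] [IsNoetherianRing R]

theorem exists_smulRegular_or_soc [Module.Finite R N] :
    (∃ x ∈ maximalIdeal R, IsSMulRegular N x) ∨
    ∃ n : N, n ≠ 0 ∧ ∀ r ∈ maximalIdeal R, r • n = 0 := by
  by_cases h : ∃ x ∈ maximalIdeal R, IsSMulRegular N x
  · exact Or.inl h
  right
  push Not at h
  have h2 : (maximalIdeal R : Set R) ⊆ ⋃ p ∈ associatedPrimes R N, p := by
    rw [biUnion_associatedPrimes_eq_compl_regular]
    exact fun x hx => h x hx
  have hf := associatedPrimes.finite R N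
  rw [Ideal.subset_union_prime_finite hf ⊥ ⊥ (fun i hi _ _ => hi.isPrime)] at h2
  obtain ⟨p, hp, hmp⟩ := h2
  have hpm : p = maximalIdeal R := (maximalIdeal.isMaximal R).eq_of_le hp.isPrime.ne_top hmp |>.symm
  obtain ⟨-, hz, hinj⟩ := (isAssociatedPrime_iff_exists_injective_linearMap p N).1 hp
  refine ⟨hz (Ideal.Quotient.mk p 1), ?_, ?_⟩
  · intro h0
    have := hinj (h0.trans (map_zero hz).symm)
    have h3 := (Ideal.Quotient.eq_zero_iff_mem).1 this
    exact hp.isPrime.ne_top ((Ideal.eq_top_iff_one _).2 h3)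
  · intro r hr
    rw [← map_smul]
    have : r • (Ideal.Quotient.mk p 1) = 0 := by
      change Ideal.Quotient.mk p (r * 1) = 0
      rw [Ideal.Quotient.eq_zero_iff_mem]; exact Ideal.mul_mem_right _ _ (hmp hr)
    rw [this, map_zero]

theorem soc_equiv (e : A ≃ₗ[R] B) (h : ∃ n : B, n ≠ 0 ∧ ∀ r ∈ maximalIdeal R, r • n = 0) :
    ∃ n : A, n ≠ 0 ∧ ∀ r ∈ maximalIdeal R, r • n = 0 := by
  obtain ⟨n, h0, h⟩ := h
  exact ⟨e.symm n, by simpa using h0, fun r hr => by rw [← map_smul, h r hr, map_zero]⟩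

theorem exists_max_reg (n : ℕ) : ∀ (N : Type u) [AddCommGroup N] [Module R N] [Module.Finite R N]
    [Nontrivial N], Module.supportDim R N = n → ∃ rs : List R, (∀ r ∈ rs, r ∈ maximalIdeal R) ∧
    IsRegular N rs ∧ ∃ z : LQ N rs, z ≠ 0 ∧ ∀ r ∈ maximalIdeal R, r • z = 0 := by
  induction n with
  | zero =>
    intro N _ _ _ _ hN
    rcases exists_smulRegular_or_soc (R := R) (N := N) with ⟨x, hx, hreg⟩ | h
    · have h1 := Module.supportDim_quotSMulTop_succ_eq_supportDim hreg hx
      rw [hN] at h1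
      obtain ⟨e, -, he⟩ := wb_add (t := 1) (d := 0) (by exact_mod_cast h1)
      omega
    · exact ⟨[], by simp, IsRegular.nil _ _, soc_equiv (LQ.nil_equiv N).some h⟩
  | succ n ih =>
    intro N _ _ _ _ hN
    rcases exists_smulRegular_or_soc (R := R) (N := N) with ⟨x, hx, hreg⟩ | h
    · have h1 := Module.supportDim_quotSMulTop_succ_eq_supportDim hreg hx
      rw [hN] at h1
      have h2 : Module.supportDim R (QuotSMulTop x N) = n := by
        obtain ⟨e, he', he⟩ := wb_add (t := 1) (d := n+1) (by exact_mod_cast h1)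
        rw [he', show e = n by omega]
      have : Nontrivial (QuotSMulTop x N) := by
        rw [← Module.supportDim_ne_bot_iff_nontrivial (R := R), h2]
        exact WithBot.coe_ne_bot
      obtain ⟨rs, h3, h4, h5⟩ := ih (QuotSMulTop x N) h2
      refine ⟨x :: rs, by simpa using ⟨hx, h3⟩, ?_, soc_equiv (LQ.cons_equiv N x rs) h5⟩
      rw [isRegular_cons_iff]
      exact ⟨hreg, h4⟩
    · exact ⟨[], by simp, IsRegular.nil _ _, soc_equiv (LQ.nil_equiv N).some h⟩

end
end GGP

end PartPE2

section PartPE3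
namespace GGP
open CategoryTheory Abelian IsLocalRing TensorProduct RingTheory.Sequence
open scoped Pointwise

section
variable {R : Type u} [CommRing R] [IsLocalRing R]
variable {A B C X Y N : Type u} [AddCommGroup A] [Module R A] [AddCommGroup B] [Module R B]
    [AddCommGroup C] [Module R C] [AddCommGroup X] [Module R X] [AddCommGroup Y] [Module R Y]
    [AddCommGroup N] [Module R N] {E : Type u} [AddCommGroup E] [Module R E] {e0 : E}

theorem maxIdeal_quot (I : Ideal R) [IsLocalRing (R ⧸ I)] (r : R) :
    Ideal.Quotient.mk I r ∈ maximalIdeal (R ⧸ I) ↔ r ∈ maximalIdeal R := by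
  have : IsLocalHom (Ideal.Quotient.mk I) :=
    IsLocalHom.of_surjective _ Ideal.Quotient.mk_surjective
  rw [mem_maximalIdeal, mem_maximalIdeal, mem_nonunits_iff, mem_nonunits_iff, isUnit_map_iff]

theorem maxIdeal_quot_map (I : Ideal R) [IsLocalRing (R ⧸ I)] :
    maximalIdeal (R ⧸ I) = (maximalIdeal R).map (Ideal.Quotient.mk I) := by
  apply le_antisymm
  · intro x hx
    obtain ⟨x, rfl⟩ := Ideal.Quotient.mk_surjective x
    exact Ideal.mem_map_of_mem _ ((maxIdeal_quot I x).1 hx)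
  · rw [Ideal.map_le_iff_le_comap]
    intro x hx
    exact (maxIdeal_quot I x).2 hx

theorem Co.quot_apply {I : Ideal R} (φ : Co R (R ⧸ I) E) (r : R) :
    φ (Ideal.Quotient.mk I r) = r • φ 1 := by
  rw [← Co.map_smulA]
  congr 1
  change Ideal.Quotient.mk I r = Ideal.Quotient.mk I (r * 1)
  rw [mul_one]

theorem Co.quot_ext {I : Ideal R} {φ ψ : Co R (R ⧸ I) E} (h : φ 1 = ψ 1) : φ = ψ := by
  apply Co.ext
  intro s
  obtain ⟨s, rfl⟩ := Ideal.Quotient.mk_surjective s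
  rw [Co.quot_apply, Co.quot_apply, h]

theorem Co.quot_smul {I : Ideal R} (φ : Co R (R ⧸ I) E) (r : R) :
    (Ideal.Quotient.mk I r • φ) = r • φ := by
  apply Co.quot_ext
  rw [Co.smul_apply, mul_one, Co.quot_apply, Co.smulA_apply]

theorem co_mat (hE : Mat R E e0) (I : Ideal R) [IsLocalRing (R ⧸ I)] :
    ∃ e, Mat (R ⧸ I) (Co R (R ⧸ I) E) e := by
  have hI : ∀ r ∈ I, r ∈ maximalIdeal R := by
    intro r hr
    rw [← maxIdeal_quot I, Ideal.Quotient.eq_zero_iff_mem.2 hr]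
    exact zero_mem _
  let φ0 : Co R (R ⧸ I) E := I.liftQ (LinearMap.toSpanSingleton R E e0) (by
    intro r hr; rw [LinearMap.mem_ker, LinearMap.toSpanSingleton_apply]; exact hE.soc r (hI r hr))
  have h1 : φ0 1 = e0 := one_smul R e0
  refine ⟨φ0, Co.inj hE.inj, ?_, ?_, ?_, ?_⟩
  · intro φ
    obtain ⟨n, hn⟩ := hE.tor (φ 1)
    refine ⟨n, fun r hr => ?_⟩
    rw [maxIdeal_quot_map, ← Ideal.map_pow] at hr
    obtain ⟨r, hr', rfl⟩ := (Ideal.mem_map_iff_of_surjective _ Ideal.Quotient.mk_surjective).1 hr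
    rw [Co.quot_smul]
    apply Co.quot_ext
    rw [Co.smulA_apply, hn r hr', Co.zero_apply]
  · intro h0
    rw [h0, Co.zero_apply] at h1
    exact hE.ne h1.symm
  · intro r hr
    obtain ⟨r, rfl⟩ := Ideal.Quotient.mk_surjective r
    rw [Co.quot_smul]
    apply Co.quot_ext
    rw [Co.smulA_apply, h1, hE.soc r ((maxIdeal_quot I r).1 hr), Co.zero_apply]
  · intro φ h
    obtain ⟨r, hr⟩ := hE.gen (φ 1) (fun r hr => by
      have := h _ ((maxIdeal_quot I r).2 hr)
      rw [Co.quot_smul] at this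
      rw [← Co.smulA_apply, this, Co.zero_apply])
    refine ⟨Ideal.Quotient.mk I r, ?_⟩
    rw [Co.quot_smul]
    apply Co.quot_ext
    rw [Co.smulA_apply, hr, h1]

theorem k_emb {z : N} (hz : z ≠ 0) (hm : ∀ r ∈ maximalIdeal R, r • z = 0) :
    ∃ f : (R ⧸ maximalIdeal R) →ₗ[R] N, Function.Injective f ∧ f (Ideal.Quotient.mk _ 1) = z := by
  refine ⟨(maximalIdeal R).liftQ (LinearMap.toSpanSingleton R N z) ?_, ?_, one_smul R z⟩
  · intro r hr; rw [LinearMap.mem_ker, LinearMap.toSpanSingleton_apply]; exact hm r hr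
  · rw [injective_iff_map_eq_zero]
    intro a ha
    obtain ⟨a, rfl⟩ := Ideal.Quotient.mk_surjective a
    rw [Ideal.Quotient.eq_zero_iff_mem]
    by_contra hu
    have hu : IsUnit a := by simpa using hu
    exact hz ((hu.smul_eq_zero).1 ha)

theorem co_ne (hE : Mat R E e0) (I : Ideal R) [IsLocalRing (R ⧸ I)]
    {z : R ⧸ I} (hz : z ≠ 0) (hm : ∀ r ∈ maximalIdeal R, r • z = 0) :
    (maximalIdeal (R ⧸ I)) • (⊤ : Submodule (R ⧸ I) (Co R (R ⧸ I) E)) ≠ ⊤ := by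
  intro h
  have h0 : ∀ φ : Co R (R ⧸ I) E, φ z = 0 := by
    intro φ
    have hφ : φ ∈ (maximalIdeal (R ⧸ I)) • (⊤ : Submodule (R ⧸ I) (Co R (R ⧸ I) E)) := by
      rw [h]; trivial
    refine Submodule.smul_induction_on hφ ?_ ?_
    · intro r hr n _
      obtain ⟨r, rfl⟩ := Ideal.Quotient.mk_surjective r
      rw [Co.quot_smul, Co.smulA_apply, ← Co.map_smulA, hm r ((maxIdeal_quot I r).1 hr), Co.map_zero]
    · intro x y hx hy
      rw [Co.add_apply, hx, hy, add_zero]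
  obtain ⟨f, hf, hf1⟩ := k_emb hz hm
  obtain ⟨f2, hf2, hf21⟩ := k_emb hE.ne hE.soc
  obtain ⟨k, hk⟩ := inj_ext hE.inj f hf f2
  have := LinearMap.congr_fun hk (Ideal.Quotient.mk _ 1)
  rw [LinearMap.comp_apply, hf1, hf21] at this
  exact hE.ne (this.symm.trans (h0 k))

/-- torsion elements have socle multiples -/
theorem tors_soc {x : X} (hx : x ≠ 0) (ht : x ∈ tors (maximalIdeal R) X) :
    ∃ r : R, r • x ≠ 0 ∧ ∀ s ∈ maximalIdeal R, s • r • x = 0 := by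
  obtain ⟨n, hn⟩ := ht
  induction n with
  | zero => exact absurd (by simpa using hn 1 (by simp)) hx
  | succ n ih =>
    by_cases h : ∀ r ∈ maximalIdeal R ^ n, r • x = 0
    · exact ih h
    push Not at h
    obtain ⟨r, hr, hne⟩ := h
    refine ⟨r, hne, fun s hs => ?_⟩
    rw [smul_smul]
    exact hn _ (by rw [pow_succ']; exact Ideal.mul_mem_mul hs hr)

theorem van_tors (n : ℕ) : ∀ (Y : Type u) [AddCommGroup Y] [Module R Y],
    (∀ i < n, van R (R ⧸ maximalIdeal R) Y i) → (∀ x : X, x ∈ tors (maximalIdeal R) X) →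
    ∀ i < n, van R X Y i := by
  induction n with
  | zero => intro Y _ _ _ _ i hi; omega
  | succ n ih =>
    intro Y _ _ hk hX
    obtain ⟨J, ι, hJ, hι⟩ := exists_hull R Y
    have hY : ∀ y : Y, (∀ s ∈ maximalIdeal R, s • y = 0) → y = 0 := by
      intro y hy
      by_contra hne
      obtain ⟨f, -, hf⟩ := k_emb hne hy
      rw [van_zero_iff.1 (hk 0 (by omega)) f] at hf
      exact hne hf.symm
    have hJ0 : van R X J 0 := by
      rw [van_zero_iff]
      intro f
      ext x
      by_contra hne
      have ht : f x ∈ tors (maximalIdeal R) J := by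
        obtain ⟨n, hn⟩ := hX x
        exact ⟨n, fun r hr => by rw [← map_smul, hn r hr, map_zero]⟩
      obtain ⟨r, hr, hs⟩ := tors_soc hne ht
      obtain ⟨r2, hr2, y, hy⟩ := hι.2 _ hr
      apply hr2
      rw [← hy, hY y, map_zero]
      intro s hs'
      apply hι.1
      rw [map_smul, hy, smul_comm, hs s hs', smul_zero, map_zero]
    have hJ0' : van R (R ⧸ maximalIdeal R) J 0 := by
      rw [van_zero_iff]
      intro f
      refine LinearMap.ext fun x => ?_
      obtain ⟨x, rfl⟩ := Ideal.Quotient.mk_surjective x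
      by_contra hne
      have hs : ∀ s ∈ maximalIdeal R, s • f (Ideal.Quotient.mk _ x) = 0 := by
        intro s hs
        rw [← map_smul]
        have : s • (Ideal.Quotient.mk (maximalIdeal R) x) = 0 := by
          change Ideal.Quotient.mk _ (s * x) = 0
          rw [Ideal.Quotient.eq_zero_iff_mem]; exact Ideal.mul_mem_right _ _ hs
        rw [this, map_zero]
      obtain ⟨r2, hr2, y, hy⟩ := hι.2 _ hne
      apply hr2
      rw [← hy, hY y, map_zero]
      intro s hs'
      apply hι.1
      rw [map_smul, hy, smul_comm, hs s hs', smul_zero, map_zero]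
    have hs := SES.ofQuot ι hι.1
    intro i hi
    cases i with
    | zero => exact hs.co_left0 hJ0
    | succ i =>
      refine hs.co_left (ih _ ?_ hX i (by omega)) (van_inj hJ)
      intro j hj
      refine hs.co_right ?_ (hk _ (by omega))
      cases j with
      | zero => exact hJ0'
      | succ j => exact van_inj hJ

theorem van_k_reg [IsNoetherianRing R] [Module.Finite R N] (rs : List R)
    (hm : ∀ r ∈ rs, r ∈ maximalIdeal R) (h : IsRegular N rs) (i : ℕ) (hi : i < rs.length) :
    van R (R ⧸ maximalIdeal R) N i := by
  have hnt : Nontrivial N := h.nontrivial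
  refine ModuleCat.subsingleton_ext_of_exists_isRegular (maximalIdeal R)
    (ModuleCat.of R (R ⧸ maximalIdeal R)) ?_ (ModuleCat.of R N) ?_ rs hm h i hi
  · change Module.support R (R ⧸ maximalIdeal R) ⊆ _
    rw [Module.support_eq_zeroLocus, Ideal.annihilator_quotient]
  · rw [lt_top_iff_ne_top]
    exact (Submodule.top_ne_ideal_smul_of_le_jacobson_annihilator
      (IsLocalRing.maximalIdeal_le_jacobson _)).symm
end
end GGP

end PartPE3

section PartPE4
namespace GGP
open CategoryTheory Abelian IsLocalRing TensorProduct RingTheory.Sequence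
open scoped Pointwise

section
variable {R : Type u} [CommRing R] [IsLocalRing R]

/-- functoriality of coinduction, equivalences -/
noncomputable def Co.congr {A R B C : Type u} [CommRing A] [CommRing R] [Algebra A R] [AddCommGroup B]
    [Module A B] [AddCommGroup C] [Module A C] (e : B ≃ₗ[A] C) : Co A R B ≃ₗ[R] Co A R C :=
  LinearEquiv.ofLinear (Co.map e.toLinearMap) (Co.map e.symm.toLinearMap)
    (by ext x; apply Co.ext; intro s; simp) (by ext x; apply Co.ext; intro s; simp)

theorem exists_sop [IsNoetherianRing R] (e : ℕ) (he : ringKrullDim R = e) :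
    ∃ ys : List R, ys.length = e ∧ (∀ y ∈ ys, y ∈ maximalIdeal R) ∧
      ∀ (N : ModuleCat.{u} R) (x : N), (∀ s ∈ ys, x ∈ ty s N) → x ∈ tors (maximalIdeal R) N := by
  obtain ⟨s, hs, hc⟩ := Ideal.exists_finset_card_eq_height_of_isNoetherianRing (maximalIdeal R)
  rw [← IsLocalRing.maximalIdeal_height_eq_ringKrullDim, ← hc] at he
  refine ⟨s.toList, ?_, ?_, ?_⟩
  · rw [Finset.length_toList]; exact_mod_cast he
  · intro y hy
    exact hs.1.2 (Ideal.subset_span (by simpa using hy))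
  · intro N x hx
    set a := LinearMap.ker (LinearMap.toSpanSingleton R N x) with ha
    have h1 : Ideal.span (s : Set R) ≤ Ideal.radical a := by
      rw [Ideal.span_le]
      intro y hy
      obtain ⟨n, hn⟩ := mem_ty.1 (hx y (by simpa using hy))
      exact ⟨n, by rw [ha, LinearMap.mem_ker, LinearMap.toSpanSingleton_apply, hn]⟩
    have h2 : maximalIdeal R ≤ Ideal.radical a := by
      rw [Ideal.radical_eq_sInf]
      refine le_sInf ?_
      rintro p ⟨hp, hpp⟩
      exact hs.2 ⟨hpp, h1.trans (hpp.radical_le_iff.2 hp)⟩ (le_maximalIdeal hpp.ne_top)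
    obtain ⟨n, hn⟩ := Ideal.exists_pow_le_of_le_radical_of_fg h2 (IsNoetherian.noetherian _)
    exact ⟨n, fun r hr => hn hr⟩

theorem soc_of_dim_zero [IsNoetherianRing R] {N : Type u} [AddCommGroup N] [Module R N]
    [Module.Finite R N] (h : Module.supportDim R N = 0) :
    ∃ n : N, n ≠ 0 ∧ ∀ r ∈ maximalIdeal R, r • n = 0 := by
  rcases exists_smulRegular_or_soc (R := R) (N := N) with ⟨x, hx, hreg⟩ | h'
  · have h1 := Module.supportDim_quotSMulTop_succ_eq_supportDim hreg hx
    rw [h] at h1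
    obtain ⟨e, -, he⟩ := wb_add (t := 1) (d := 0) (by exact_mod_cast h1)
    omega
  · exact h'

theorem co_to_k {E : Type u} [AddCommGroup E] [Module R E] {e0 : E} (hE : Mat R E e0) (I : Ideal R)
    {z : R ⧸ I} (hz : z ≠ 0) (hm : ∀ r ∈ maximalIdeal R, r • z = 0) :
    ∃ (g : Co R (R ⧸ I) E →ₗ[R] (R ⧸ maximalIdeal R)) (φ : _), g φ ≠ 0 := by
  obtain ⟨f, hf, hf1⟩ := k_emb hz hm
  obtain ⟨f2, hf2, hf21⟩ := k_emb hE.ne hE.soc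
  obtain ⟨k, hk⟩ := inj_ext hE.inj f hf f2
  have hkz := LinearMap.congr_fun hk (Ideal.Quotient.mk _ 1)
  rw [LinearMap.comp_apply, hf1, hf21] at hkz
  let evz : Co R (R ⧸ I) E →ₗ[R] E := LinearMap.applyₗ (R := R) z
  have hevz : ∀ φ, evz φ = φ z := fun _ => rfl
  have hr : ∀ φ, evz φ ∈ LinearMap.range f2 := by
    intro φ
    obtain ⟨r, hr⟩ := hE.gen (evz φ) (fun r hr => by
      rw [hevz, ← Co.map_smulA, hm r hr, Co.map_zero])
    exact ⟨r • Ideal.Quotient.mk _ 1, by rw [map_smul, hf21, hr]⟩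
  let e2 := LinearEquiv.ofInjective f2 hf2
  refine ⟨e2.symm.toLinearMap ∘ₗ evz.codRestrict _ hr, k, ?_⟩
  intro h0
  have : evz.codRestrict _ hr k = 0 := by
    apply e2.symm.injective
    rw [map_zero]; exact h0
  have h3 : evz k = 0 := congrArg Subtype.val this
  exact hE.ne (hkz.symm.trans h3)

theorem cm_main [IsNoetherianRing R] (d : ℕ) (hd : ringKrullDim R = d) (M : Type u) [AddCommGroup M]
    [Module R M] [Module.Finite R M] (xs : List R) (hxs : ∀ r ∈ xs, r ∈ maximalIdeal R)
    (hreg : IsRegular M xs) (hlen : xs.length = d) (hdim : Module.supportDim R M = d)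
    (B G : ℕ → ModuleCat.{u} R) (ι : ∀ j, B j →ₗ[R] G j) (π : ∀ j, G j →ₗ[R] B (j+1))
    (h : ∀ j, SES R (ι j) (π j)) (hG : ∀ j, IsGI R (G j)) (g : ℕ)
    (hg : ∀ j, g < j → Subsingleton (B j)) (e : M ≃ₗ[R] B 0) :
    ∃ rs : List R, (∀ r ∈ rs, r ∈ maximalIdeal R) ∧ IsRegular R rs ∧ rs.length = d := by
  obtain ⟨rs, hrs, hrr, z, hz, hmz⟩ := exists_max_reg (R := R) d R
    (by rw [Module.supportDim_self_eq_ringKrullDim, hd])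
  set t := rs.length with ht
  have hdim' := ringKrullDim_add_length_eq_ringKrullDim_of_isRegular rs hrr
  rw [hd] at hdim'
  obtain ⟨e', he', het⟩ := wb_add hdim'
  rcases Nat.eq_zero_or_pos e' with h0 | hpos
  · exact ⟨rs, hrs, hrr, by omega⟩
  exfalso
  set I := Ideal.ofList rs with hI
  have eLQ : LQ R rs ≃ₗ[R] (R ⧸ I) := Submodule.quotEquivOfEq _ _ (by simp [hI])
  have hnt : Nontrivial (R ⧸ I) := by
    have : Nontrivial (LQ R rs) := ⟨z, 0, hz⟩
    exact eLQ.symm.toEquiv.nontrivial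
  haveI : IsLocalRing (R ⧸ I) := IsLocalRing.of_surjective' (Ideal.Quotient.mk I)
    Ideal.Quotient.mk_surjective
  have hz' : eLQ z ≠ 0 := by simpa using hz
  have hmz' : ∀ r ∈ maximalIdeal R, r • eLQ z = 0 := by
    intro r hr; rw [← map_smul, hmz r hr, map_zero]
  obtain ⟨E, e0, hE⟩ := exists_mat R
  obtain ⟨e1, hE'⟩ := co_mat hE I
  have hEm := co_ne hE I hz' hmz'
  -- projective dimension
  have hP : ∀ (Y : ModuleCat.{u} R) i, t < i → van R (R ⧸ I) Y i := by
    intro Y i hi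
    refine van_congr_left eLQ.symm (van_LQ_left rs R hrr.1 0 ?_ i (by omega))
    intro i hi
    obtain ⟨i, rfl⟩ : ∃ j, i = j + 1 := ⟨i-1, by omega⟩
    exact van_proj
  -- Ext from E'
  have hEE : ∀ (Y : ModuleCat.{u} R), (∀ i, van R E Y (i+1)) →
      ∀ i, van R (Co R (R ⧸ I) E) Y (i+1) := by
    intro Y hY i
    have e3 : Co R (R ⧸ I) E ≃ₗ[R] (LQ R rs →ₗ[R] E) := LinearEquiv.congrLeft E R eLQ.symm
    refine van_congr_left e3 (van_LQ_hom hE.inj rs R hrr.1 ?_ i)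
    intro i
    exact van_congr_left (LinearMap.ringLmapEquivSelf R R E) (hY i)
  have hEG : ∀ j i, van R (Co R (R ⧸ I) E) (G j) (i+1) := fun j =>
    hEE (G j) (fun i => (hG j).van_inj hE.inj i)
  have hPB : ∀ j i, t ≤ i + j → van R (R ⧸ I) (B j) (i+1) := by
    intro j
    induction j with
    | zero => intro i hi; exact hP _ _ (by omega)
    | succ j ih =>
      intro i hi
      exact (h j).co_right ((hG j).van_pd _ t hP i) (ih (i+1) (by omega))
  have hCI : ∀ j, CI (R ⧸ I) ∅ (Co R (R ⧸ I) E) (Co R (R ⧸ I) (G j)) := by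
    intro j
    obtain ⟨Z, X, ι', π', h', hX, hl, ⟨e4⟩⟩ := hG j
    refine ⟨fun k => ModuleCat.of _ (Co R (R ⧸ I) (Z k)), fun k => ModuleCat.of _ (Co R (R ⧸ I) (X k)),
      fun k => Co.map (ι' k), fun k => Co.map (π' k), ?_, fun k => Co.inj (hX k), by simp, ?_,
      ⟨Co.congr e4⟩⟩
    · intro k
      refine Co.ses (h' k) ?_
      intro q
      exact (h' k).lift (gi_van_pd h' hX _ t hP 0 k) q
    · intro k
      refine Co.lift (f := ι' k) ?_
      intro q
      exact (h' k).lift (hEE (Z k) (fun i => gi_van_inj h' hX E (hl E hE.inj) i k) 0) q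
  obtain ⟨ys, hyl, hym, hyT⟩ := exists_sop (R := R ⧸ I) e' he'
  obtain ⟨y, ys, rfl⟩ : ∃ y ys', ys = y :: ys' := by
    cases ys with
    | nil => simp at hyl; omega
    | cons a b => exact ⟨a, b, rfl⟩
  have key := chain_red hE' hEm y (hym y (by simp)) {s | s ∈ y :: ys} hyT g ys ∅
    (fun z hz => hym z (by simp [hz])) (by
      intro z hz
      simp only [Set.mem_setOf_eq, List.mem_cons] at hz
      rcases hz with hz | hz
      · exact Or.inr (Or.inl hz)
      · exact Or.inl hz)
    (fun j => ModuleCat.of _ (Co R (R ⧸ I) (B (t+j)))) (fun j => ModuleCat.of _ (Co R (R ⧸ I) (G (t+j))))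
    (fun j => Co.map (ι (t+j))) (fun j => Co.map (π (t+j)))
    (fun j => Co.ses (h (t+j)) fun q => (h (t+j)).lift (hPB (t+j) 0 (by omega)) q)
    (fun j => hCI (t+j)) (fun j hj => by
      have := hg (t+j) (by omega)
      refine ⟨fun a b => Co.ext fun s => Subsingleton.elim _ _⟩)
  have hyl' : ys.length + 1 = e' := by simpa using hyl
  have h1 : ∀ j, d ≤ j + 1 → van R (Co R (R ⧸ I) E) (B j) 1 := by
    intro j hj
    obtain ⟨j, rfl⟩ : ∃ j', j = t + j' := ⟨j - t, by omega⟩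
    refine (h (t+j)).van1_of_lift (hEG _ 0) ?_
    exact Co.lift' (f := ι (t+j)) (key j (by omega))
  have h2 : ∀ i j, d ≤ j + 1 → van R (Co R (R ⧸ I) E) (B j) (i+1) := by
    intro i
    induction i with
    | zero => exact h1
    | succ i ih => intro j hj; exact (h j).co_left (ih (j+1) (by omega)) (hEG j _)
  have h3 : ∀ n j i, d ≤ j + n + 1 → n ≤ i → van R (Co R (R ⧸ I) E) (B j) (i+1) := by
    intro n
    induction n with
    | zero => intro j i hj _; exact h2 i j hj
    | succ n ih =>
      intro j i hj hi
      obtain ⟨i, rfl⟩ : ∃ i', i = i' + 1 := ⟨i-1, by omega⟩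
      exact (h j).co_left (ih (j+1) i (by omega) (by omega)) (hEG j _)
  have htor : ∀ φ : Co R (R ⧸ I) E, φ ∈ tors (maximalIdeal R) (Co R (R ⧸ I) E) := by
    intro φ
    obtain ⟨n, hn⟩ := hE.tor (φ 1)
    refine ⟨n, fun r hr => ?_⟩
    apply Co.quot_ext
    rw [Co.smulA_apply, hn r hr, Co.zero_apply]
  have h4 : ∀ n, van R (Co R (R ⧸ I) E) M n := by
    intro n
    rcases Nat.lt_or_ge n d with hn | hn
    · exact van_tors d M (fun i hi => van_k_reg xs hxs hreg i (by omega)) htor n hn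
    · obtain ⟨i, rfl⟩ : ∃ i', n = i' + 1 := ⟨n-1, by omega⟩
      exact van_congr_right e (h3 (d-1) 0 i (by omega) (by omega))
  have h5 := van_LQ_right xs M hreg.1 h4 0
  have h6 : Module.supportDim R (LQ M xs) = 0 := by
    have := Module.supportDim_add_length_eq_supportDim_of_isRegular xs hreg
    rw [hdim] at this
    obtain ⟨e5, h51, h52⟩ := wb_add this
    rw [h51, show e5 = 0 by omega]; rfl
  obtain ⟨n, hn0, hn⟩ := soc_of_dim_zero h6
  obtain ⟨f, hf, -⟩ := k_emb hn0 hn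
  obtain ⟨q, φ, hq⟩ := co_to_k hE I hz' hmz'
  have h7 := LinearMap.congr_fun (van_zero_iff.1 h5 (f ∘ₗ q)) φ
  exact hq (hf (h7.trans (map_zero f).symm))
end
end GGP

end PartPE4

section PartPF
namespace GGP
open CategoryTheory Abelian IsLocalRing TensorProduct RingTheory.Sequence
open scoped Pointwise

section
variable {R : Type u} [CommRing R]

theorem cores_chain {P : ModuleCat.{u} R → Prop} {M : Type u} [AddCommGroup M] [Module R M] {n : ℕ}
    (h : GG.CoresolutionLE R P M n) : ∃ (B G : ℕ → ModuleCat.{u} R) (ι : ∀ j, B j →ₗ[R] G j)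
    (π : ∀ j, G j →ₗ[R] B (j+1)), (∀ j, SES R (ι j) (π j)) ∧ (∀ j, P (G j)) ∧
    (∀ j, n < j → Subsingleton (B j)) ∧ Nonempty (M ≃ₗ[R] B 0) := by
  obtain ⟨G, d, ε, hP, hε, h0, hex, hn⟩ := h
  refine ⟨fun j => ModuleCat.of R (LinearMap.ker (d j)), G, fun j => (LinearMap.ker (d j)).subtype,
    fun j => (d j).codRestrict _ (fun x => by rw [← hex j]; exact ⟨x, rfl⟩), fun j => ?_, hP,
    fun j hj => ⟨fun a b => Subtype.ext (by rw [hn j hj a.1, hn j hj b.1])⟩, ?_⟩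
  · refine ⟨Subtype.val_injective, fun y => ?_, fun y => ?_⟩
    · constructor
      · intro hy; exact ⟨⟨y, by simpa using congrArg Subtype.val hy⟩, rfl⟩
      · rintro ⟨y, rfl⟩; exact Subtype.ext y.2
    · obtain ⟨y, hy⟩ := y
      rw [← hex j] at hy
      obtain ⟨x, rfl⟩ := hy
      exact ⟨x, rfl⟩
  · refine ⟨LinearEquiv.ofBijective (ε.codRestrict _ (fun x => by rw [← h0]; exact ⟨x, rfl⟩)) ⟨?_, ?_⟩⟩
    · intro a b hab; exact hε (by simpa using congrArg Subtype.val hab)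
    · rintro ⟨y, hy⟩
      rw [← h0] at hy
      obtain ⟨x, rfl⟩ := hy
      exact ⟨x, rfl⟩

section chains
variable {X : Type u} [AddCommGroup X] [Module R X] {Z J : ℕ → ModuleCat.{u} R}
  {ι : ∀ j, Z j →ₗ[R] J j} {π : ∀ j, J j →ₗ[R] Z (j+1)}

theorem chain_up (h : ∀ j, SES R (ι j) (π j)) (hJ : ∀ n i, van R X (J n) (i+1)) (n : ℕ) :
    ∀ i, van R X (Z n) i → van R X (Z 0) (n + i) := by
  induction n with
  | zero => intro i hi; rwa [zero_add]
  | succ n ih =>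
    intro i hi
    have := ih (i+1) ((h n).co_left hi (hJ _ _))
    rwa [show n + 1 + i = n + (i+1) by ring]

theorem chain_down (h : ∀ j, SES R (ι j) (π j)) (hJ : ∀ n i, van R X (J n) (i+1)) (n : ℕ) :
    ∀ i, van R X (Z 0) (n + i + 1) → van R X (Z n) (i+1) := by
  induction n with
  | zero => intro i hi; rwa [zero_add] at hi
  | succ n ih =>
    intro i hi
    refine (h n).co_right (hJ _ _) (ih (i+1) ?_)
    rwa [show n + (i + 1) + 1 = n + 1 + i + 1 by ring]
end chains

variable (R) in
/-- finite injective dimension -/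
def FID (N : Type u) [AddCommGroup N] [Module R N] : Prop :=
  ∃ n, ∀ (X : ModuleCat.{u} R) i, n < i → van R X N i

theorem FID.of_chain {N : Type u} [AddCommGroup N] [Module R N] {Z J : ℕ → ModuleCat.{u} R}
  {ι : ∀ j, Z j →ₗ[R] J j} {π : ∀ j, J j →ₗ[R] Z (j+1)} (h : ∀ j, SES R (ι j) (π j))
  (hJ : ∀ j, Module.Injective R (J j)) (n : ℕ) (hn : ∀ j, n < j → Subsingleton (Z j))
  (e : N ≃ₗ[R] Z 0) : FID R N := by
  refine ⟨n, fun X i hi => van_congr_right e ?_⟩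
  have := hn i hi
  have := chain_up (X := X) h (fun n i => van_inj (hJ n)) i 0 van_subsingleton_right
  simpa using this

theorem FID.of_idLE {N : Type u} [AddCommGroup N] [Module R N] {n : ℕ} (h : GG.idLE R N n) :
    FID R N := by
  obtain ⟨B, G, ι, π, h1, h2, h3, ⟨e⟩⟩ := cores_chain h
  exact FID.of_chain h1 h2 n h3 e

theorem inj_of_van1 {J : Type u} [AddCommGroup J] [Module R J]
    (h : ∀ X : ModuleCat.{u} R, van R X J 1) : Module.Injective R J :=
  inj_of_ext fun A B f hf k =>
    (SES.ofQuot f hf).extend (h (ModuleCat.of R (B ⧸ LinearMap.range f))) k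

/-- minimal injective resolutions in chain form -/
structure MinRes (R : Type u) [CommRing R] (Z J : ℕ → ModuleCat.{u} R) (ι : ∀ j, Z j →ₗ[R] J j)
    (π : ∀ j, J j →ₗ[R] Z (j+1)) : Prop where
  ses : ∀ j, SES R (ι j) (π j)
  inj : ∀ j, Module.Injective R (J j)
  ess : ∀ j, Ess (ι j)

variable (R) in
theorem exists_minres (N : Type u) [AddCommGroup N] [Module R N] :
    ∃ (Z J : ℕ → ModuleCat.{u} R) (ι : ∀ j, Z j →ₗ[R] J j) (π : ∀ j, J j →ₗ[R] Z (j+1)),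
      MinRes R Z J ι π ∧ Z 0 = ModuleCat.of R N := by
  choose H hι hinj hess using fun Z : ModuleCat.{u} R => exists_hull R Z
  obtain ⟨Z, hZ0, hZ⟩ : ∃ Z : ℕ → ModuleCat.{u} R, Z 0 = ModuleCat.of R N ∧
      ∀ n, Z (n+1) = ModuleCat.of R (H (Z n) ⧸ LinearMap.range (hι (Z n))) :=
    ⟨fun n => Nat.rec (ModuleCat.of R N)
    (fun _ Z => ModuleCat.of R (H Z ⧸ LinearMap.range (hι Z))) n, rfl, fun n => rfl⟩
  have key : ∀ n, ∃ π : H (Z n) →ₗ[R] Z (n+1), SES R (hι (Z n)) π := by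
    intro n
    rw [hZ n]
    exact ⟨_, SES.ofQuot _ (hess _).1⟩
  choose π hπ using key
  exact ⟨Z, fun n => H (Z n), fun n => hι (Z n), π,
    ⟨hπ, fun n => hinj _, fun n => hess _⟩, hZ0⟩

variable {Z J : ℕ → ModuleCat.{u} R} {ι : ∀ j, Z j →ₗ[R] J j} {π : ∀ j, J j →ₗ[R] Z (j+1)}

theorem MinRes.zero (h : MinRes R Z J ι π) (hF : FID R (Z 0)) :
    ∃ n, ∀ j, n < j → Subsingleton (Z j) := by
  obtain ⟨n, hn⟩ := hF
  refine ⟨n, fun j hj => ?_⟩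
  obtain ⟨j, rfl⟩ : ∃ k, j = k + 1 := ⟨j-1, by omega⟩
  have hinj : Module.Injective R (Z j) := inj_of_van1 fun X =>
    chain_down h.ses (fun n i => van_inj (h.inj n)) j 0 (hn X _ (by omega))
  obtain ⟨r, hr⟩ := inj_ext hinj (ι j) (h.ess j).1 LinearMap.id
  have hri := (h.ess j).inj_of_comp r (by rw [hr]; exact fun a b h => h)
  have : ∀ y, π j y = 0 := fun y => by
    refine ((h.ses j).exact y).2 ⟨r y, hri ?_⟩
    exact congrArg (fun f => f (r y)) hr
  refine ⟨fun a b => ?_⟩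
  obtain ⟨a, rfl⟩ := (h.ses j).surj a
  obtain ⟨b, rfl⟩ := (h.ses j).surj b
  rw [this, this]

/-- associated prime -/
def AP (p : Ideal R) (N : Type u) [AddCommGroup N] [Module R N] : Prop :=
  ∃ x : N, ∀ r : R, r • x = 0 ↔ r ∈ p

theorem AP.of_inj {p : Ideal R} {A B : Type u} [AddCommGroup A] [Module R A] [AddCommGroup B]
    [Module R B] (f : A →ₗ[R] B) (hf : Function.Injective f) (h : AP p A) : AP p B := by
  obtain ⟨x, hx⟩ := h
  refine ⟨f x, fun r => ?_⟩
  rw [← hx r, ← map_smul, map_eq_zero_iff f hf]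

theorem AP.of_ess {p : Ideal R} [hp : p.IsPrime] {A B : Type u} [AddCommGroup A] [Module R A] [AddCommGroup B]
    [Module R B] {f : A →ₗ[R] B} (hf : Ess f) (h : AP p B) : AP p A := by
  obtain ⟨x, hx⟩ := h
  have hx0 : x ≠ 0 := fun h0 => hp.ne_top ((Ideal.eq_top_iff_one _).2 ((hx 1).1 (by simp [h0])))
  obtain ⟨r, hr, a, ha⟩ := hf.2 x hx0
  refine ⟨a, fun s => ?_⟩
  have hrp : r ∉ p := fun h => hr ((hx r).2 h)
  rw [← map_eq_zero_iff f hf.1, map_smul, ha, smul_smul, hx]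
  exact ⟨fun h => (hp.mem_or_mem h).resolve_right hrp, fun h => p.mul_mem_right _ h⟩

theorem AP.map {p : Ideal R} {N : Type u} [AddCommGroup N] [Module R N] (h : AP p N) :
    ∃ f : (R ⧸ p) →ₗ[R] N, Function.Injective f := by
  obtain ⟨x, hx⟩ := h
  refine ⟨Submodule.liftQ p (LinearMap.toSpanSingleton R N x) (fun r hr => by
    simpa using (hx r).2 hr), ?_⟩
  rw [← LinearMap.ker_eq_bot]
  refine Submodule.ker_liftQ_eq_bot _ _ _ (fun r hr => by simpa [hx] using hr)

theorem AP.of_map {p : Ideal R} {N : Type u} [AddCommGroup N] [Module R N]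
    (f : (R ⧸ p) →ₗ[R] N) (hf : Function.Injective f) : AP p N := by
  refine AP.of_inj f hf ⟨Ideal.Quotient.mk p 1, fun r => ?_⟩
  change Ideal.Quotient.mk p (r * 1) = 0 ↔ _
  rw [mul_one, Ideal.Quotient.eq_zero_iff_mem]

theorem ap_of_ne [IsNoetherianRing R] {N : Type u} [AddCommGroup N] [Module R N] {x : N} (hx : x ≠ 0) :
    ∃ (p : Ideal R) (_ : p.IsPrime), AP p N ∧ ∃ s : R, ∀ r, r • s • x = 0 ↔ r ∈ p := by
  obtain ⟨I, ⟨⟨s, hs, rfl⟩, hI⟩⟩ := set_has_maximal_iff_noetherian.2 (inferInstanceAs (IsNoetherian R R))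
    {I : Ideal R | ∃ s : R, s • x ≠ 0 ∧ I = LinearMap.ker (LinearMap.toSpanSingleton R N (s • x))}
    ⟨_, 1, by simpa using hx, rfl⟩
  have hm : ∀ r, r ∈ LinearMap.ker (LinearMap.toSpanSingleton R N (s • x)) ↔ r • s • x = 0 := fun r => by
    simp
  refine ⟨_, ⟨?_, ?_⟩, ⟨s • x, fun r => (hm r).symm⟩, s, fun r => (hm r).symm⟩
  · rw [Ne, Ideal.eq_top_iff_one, hm, one_smul]; exact hs
  · intro a b hab
    by_contra hc
    push Not at hc
    rw [hm] at hab
    rw [hm, hm] at hc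
    refine hI _ ⟨b * s, by rw [mul_smul]; exact hc.2, rfl⟩ (lt_of_le_of_ne ?_ ?_)
    · intro r hr
      rw [hm] at hr
      simp only [LinearMap.mem_ker, LinearMap.toSpanSingleton_apply]
      rw [mul_smul, smul_comm r b, hr, smul_zero]
    · intro heq
      have : a ∈ LinearMap.ker (LinearMap.toSpanSingleton R N ((b * s) • x)) := by
        simp only [LinearMap.mem_ker, LinearMap.toSpanSingleton_apply]
        rw [mul_smul, smul_smul, hab]
      rw [← heq, hm] at this
      exact hc.1 this

/-- vanishing of Ext kills associated primes of minimal cosyzygies -/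
theorem MinRes.not_ap (h : MinRes R Z J ι π) {p : Ideal R} [hp : p.IsPrime] (n : ℕ)
    (hv : van R (R ⧸ p) (Z 0) n) : ¬ AP p (Z n) := by
  intro hap
  obtain ⟨f, hf⟩ := hap.map
  have hf0 : f (Ideal.Quotient.mk p 1) ≠ 0 := by
    rw [Ne, map_eq_zero_iff f hf, map_one]
    have : Nontrivial (R ⧸ p) := Ideal.Quotient.nontrivial_iff.2 hp.ne_top
    exact one_ne_zero
  cases n with
  | zero =>
    rw [van_zero_iff] at hv
    exact hf0 (by rw [hv f]; rfl)
  | succ n =>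
    obtain ⟨f', hf'⟩ := (h.ses n).lift (chain_down h.ses (fun n i => van_inj (h.inj n)) n 0 hv) f
    have h1 : ∀ z, π n (f' z) = f z := fun z => congrArg (fun g => g z) hf'
    by_cases hy : f' (Ideal.Quotient.mk p 1) = 0
    · exact hf0 (by rw [← h1, hy, map_zero])
    · obtain ⟨r, hr, hr'⟩ := (h.ess n).2 _ hy
      have h2 := ((h.ses n).exact _).2 hr'
      rw [← map_smul, h1, map_eq_zero_iff f hf] at h2
      rw [← map_smul, h2, map_zero] at hr
      exact hr rfl

theorem MinRes.van_of_not_ap [IsLocalRing R] (h : MinRes R Z J ι π) (n : ℕ)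
    (hn : ¬ AP (maximalIdeal R) (Z n)) : van R (R ⧸ maximalIdeal R) (Z 0) n := by
  have := chain_up (X := R ⧸ maximalIdeal R) h.ses (fun n i => van_inj (h.inj n)) n 0 (by
    rw [van_zero_iff]
    intro f
    by_contra hf
    have h1 : f (Ideal.Quotient.mk _ 1) ≠ 0 := fun h1 => hf (by
      refine LinearMap.ext fun x => ?_
      obtain ⟨r, rfl⟩ := Ideal.Quotient.mk_surjective x
      have : Ideal.Quotient.mk (maximalIdeal R) r = r • Ideal.Quotient.mk (maximalIdeal R) 1 := by
        change _ = Ideal.Quotient.mk (maximalIdeal R) (r * 1); rw [mul_one]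
      rw [this, map_smul, h1]; simp)
    obtain ⟨g, hg, -⟩ := k_emb h1 (fun r hr => by
      rw [← map_smul]
      have : r • Ideal.Quotient.mk (maximalIdeal R) 1 = 0 := by
        change Ideal.Quotient.mk (maximalIdeal R) (r * 1) = 0
        rw [mul_one, Ideal.Quotient.eq_zero_iff_mem]; exact hr
      rw [this, map_zero])
    exact hn (AP.of_map g hg))
  simpa using this

end
end GGP

end PartPF

section PartPF2
namespace GGP
open CategoryTheory Abelian IsLocalRing TensorProduct RingTheory.Sequence
open scoped Pointwise

section
variable {R : Type u} [CommRing R] [IsNoetherianRing R]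

theorem filt_van {N : Type u} [AddCommGroup N] [Module R N] (J : Ideal R) (i : ℕ)
    (h : ∀ q : Ideal R, q.IsPrime → J ≤ q → van R (R ⧸ q) N i) (X : Type u) [AddCommGroup X]
    [Module R X] [hX : Module.Finite R X] : J ≤ Module.annihilator R X → van R X N i := by
  refine IsNoetherianRing.induction_on_isQuotientEquivQuotientPrime R hX
    (motive := fun X _ _ _ => J ≤ Module.annihilator R X → van R X N i) ?_ ?_ ?_
  · intro N _ _ _ _ _; exact van_subsingleton_left
  · intro N _ _ _ p e hJ
    refine van_congr_left e (h p.1 p.2 ?_)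
    rwa [e.annihilator_eq, Ideal.annihilator_quotient] at hJ
  · intro N1 _ _ _ N2 _ _ _ N3 _ _ _ f g hf hg hfg h1 h3 hJ
    exact SES.contra_mid ⟨hf, hfg, hg⟩ (h1 (hJ.trans (f.annihilator_le_of_injective hf)))
      (h3 (hJ.trans (g.annihilator_le_of_surjective hg)))

variable [IsLocalRing R]

/-- the Nakayama step -/
theorem prime_step {N : Type u} [AddCommGroup N] [Module R N] [Module.Finite R N]
    (p : Ideal R) [hp : p.IsPrime] (x : R) (hx : x ∈ maximalIdeal R) (hxp : x ∉ p) (i : ℕ)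
    (h : ∀ q : Ideal R, q.IsPrime → p < q → x ∈ q → van R (R ⧸ q) N (i+1)) : van R (R ⧸ p) N i := by
  have hreg : IsSMulRegular (R ⧸ p) x := by
    rw [isSMulRegular_iff_right_eq_zero_of_smul]
    intro y hy
    obtain ⟨y, rfl⟩ := Ideal.Quotient.mk_surjective y
    change Ideal.Quotient.mk p (x * y) = 0 at hy
    rw [Ideal.Quotient.eq_zero_iff_mem] at hy ⊢
    exact (hp.mem_or_mem hy).resolve_left hxp
  refine van_nak_left hx (ses_smul hreg) ?_
  refine filt_van (p ⊔ Ideal.span {x}) (i+1) (fun q hq hle => ?_) _ ?_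
  · have hxq : x ∈ q := hle (Ideal.mem_sup_right (Ideal.mem_span_singleton_self x))
    refine h q hq (lt_of_le_of_ne (le_sup_left.trans hle) ?_) hxq
    rintro rfl
    exact hxp hxq
  · refine sup_le ?_ ?_
    · intro r hr
      rw [Module.mem_annihilator]
      intro z
      obtain ⟨z, rfl⟩ := Submodule.mkQ_surjective _ z
      obtain ⟨z, rfl⟩ := Ideal.Quotient.mk_surjective z
      rw [← map_smul]
      have : r • Ideal.Quotient.mk p z = 0 := by
        change Ideal.Quotient.mk p (r * z) = 0
        rw [Ideal.Quotient.eq_zero_iff_mem]; exact p.mul_mem_right _ hr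
      rw [this, map_zero]
    · rw [Ideal.span_singleton_le_iff_mem, Module.mem_annihilator]
      intro z
      obtain ⟨z, rfl⟩ := Submodule.mkQ_surjective _ z
      rw [← map_smul, Submodule.mkQ_apply, Submodule.Quotient.mk_eq_zero]
      exact Submodule.smul_mem_pointwise_smul _ _ _ trivial

theorem exists_mem_not_mem {p : Ideal R} [p.IsPrime] (h : p ≠ maximalIdeal R) :
    ∃ x ∈ maximalIdeal R, x ∉ p := by
  by_contra hc
  push Not at hc
  exact h (le_antisymm (le_maximalIdeal_of_isPrime p) hc)

theorem bass_prime {N : Type u} [AddCommGroup N] [Module R N] [Module.Finite R N] (n : ℕ)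
    (hk : ∀ i, n ≤ i → van R (R ⧸ maximalIdeal R) N i) (p : Ideal R) :
    p.IsPrime → ∀ i, n ≤ i → van R (R ⧸ p) N i := by
  refine WellFoundedGT.induction (motive := fun p : Ideal R => p.IsPrime → ∀ i, n ≤ i → van R (R ⧸ p) N i) p ?_
  intro p ih hp i hi
  by_cases hpm : p = maximalIdeal R
  · subst hpm; exact hk i hi
  · obtain ⟨x, hx, hxp⟩ := exists_mem_not_mem hpm
    exact prime_step p x hx hxp i fun q hq hlt _ => ih q hlt hq _ (by omega)

theorem bass_van {N : Type u} [AddCommGroup N] [Module R N] [Module.Finite R N] (n : ℕ)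
    (hk : ∀ i, n ≤ i → van R (R ⧸ maximalIdeal R) N i) (X : Type u) [AddCommGroup X] [Module R X]
    [Module.Finite R X] (i : ℕ) (hi : n ≤ i) : van R X N i :=
  filt_van ⊥ i (fun q hq _ => bass_prime n hk q hq i hi) X bot_le

theorem ring_t (hF : FID R R) : ∃ t : ℕ, (∀ i, van R (R ⧸ maximalIdeal R) R i ↔ i ≠ t) ∧
    ∃ rs : List R, rs.length = t ∧ (∀ r ∈ rs, r ∈ maximalIdeal R) ∧ IsRegular R rs := by
  obtain ⟨d, hd⟩ : ∃ d : ℕ, ringKrullDim R = d := by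
    have h1 := ringKrullDim_lt_top (R := R)
    have h0 : ringKrullDim R ≠ ⊥ := ringKrullDim_ne_bot
    obtain ⟨a, ha⟩ := WithBot.ne_bot_iff_exists.1 h0
    rw [← ha] at h1
    obtain ⟨b, hb⟩ := ENat.ne_top_iff_exists.1 (show a ≠ ⊤ by rintro rfl; exact lt_irrefl _ h1)
    exact ⟨b, by rw [← ha, ← hb]; rfl⟩
  obtain ⟨rs, hm, hreg, z, hz, hzm⟩ := exists_max_reg d R (by
    rw [Module.supportDim_self_eq_ringKrullDim, hd])
  obtain ⟨f, hf, -⟩ := k_emb hz hzm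
  obtain ⟨n, hn⟩ := hF
  have hLQ : ∀ i, rs.length < i → van R (LQ R rs) R i := by
    have := van_LQ_left (Y := R) rs R hreg.toIsWeaklyRegular 0 (fun i hi => by
      obtain ⟨i, rfl⟩ : ∃ k, i = k + 1 := ⟨i-1, by omega⟩
      exact van_proj)
    simpa using this
  have hgt : ∀ k, k ≤ n → ∀ i, rs.length + 1 + (n - k) ≤ i → van R (R ⧸ maximalIdeal R) R i := by
    intro k
    induction k with
    | zero => intro _ i hi; exact hn (ModuleCat.of R (R ⧸ maximalIdeal R)) i (by omega)
    | succ k ih =>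
      intro hk i hi
      refine (SES.ofQuot f hf).contra_left (hLQ i (by omega)) ?_
      exact bass_van (N := R) _ (ih (by omega)) _ (i+1) (by omega)
  have hgt' : ∀ i, rs.length < i → van R (R ⧸ maximalIdeal R) R i := fun i hi =>
    hgt n le_rfl i (by omega)
  refine ⟨rs.length, fun i => ⟨?_, fun hi => ?_⟩, rs, rfl, hm, hreg⟩
  · rintro hv rfl
    have : ∀ i, 0 ≤ i → van R (R ⧸ maximalIdeal R) R i := by
      intro i _
      rcases lt_trichotomy i rs.length with h | h | h
      · exact van_k_reg rs hm hreg i h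
      · rw [h]; exact hv
      · exact hgt' i h
    have h2 := bass_van 0 this R 0 le_rfl
    rw [van_zero_iff] at h2
    have := congrArg (fun g => g 1) (h2 LinearMap.id)
    simp at this
  · rcases lt_or_gt_of_ne hi with h | h
    · exact van_k_reg rs hm hreg i h
    · exact hgt' i h

variable {Z J : ℕ → ModuleCat.{u} R} {ι : ∀ j, Z j →ₗ[R] J j} {π : ∀ j, J j →ₗ[R] Z (j+1)}

theorem loc_main (h : MinRes R Z J ι π) (e : R ≃ₗ[R] Z 0) (hF : FID R R) :
    ∃ t : ℕ, (∀ n, AP (maximalIdeal R) (Z n) ↔ n = t) ∧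
    (∀ p : Ideal R, p.IsPrime → p ≠ maximalIdeal R → ∀ n, AP p (Z n) → n < t) ∧
    (∀ p : Ideal R, p.IsPrime → p ≠ maximalIdeal R →
      (∀ q : Ideal R, q.IsPrime → p < q → q = maximalIdeal R) → ∀ n, AP p (Z n) → n + 1 = t) ∧
    (t : WithBot ℕ∞) ≤ ringKrullDim R := by
  obtain ⟨t, ht, rs, hrs, hm, hreg⟩ := ring_t hF
  refine ⟨t, fun n => ⟨fun hap => ?_, ?_⟩, fun p hp hpm n hap => ?_, fun p hp hpm hpq n hap => ?_, ?_⟩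
  · by_contra hne
    exact h.not_ap n (van_congr_right e.symm ((ht n).2 hne)) hap
  · rintro rfl
    by_contra hne
    exact (ht n).1 (van_congr_right e (h.van_of_not_ap n hne)) rfl
  · by_contra hlt
    refine h.not_ap n (van_congr_right e.symm ?_) hap
    obtain ⟨x, hx, hxp⟩ := exists_mem_not_mem hpm
    exact prime_step p x hx hxp n fun q hq hlt' _ => bass_prime (t+1) (fun i hi => (ht i).2 (by omega))
      q hq _ (by omega)
  · by_contra hne
    refine h.not_ap n (van_congr_right e.symm ?_) hap
    obtain ⟨x, hx, hxp⟩ := exists_mem_not_mem hpm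
    refine prime_step p x hx hxp n fun q hq hlt' _ => ?_
    rw [hpq q hq hlt']
    exact (ht _).2 hne
  · have := ringKrullDim_add_length_eq_ringKrullDim_of_isRegular rs hreg
    rw [← this, ← hrs]
    refine le_add_of_nonneg_left ?_
    have : Nontrivial (R ⧸ Ideal.ofList rs) := by
      refine Ideal.Quotient.nontrivial_iff.2 fun htop => ?_
      have := hreg.top_ne_smul
      rw [htop] at this
      simp at this
    exact ringKrullDim_nonneg_of_nontrivial
end
end GGP

end PartPF2

section PartPF3
namespace GGP
open CategoryTheory Abelian IsLocalRing TensorProduct RingTheory.Sequence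
open scoped Pointwise

section
variable {R : Type u} [CommRing R] (S : Submonoid R)
variable {A B C N : Type u} [AddCommGroup A] [Module R A] [AddCommGroup B] [Module R B]
  [AddCommGroup C] [Module R C] [AddCommGroup N] [Module R N]

theorem lm_zero {b : N} {s : S} : LocalizedModule.mk b s = 0 ↔ ∃ u ∈ S, u • b = 0 := by
  rw [← LocalizedModule.zero_mk 1, LocalizedModule.mk_eq]
  constructor
  · rintro ⟨u, hu⟩
    refine ⟨u, u.2, ?_⟩
    simpa [Submonoid.smul_def] using hu
  · rintro ⟨u, hu, h⟩
    refine ⟨⟨u, hu⟩, ?_⟩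
    simpa [Submonoid.smul_def] using h

theorem lm_sat [IsNoetherianRing R] (b : N) :
    ∃ s ∈ S, ∀ r : R, (∃ u ∈ S, u • r • b = 0) → r • s • b = 0 := by
  obtain ⟨I, ⟨⟨s, hs, rfl⟩, hI⟩⟩ := set_has_maximal_iff_noetherian.2 (inferInstanceAs (IsNoetherian R R))
    {I : Ideal R | ∃ s ∈ S, I = LinearMap.ker (LinearMap.toSpanSingleton R N (s • b))}
    ⟨_, 1, S.one_mem, rfl⟩
  refine ⟨s, hs, fun r ⟨u, hu, h⟩ => ?_⟩
  have hle : LinearMap.ker (LinearMap.toSpanSingleton R N (s • b)) ≤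
      LinearMap.ker (LinearMap.toSpanSingleton R N ((u * s) • b)) := by
    intro a ha
    simp only [LinearMap.mem_ker, LinearMap.toSpanSingleton_apply] at ha ⊢
    rw [mul_smul, smul_comm a u, ha, smul_zero]
  have heq := eq_of_le_of_not_lt hle (hI _ ⟨u * s, S.mul_mem hu hs, rfl⟩)
  have : r ∈ LinearMap.ker (LinearMap.toSpanSingleton R N ((u * s) • b)) := by
    simp only [LinearMap.mem_ker, LinearMap.toSpanSingleton_apply]
    rw [mul_comm, mul_smul, smul_comm r s, smul_comm r u, h, smul_zero]
  rw [← heq] at this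
  simpa using this

theorem SES.loc {f : A →ₗ[R] B} {g : B →ₗ[R] C} (h : SES R f g) :
    SES (Localization S) (LocalizedModule.map S f) (LocalizedModule.map S g) where
  inj := LocalizedModule.map_injective S f h.inj
  exact := LocalizedModule.map_exact S f g h.exact
  surj := LocalizedModule.map_surjective S g h.surj

theorem lm_smul (r : R) (s : S) (b : N) :
    algebraMap R (Localization S) r • LocalizedModule.mk b s = LocalizedModule.mk (r • b) s := by
  rw [algebraMap_smul, LocalizedModule.smul'_mk]

theorem Ess.loc [IsNoetherianRing R] {f : A →ₗ[R] B} (h : Ess f) : Ess (LocalizedModule.map S f) := by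
  refine ⟨LocalizedModule.map_injective S f h.1, fun y hy => ?_⟩
  induction y using LocalizedModule.induction_on with
  | _ b s =>
  obtain ⟨s0, hs0, hsat⟩ := lm_sat S b
  have hb : s0 • b ≠ 0 := fun h0 => hy ((lm_zero S).2 ⟨s0, hs0, h0⟩)
  obtain ⟨r, hr, a, ha⟩ := h.2 _ hb
  refine ⟨algebraMap R _ (r * s0), ?_, LocalizedModule.mk a s, ?_⟩
  · rw [lm_smul, Ne, lm_zero]
    rintro ⟨u, hu, h0⟩
    refine hr (hsat r ⟨u * s0, S.mul_mem hu hs0, ?_⟩)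
    rw [mul_smul, smul_comm s0 r, ← mul_smul r s0]; exact h0
  · rw [lm_smul, LocalizedModule.map_mk, ha, mul_smul]

variable {Z J : ℕ → ModuleCat.{u} R} {ι : ∀ j, Z j →ₗ[R] J j} {π : ∀ j, J j →ₗ[R] Z (j+1)}

theorem MinRes.loc [IsNoetherianRing R] (h : MinRes R Z J ι π) : MinRes (Localization S)
    (fun n => ModuleCat.of (Localization S) (LocalizedModule S (Z n)))
    (fun n => ModuleCat.of (Localization S) (LocalizedModule S (J n)))
    (fun n => LocalizedModule.map S (ι n)) (fun n => LocalizedModule.map S (π n)) where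
  ses n := (h.ses n).loc S
  inj n := by
    have := h.inj n
    exact Module.injective_of_isLocalizedModule S (LocalizedModule.mkLinearMap S (J n))
  ess n := (h.ess n).loc S

theorem ap_loc [IsNoetherianRing R] (P : Ideal (Localization S)) [hP : P.IsPrime] :
    AP P (LocalizedModule S N) ↔ AP (P.comap (algebraMap R (Localization S))) N := by
  constructor
  · rintro ⟨y, hy⟩
    induction y using LocalizedModule.induction_on with
    | _ b s =>
    obtain ⟨s0, hs0, hsat⟩ := lm_sat S b
    refine ⟨s0 • b, fun r => ?_⟩
    rw [Ideal.mem_comap, ← hy, lm_smul, lm_zero]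
    exact ⟨fun h => ⟨s0, hs0, by rwa [smul_comm]⟩, hsat r⟩
  · rintro ⟨x, hx⟩
    refine ⟨LocalizedModule.mk x 1, fun z => ?_⟩
    obtain ⟨⟨a, s⟩, rfl⟩ := IsLocalization.mk'_surjective S z
    have hz : IsLocalization.mk' (Localization S) a s = Localization.mk a s := by
      rw [Localization.mk_eq_mk']
    change IsLocalization.mk' (Localization S) a s • _ = 0 ↔ IsLocalization.mk' (Localization S) a s ∈ P
    rw [IsLocalization.mk'_mem_iff, ← Ideal.mem_comap, ← hx, hz, LocalizedModule.mk_smul_mk, lm_zero]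
    constructor
    · rintro ⟨u, hu, h⟩
      rw [smul_smul, hx] at h
      rw [hx]
      refine (Ideal.IsPrime.mem_or_mem inferInstance h).resolve_left fun h' => hP.ne_top ?_
      exact Ideal.eq_top_of_isUnit_mem _ h' (IsLocalization.map_units _ ⟨u, hu⟩)
    · intro h; exact ⟨1, S.one_mem, by rw [h, smul_zero]⟩

noncomputable def lmSelf (e : R ≃ₗ[R] N) : Localization S ≃ₗ[Localization S] LocalizedModule S N :=
  (IsLocalizedModule.linearEquiv S (Algebra.linearMap R (Localization S))
    (LocalizedModule.mkLinearMap S N ∘ₗ e.toLinearMap)).extendScalarsOfIsLocalization S (Localization S)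

end

section
variable {R : Type u} [CommRing R] [IsNoetherianRing R]
variable {Z J : ℕ → ModuleCat.{u} R} {ι : ∀ j, Z j →ₗ[R] J j} {π : ∀ j, J j →ₗ[R] Z (j+1)}

theorem FID.loc (S : Submonoid R) (h : FID R R) : FID (Localization S) (Localization S) := by
  obtain ⟨Z, J, ι, π, hm, hZ⟩ := exists_minres R R
  have e : R ≃ₗ[R] Z 0 := by rw [hZ]
  obtain ⟨n, hn⟩ := hm.zero (by rw [hZ]; exact h)
  refine FID.of_chain (Z := fun n => ModuleCat.of (Localization S) (LocalizedModule S (Z n))) (hm.loc S).ses (hm.loc S).inj n (fun j hj => ?_) (lmSelf S e)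
  have := hn j hj
  exact inferInstanceAs (Subsingleton (LocalizedModule S (Z j)))

theorem exists_t (h : MinRes R Z J ι π) (e : R ≃ₗ[R] Z 0) (hF : FID R R) :
    ∃ t : PrimeSpectrum R → ℕ, (∀ p n, AP p.asIdeal (Z n) ↔ n = t p) ∧ StrictMono t ∧
      (∀ p q, p ⋖ q → t q = t p + 1) ∧ ∀ p, (t p : ℕ∞) = Order.height p := by
  have key : ∀ p : PrimeSpectrum R, ∃ t : ℕ, (∀ n, AP p.asIdeal (Z n) ↔ n = t) ∧
      (∀ q < p, ∀ n, AP q.asIdeal (Z n) → n < t) ∧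
      (∀ q, q ⋖ p → ∀ n, AP q.asIdeal (Z n) → n + 1 = t) ∧ (t : ℕ∞) ≤ Order.height p := by
    intro p
    have hcm : (maximalIdeal (Localization p.asIdeal.primeCompl)).comap (algebraMap R _) = p.asIdeal :=
      Localization.AtPrime.under_maximalIdeal
    obtain ⟨t, h1, h2, h3, h4⟩ := loc_main (R := Localization p.asIdeal.primeCompl)
      (h.loc p.asIdeal.primeCompl) (lmSelf _ e) (hF.loc _)
    have hdis : ∀ q : PrimeSpectrum R, q < p → ∃ Q : Ideal (Localization p.asIdeal.primeCompl),
        Q.IsPrime ∧ Q ≠ maximalIdeal _ ∧ Q.comap (algebraMap R _) = q.asIdeal := by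
      intro q hq
      have hd : Disjoint (p.asIdeal.primeCompl : Set R) q.asIdeal :=
        Set.disjoint_left.2 fun x hx hx' => hx (hq.le hx')
      have hc := IsLocalization.under_map_of_isPrime_disjoint p.asIdeal.primeCompl
        (Localization p.asIdeal.primeCompl) q.2 hd
      refine ⟨q.asIdeal.map (algebraMap R _),
        IsLocalization.isPrime_of_isPrime_disjoint _ _ _ q.2 hd, ?_, hc⟩
      intro heq
      change Ideal.comap _ _ = _ at hc
      rw [heq, hcm] at hc
      exact hq.ne (PrimeSpectrum.ext hc.symm)
    refine ⟨t, fun n => ?_, fun q hq n hn => ?_, fun q hq n hn => ?_, ?_⟩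
    · rw [← h1 n]
      have := ap_loc (N := Z n) p.asIdeal.primeCompl (maximalIdeal (Localization p.asIdeal.primeCompl))
      rw [hcm] at this
      exact this.symm
    · obtain ⟨Q, hQ, hQm, hQc⟩ := hdis q hq
      refine h2 Q hQ hQm n ?_
      rw [← hQc] at hn
      exact (ap_loc _ _).2 hn
    · obtain ⟨Q, hQ, hQm, hQc⟩ := hdis q hq.lt
      refine h3 Q hQ hQm (fun Q' hQ' hlt => ?_) n ?_
      · by_contra hne
        have hle : ∀ {I I' : Ideal (Localization p.asIdeal.primeCompl)},
          I.comap (algebraMap R _) ≤ I'.comap (algebraMap R _) → I ≤ I' := fun {I I'} hh =>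
            (IsLocalization.orderEmbedding p.asIdeal.primeCompl _).le_iff_le.1 hh
        refine hq.2 (c := ⟨Q'.comap (algebraMap R _), inferInstance⟩) ?_ ?_
        · rw [lt_iff_le_not_ge]
          constructor
          · change q.asIdeal ≤ Q'.comap (algebraMap R _)
            rw [← hQc]; exact Ideal.comap_mono hlt.le
          · intro hh
            change Q'.comap (algebraMap R _) ≤ q.asIdeal at hh
            rw [← hQc] at hh
            exact hlt.not_ge (hle hh)
        · rw [lt_iff_le_not_ge]
          constructor
          · change Q'.comap (algebraMap R _) ≤ p.asIdeal
            exact (Ideal.comap_mono (le_maximalIdeal_of_isPrime _)).trans hcm.le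
          · intro hh
            change p.asIdeal ≤ Q'.comap (algebraMap R _) at hh
            exact hne (le_antisymm (le_maximalIdeal_of_isPrime _) (hle (hcm.le.trans hh)))
      · rw [← hQc] at hn
        exact (ap_loc _ _).2 hn
    · have h5 : ringKrullDim (Localization p.asIdeal.primeCompl) = p.asIdeal.height :=
        IsLocalization.AtPrime.ringKrullDim_eq_height p.asIdeal _
      rw [h5, PrimeSpectrum.height_eq_orderHeight] at h4
      exact_mod_cast h4
  choose t h1 h2 h3 h4 using key
  have hmono : StrictMono t := fun p q hpq => h2 q p hpq _ ((h1 p _).2 rfl)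
  refine ⟨t, h1, hmono, fun p q hpq => (h3 q p hpq _ ((h1 p _).2 rfl)).symm, fun p => ?_⟩
  refine le_antisymm (h4 p) ?_
  have := Order.height_le_height_apply_of_strictMono t hmono p
  rwa [Order.height_nat] at this
end
end GGP

end PartPF3

section PartPF4
namespace GGP
open CategoryTheory Abelian IsLocalRing TensorProduct RingTheory.Sequence
open scoped Pointwise

section order
variable {α : Type*} [PartialOrder α] {h : α → ℕ}

theorem exists_cov_up (hm : StrictMono h) (a : α) : ∀ (n : ℕ) (b : α), h b = n → a < b → ∃ c, a ⋖ c ∧ c ≤ b := by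
  intro n
  induction n using Nat.strong_induction_on with
  | _ n ih =>
    intro b hb hab
    by_cases hc : a ⋖ b
    · exact ⟨b, hc, le_rfl⟩
    · rw [not_covBy_iff hab] at hc
      obtain ⟨c, hac, hcb⟩ := hc
      obtain ⟨c', h1, h2⟩ := ih (h c) (by rw [← hb]; exact hm hcb) c rfl hac
      exact ⟨c', h1, h2.trans hcb.le⟩

theorem ord_coheight (hm : StrictMono h) (hc : ∀ p q, p ⋖ q → h q = h p + 1) (m : α) (hle : ∀ p, p ≤ m) :
    ∀ (k : ℕ) (p : α), h m ≤ h p + k → (h m : ℕ∞) ≤ h p + Order.coheight p := by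
  intro k
  induction k with
  | zero => intro p hp; exact le_add_right (by exact_mod_cast hp)
  | succ k ih =>
    intro p hp
    rcases (hle p).eq_or_lt with rfl | hlt
    · exact le_self_add
    · obtain ⟨c, hpc, -⟩ := exists_cov_up hm p _ m rfl hlt
      have h1 := hc p c hpc
      have h2 := ih c (by omega)
      have h3 := Order.coheight_add_one_le hpc.lt
      refine h2.trans ?_
      rw [h1]
      push_cast
      rw [add_assoc, add_comm 1]
      gcongr
end order

section
variable {A R : Type u} [CommRing A] [CommRing R] (f : A →+* R) (hf : Function.Surjective f)
include hf

theorem comap_strict : StrictMono (PrimeSpectrum.comap f) := by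
  intro p q hpq
  rw [lt_iff_le_not_ge] at hpq ⊢
  refine ⟨Ideal.comap_mono hpq.1, fun h => hpq.2 ?_⟩
  intro r hr
  obtain ⟨a, rfl⟩ := hf r
  exact h hr

theorem exists_comap (c : PrimeSpectrum A) (hc : RingHom.ker f ≤ c.asIdeal) :
    ∃ c', PrimeSpectrum.comap f c' = c := by
  have := _root_.range_comap_of_surjective R f hf
  have h2 : c ∈ Set.range (PrimeSpectrum.comap f) := by
    rw [this]; exact hc
  exact h2

theorem comap_cov {p q : PrimeSpectrum R} (h : p ⋖ q) :
    PrimeSpectrum.comap f p ⋖ PrimeSpectrum.comap f q := by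
  refine ⟨comap_strict f hf h.lt, fun c h1 h2 => ?_⟩
  obtain ⟨c', rfl⟩ := exists_comap f hf c ((Ideal.comap_mono bot_le).trans h1.le)
  have hs : ∀ {a b : PrimeSpectrum R}, PrimeSpectrum.comap f a ≤ PrimeSpectrum.comap f b → a ≤ b := by
    intro a b hab r hr
    obtain ⟨a, rfl⟩ := hf r
    exact hab hr
  refine h.2 (c := c') ?_ ?_
  · exact lt_iff_le_not_ge.2 ⟨hs h1.le, fun h => h1.not_ge (Ideal.comap_mono h)⟩
  · exact lt_iff_le_not_ge.2 ⟨hs h2.le, fun h => h2.not_ge (Ideal.comap_mono h)⟩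
end

section
variable {A : Type u} [CommRing A]

theorem FID.quot (x : A) (hx : ∀ a : A, x * a = 0 → a = 0) (hF : FID A A) :
    FID (A ⧸ Ideal.span {x}) (A ⧸ Ideal.span {x}) := by
  obtain ⟨J, ι, hJ, hess⟩ := exists_hull A A
  have hxi : ∀ j : J, x • j = 0 → j = 0 := by
    intro j hj
    by_contra hne
    obtain ⟨r, hr, a, ha⟩ := hess.2 j hne
    have : ι (x * a) = 0 := by rw [← smul_eq_mul, map_smul, ha, smul_comm, hj, smul_zero]
    rw [map_eq_zero_iff ι hess.1] at this
    rw [← ha, hx a this, map_zero] at hr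
    exact hr rfl
  obtain ⟨z, hz⟩ : ∃ z : J, x • z = ι 1 := by
    obtain ⟨k, hk⟩ := inj_ext hJ (x • LinearMap.id : A →ₗ[A] A)
      ((injective_iff_map_eq_zero _).2 fun a ha => hx a (by simpa using ha)) ι
    exact ⟨k 1, by rw [← map_smul, ← hk]; simp⟩
  let Q := J ⧸ LinearMap.range ι
  have hQ : SES A ι (LinearMap.range ι).mkQ := SES.ofQuot ι hess.1
  let I := Ideal.span {x}
  have hιa : ∀ a : A, ι a = a • ι 1 := fun a => by rw [← map_smul, smul_eq_mul, mul_one]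
  have h0 : I ≤ LinearMap.ker (LinearMap.toSpanSingleton A Q ((LinearMap.range ι).mkQ z)) := by
    rw [Ideal.span_singleton_le_iff_mem]
    simp only [LinearMap.mem_ker, LinearMap.toSpanSingleton_apply]
    rw [← map_smul, hz]
    exact (hQ.exact _).2 ⟨1, rfl⟩
  let φ : Co A (A ⧸ I) Q := Submodule.liftQ I _ h0
  have hφ1 : φ 1 = (LinearMap.range ι).mkQ z := by
    change (LinearMap.toSpanSingleton A Q ((LinearMap.range ι).mkQ z)) 1 = _
    simp
  have hsm : ∀ a : A, (Ideal.Quotient.mk I a • φ) 1 = (LinearMap.range ι).mkQ (a • z) := fun a => by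
    rw [Co.smul_apply, mul_one, map_smul, ← hφ1]
    have : Ideal.Quotient.mk I a = a • (1 : A ⧸ I) := by
      rw [Algebra.smul_def, mul_one]; rfl
    rw [this, Co.map_smulA]
  have hqe : ∀ {φ ψ : Co A (A ⧸ I) Q}, φ 1 = ψ 1 → φ = ψ := fun {φ ψ} h => Co.ext fun s => by
    obtain ⟨s, rfl⟩ := Ideal.Quotient.mk_surjective s
    have : Ideal.Quotient.mk I s = s • (1 : A ⧸ I) := by
      rw [Algebra.smul_def, mul_one]; rfl
    rw [this, Co.map_smulA, Co.map_smulA, h]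
  have e : (A ⧸ I) ≃ₗ[A ⧸ I] Co A (A ⧸ I) Q := by
    refine LinearEquiv.ofBijective (LinearMap.toSpanSingleton (A ⧸ I) _ φ) ⟨?_, ?_⟩
    · rw [injective_iff_map_eq_zero]
      intro r hr
      obtain ⟨a, rfl⟩ := Ideal.Quotient.mk_surjective r
      rw [LinearMap.toSpanSingleton_apply] at hr
      have h1 := hsm a
      rw [hr, Co.zero_apply] at h1
      obtain ⟨b, hb⟩ := (hQ.exact _).1 h1.symm
      have : ι a = ι (x * b) := by
        rw [← smul_eq_mul, map_smul, hb, smul_comm, hz, hιa]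
      rw [hess.1 this, Ideal.Quotient.eq_zero_iff_mem]
      exact I.mul_mem_right _ (Ideal.mem_span_singleton_self x)
    · intro ψ
      obtain ⟨y, hy⟩ := hQ.surj (ψ 1)
      have h1 : (LinearMap.range ι).mkQ (x • y) = 0 := by
        rw [map_smul, hy, ← Co.map_smulA]
        have : x • (1 : A ⧸ I) = 0 := by
          rw [Algebra.smul_def, mul_one]
          exact Ideal.Quotient.eq_zero_iff_mem.2 (Ideal.mem_span_singleton_self x)
        rw [this, Co.map_zero]
      obtain ⟨a, ha⟩ := (hQ.exact _).1 h1
      have : y = a • z := by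
        rw [← sub_eq_zero]
        apply hxi
        rw [smul_sub, ← ha, smul_comm, hz, ← hιa, sub_self]
      refine ⟨Ideal.Quotient.mk I a, hqe ?_⟩
      rw [LinearMap.toSpanSingleton_apply, hsm, ← this, hy]
  have hpd : ∀ (Y : Type u) [AddCommGroup Y] [Module A Y] i, van A (A ⧸ I) Y (i+2) := by
    intro Y _ _ i
    have hI : SES A (LinearMap.toSpanSingleton A A x) (Submodule.mkQ I) := by
      refine ⟨(injective_iff_map_eq_zero _).2 fun a ha => hx a ?_, fun y => ?_, Submodule.mkQ_surjective _⟩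
      · rw [LinearMap.toSpanSingleton_apply, smul_eq_mul, mul_comm] at ha; exact ha
      · rw [Submodule.mkQ_apply, Submodule.Quotient.mk_eq_zero, Ideal.mem_span_singleton']
        rfl
    exact hI.contra_right van_proj van_proj
  obtain ⟨n, hn⟩ := hF
  refine ⟨n, fun X i hi => van_congr_right e ?_⟩
  letI : Module A X := Module.compHom X (Ideal.Quotient.mk I)
  haveI : IsScalarTower A (A ⧸ I) X := ⟨fun a r y => by
    rw [Algebra.smul_def, mul_smul]; rfl⟩
  refine Co.van (fun j => hQ.co_right (van_inj hJ) (hpd A j)) i ?_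
  obtain ⟨i, rfl⟩ : ∃ k, i = k + 1 := ⟨i-1, by omega⟩
  exact hQ.co_right (van_inj hJ) (hn (ModuleCat.of A X) _ (by omega))

theorem zd_prime [IsNoetherianRing A] (I : Ideal A) (h : ∀ x ∈ I, ∃ a, a ≠ 0 ∧ x * a = 0) :
    ∃ p : PrimeSpectrum A, I ≤ p.asIdeal ∧ AP p.asIdeal A := by
  have hsub : (I : Set A) ⊆ ⋃ p ∈ associatedPrimes A A, (p : Set A) := by
    intro x hx
    rw [biUnion_associatedPrimes_eq_compl_regular]
    obtain ⟨a, ha, hxa⟩ := h x hx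
    intro hr
    change IsSMulRegular A x at hr
    exact ha (by rw [isSMulRegular_iff_right_eq_zero_of_smul] at hr; exact hr a hxa)
  obtain ⟨p, hp, hle⟩ := (Ideal.subset_union_prime_finite (associatedPrimes.finite A A) ⊥ ⊥
    (fun p hp _ _ => hp.isPrime)).1 hsub
  refine ⟨⟨p, hp.isPrime⟩, hle, ?_⟩
  have hpp := hp.isPrime
  obtain ⟨_, g, hg⟩ := (isAssociatedPrime_iff_exists_injective_linearMap p A).1 hp
  exact AP.of_map g hg

theorem dim_t [IsNoetherianRing A] [IsLocalRing A] {t : PrimeSpectrum A → ℕ}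
    (h : ∀ p, (t p : ℕ∞) = Order.height p) : ringKrullDim A = t (closedPoint A) := by
  have := IsLocalRing.maximalIdeal_height_eq_ringKrullDim (R := A)
  rw [← this]
  have h2 := PrimeSpectrum.height_eq_orderHeight (closedPoint A)
  rw [← h] at h2
  change (maximalIdeal A).height = _ at h2
  rw [h2]; rfl

theorem comap_closed {R : Type u} [CommRing R] [IsLocalRing A] [IsLocalRing R] (f : A →+* R) (hf : Function.Surjective f) :
    PrimeSpectrum.comap f (closedPoint R) = closedPoint A := by
  apply PrimeSpectrum.ext
  have : IsLocalHom f := IsLocalRing.surjective_units_map_of_local_ringHom f hf |> fun _ => hf.isLocalHom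
  exact IsLocalRing.maximalIdeal_comap f

theorem cut {R : Type u} [CommRing R] [IsLocalRing R] (d : ℕ) (hd : ringKrullDim R = d) :
    ∀ (n : ℕ) (A : Type u) [CommRing A] [IsLocalRing A] [IsNoetherianRing A] (_ : FID A A)
    (f : A →+* R) (_ : Function.Surjective f) (_ : ringKrullDim A = (d + n : ℕ)),
    ∃ (A' : CommRingCat.{u}) (_ : IsLocalRing A') (_ : IsNoetherianRing A') (g : A' →+* R), FID A' A' ∧
      Function.Surjective g ∧ ringKrullDim A' = d := by
  intro n
  induction n with
  | zero => intro A _ _ _ hF f hf hA; exact ⟨CommRingCat.of A, ‹_›, ‹_›, f, hF, hf, hA⟩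
  | succ n ih =>
    intro A _ _ _ hF f hf hA
    by_cases hex : ∃ x ∈ RingHom.ker f, ∀ a : A, x * a = 0 → a = 0
    · obtain ⟨x, hxk, hx⟩ := hex
      have hxm : x ∈ maximalIdeal A := by
        rw [mem_maximalIdeal, mem_nonunits_iff]
        intro hu
        exact not_isUnit_zero (M₀ := R) (by rw [← (RingHom.mem_ker).1 hxk]; exact hu.map f)
      have : Nontrivial (A ⧸ Ideal.span {x}) := Ideal.Quotient.nontrivial_iff.2 fun h => by
        rw [Ideal.span_singleton_eq_top] at h
        exact hxm h
      have : IsLocalRing (A ⧸ Ideal.span {x}) :=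
        IsLocalRing.of_surjective' (Ideal.Quotient.mk _) Ideal.Quotient.mk_surjective
      have hle : Ideal.span {x} ≤ RingHom.ker f := (Ideal.span_singleton_le_iff_mem _).2 hxk
      refine ih (A ⧸ Ideal.span {x}) (hF.quot x hx) (Ideal.Quotient.lift _ f fun a ha => hle ha) ?_ ?_
      · intro r
        obtain ⟨a, rfl⟩ := hf r
        exact ⟨Ideal.Quotient.mk _ a, rfl⟩
      · have h1 := ringKrullDim_quotient_span_singleton_succ_eq_ringKrullDim (R := A) (x := x)
          (isSMulRegular_iff_right_eq_zero_of_smul.2 hx) hxm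
        rw [hA] at h1
        obtain ⟨e, he, he'⟩ := wb_add (t := 1) (d := d + (n+1)) (by exact_mod_cast h1)
        rw [he, show e = d + n by omega]
    · exfalso
      push Not at hex
      obtain ⟨p, hpI, hap⟩ := zd_prime (RingHom.ker f) fun x hx => by
        obtain ⟨a, ha, hne⟩ := hex x hx; exact ⟨a, hne, ha⟩
      obtain ⟨Z, J, ι, π, hm, hZ⟩ := exists_minres A A
      have e : A ≃ₗ[A] Z 0 := by rw [hZ]
      obtain ⟨t, h1, h2, h3, h4⟩ := exists_t hm e hF
      have ht0 : 0 = t p := (h1 p 0).1 (hap.of_inj e.toLinearMap e.injective)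
      obtain ⟨p', rfl⟩ := exists_comap f hf p hpI
      have h5 := ord_coheight (h := fun q => t (PrimeSpectrum.comap f q)) (h2.comp (comap_strict f hf))
        (fun p q hpq => h3 _ _ (comap_cov f hf hpq)) (closedPoint R) (fun p => IsLocalRing.le_maximalIdeal_of_isPrime _)
        _ p' (Nat.le_add_left _ _)
      rw [comap_closed f hf, ← ht0] at h5
      have h6 := dim_t h4
      rw [hA] at h6
      have h7 : d + (n + 1) = t (closedPoint A) := by exact_mod_cast h6
      have h8 := Order.coheight_le_krullDim p'
      change _ ≤ ringKrullDim R at h8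
      rw [hd] at h8
      rw [← h7, Nat.cast_zero, zero_add] at h5
      have h9 : ((d + (n+1) : ℕ) : WithBot ℕ∞) ≤ (d : ℕ) := le_trans (by exact_mod_cast h5) h8
      have : d + (n + 1) ≤ d := by exact_mod_cast h9
      omega
end
end GGP

end PartPF4

section PartPF5
open CategoryTheory Abelian IsLocalRing TensorProduct RingTheory.Sequence
open scoped Pointwise
namespace GGP

theorem exists_gor {R : Type u} [CommRing R] [IsLocalRing R] [IsNoetherianRing R] (d : ℕ)
    (hd : ringKrullDim R = d) (hR : GG.HasDualizingComplex R) :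
    ∃ (A' : CommRingCat.{u}) (_ : IsLocalRing A') (_ : IsNoetherianRing A') (g : A' →+* R), FID A' A' ∧
      Function.Surjective g ∧ ringKrullDim A' = d := by
  obtain ⟨Q, hQ, hQd, hG, f, hf⟩ := hR
  let p : PrimeSpectrum Q := PrimeSpectrum.comap f (closedPoint R)
  obtain ⟨n, hn⟩ := hG p
  have hu : ∀ y : p.asIdeal.primeCompl, IsUnit (f y) := by
    intro y
    by_contra hc
    exact y.2 ((mem_maximalIdeal _).2 hc)
  let g : Localization.AtPrime p.asIdeal →+* R := IsLocalization.lift (M := p.asIdeal.primeCompl) hu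
  have hg : Function.Surjective g := by
    intro r
    obtain ⟨a, rfl⟩ := hf r
    exact ⟨algebraMap _ _ a, IsLocalization.lift_eq hu a⟩
  have hN : IsNoetherianRing (Localization.AtPrime p.asIdeal) :=
    IsLocalization.isNoetherianRing p.asIdeal.primeCompl _ hQ
  have h1 : ringKrullDim (Localization.AtPrime p.asIdeal) < ⊤ :=
    ringKrullDim_lt_top
  have h2 := ringKrullDim_le_of_surjective g hg
  rw [hd] at h2
  obtain ⟨e, he⟩ : ∃ e : ℕ, ringKrullDim (Localization.AtPrime p.asIdeal) = e := by
    generalize ringKrullDim (Localization.AtPrime p.asIdeal) = z at h1 h2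
    induction z with
    | bot => simp at h2
    | coe z =>
      induction z with
      | top => exact absurd h1 (lt_irrefl _)
      | coe z => exact ⟨z, rfl⟩
  rw [he] at h2
  have h3 : d ≤ e := by exact_mod_cast h2
  exact cut d hd (e - d) _ (FID.of_idLE hn) g hg (by rw [he]; congr; omega)
end GGP

end PartPF5

section PartPG
open CategoryTheory Abelian IsLocalRing TensorProduct RingTheory.Sequence
open scoped Pointwise
namespace GGP
section
variable {R : Type u} [CommRing R] [IsNoetherianRing R]

/-- depth bound for Ext vanishing -/
theorem van_depth [IsLocalRing R] {Y : Type u} [AddCommGroup Y] [Module R Y] [Module.Finite R Y] (d : ℕ)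
    (hY : ∀ (X : ModuleCat.{u} R) i, d < i → van R X Y i) (rs : List R) :
    ∀ (N : Type u) [AddCommGroup N] [Module R N] [Module.Finite R N],
    (∀ r ∈ rs, r ∈ maximalIdeal R) → IsWeaklyRegular N rs →
    ∀ i, d < i + rs.length → van R N Y i := by
  induction rs with
  | nil => intro N _ _ _ _ _ i hi; exact hY (ModuleCat.of R N) i (by simpa using hi)
  | cons x rs ih =>
    intro N _ _ _ hm hN i hi
    rw [isWeaklyRegular_cons_iff] at hN
    refine van_nak_left (hm x (by simp)) (ses_smul hN.1) ?_
    exact ih (QuotSMulTop x N) (fun r hr => hm r (by simp [hr])) hN.2 _ (by simp at hi; omega)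

variable {W : Type u} [AddCommGroup W] [Module R W]

/-- dualizing data -/
structure Om (R W : Type u) [CommRing R] [AddCommGroup W] [Module R W] (d : ℕ) : Prop where
  fin : Module.Finite R W
  id : ∀ (X : ModuleCat.{u} R) i, d < i → van R X W i
  self : ∀ i, van R W W (i+1)
  inj : ∀ r : R, (∀ w : W, r • w = 0) → r = 0
  surj : ∀ f : W →ₗ[R] W, ∃ r : R, ∀ w, f w = r • w

variable {d : ℕ}

theorem exists_pres (X : Type u) [AddCommGroup X] [Module R X] [Module.Finite R X] :
    ∃ (n : ℕ) (f : (Fin n → R) →ₗ[R] X), Function.Surjective f :=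
  Module.Finite.exists_fin' R X

omit [IsNoetherianRing R] in
theorem van_free_dual (h : Om R W d) (n : ℕ) (i : ℕ) : van R ((Fin n → R) →ₗ[R] W) W (i+1) := by
  have e : ((Fin n → R) →ₗ[R] W) ≃ₗ[R] (Fin n → W) :=
    ((LinearMap.lsum R (fun _ : Fin n => R) R).symm.trans
      (LinearEquiv.piCongrRight fun _ => LinearMap.ringLmapEquivSelf R R W))
  exact van_congr_left e (van_pi_left (h.self i) n)

theorem dual_van (h : Om R W d) : ∀ (n : ℕ) (X : Type u) [AddCommGroup X] [Module R X] [Module.Finite R X],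
    (∀ i, van R X W (i+1)) → ∀ i, d < i + 1 + n → van R (X →ₗ[R] W) W (i+1) := by
  intro n
  induction n with
  | zero => intro X _ _ _ _ i hi; exact h.id (ModuleCat.of R (X →ₗ[R] W)) (i+1) hi
  | succ n ih =>
    intro X _ _ _ hX i hi
    obtain ⟨m, f, hf⟩ := exists_pres (R := R) X
    have hs := SES.ofKer f hf
    exact (hs.homc (hs.extend (hX 0))).contra_left (van_free_dual h m i)
      (ih _ (fun i => hs.contra_left van_proj (hX _)) _ (by omega))

omit [IsNoetherianRing R] in
theorem free_bidual (h : Om R W d) (n : ℕ) (φ : ((Fin n → R) →ₗ[R] W) →ₗ[R] W) :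
    ∃ x, ∀ f, φ f = f x := by
  choose r hr using fun i => h.surj (φ ∘ₗ LinearMap.lcomp R W (LinearMap.proj i : (Fin n → R) →ₗ[R] R) ∘ₗ
    (LinearMap.ringLmapEquivSelf R R W).symm.toLinearMap)
  refine ⟨r, fun f => ?_⟩
  have hf : f = ∑ i, (LinearMap.lcomp R W (LinearMap.proj i : (Fin n → R) →ₗ[R] R) ∘ₗ
    (LinearMap.ringLmapEquivSelf R R W).symm.toLinearMap) (f (Pi.single i 1)) := by
    refine LinearMap.ext fun x => ?_
    conv_lhs => rw [← LinearMap.sum_single_apply (φ := fun _ : Fin n => R) x]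
    rw [map_sum, LinearMap.sum_apply]
    refine Finset.sum_congr rfl fun i _ => ?_
    simp only [LinearMap.comp_apply, LinearMap.lcomp_apply, LinearMap.proj_apply, LinearEquiv.coe_coe,
      LinearMap.ringLmapEquivSelf_symm_apply]
    simp only [LinearMap.smulRight_apply, Module.End.one_apply]
    rw [← map_smul, ← Pi.single_smul, smul_eq_mul, mul_one]
  conv_lhs => rw [hf]
  conv_rhs => rw [← LinearMap.sum_single_apply (φ := fun _ : Fin n => R) r]
  rw [map_sum, map_sum]
  refine Finset.sum_congr rfl fun i _ => ?_
  refine (hr i _).trans ?_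
  rw [← map_smul, ← Pi.single_smul, smul_eq_mul, mul_one]

omit [IsNoetherianRing R] in
theorem free_bidual_inj (h : Om R W d) (n : ℕ) (x : Fin n → R) (hx : ∀ f : (Fin n → R) →ₗ[R] W, f x = 0) : x = 0 := by
  funext i
  refine h.inj _ fun w => ?_
  exact hx ((LinearMap.toSpanSingleton R W w) ∘ₗ LinearMap.proj i)

theorem bidual_surj (h : Om R W d) (X : Type u) [AddCommGroup X] [Module R X] [Module.Finite R X]
    (hX : ∀ i, van R X W (i+1)) (φ : (X →ₗ[R] W) →ₗ[R] W) : ∃ x, ∀ f, φ f = f x := by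
  obtain ⟨m, f, hf⟩ := exists_pres (R := R) X
  have hs := SES.ofKer f hf
  have hs2 := hs.homc (hs.extend (hX 0))
  obtain ⟨φ', hφ'⟩ := hs2.extend (dual_van h d _ (fun i => hs.contra_left van_proj (hX _)) _ (by omega)) φ
  obtain ⟨x, hx⟩ := free_bidual h m φ'
  exact ⟨f x, fun g => by rw [← hφ', LinearMap.comp_apply, hx]; rfl⟩

theorem bidual_inj (h : Om R W d) (X : Type u) [AddCommGroup X] [Module R X] [Module.Finite R X]
    (hX : ∀ i, van R X W (i+1)) (x : X) (hx : ∀ f : X →ₗ[R] W, f x = 0) : x = 0 := by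
  obtain ⟨m, f, hf⟩ := exists_pres (R := R) X
  have hs := SES.ofKer f hf
  have hs2 := hs.homc (hs.extend (hX 0))
  obtain ⟨y, rfl⟩ := hf x
  -- evaluation at y kills the image of X', so factors through Hom(ker, W)
  have hY : ∀ i, van R (LinearMap.ker f) W (i+1) := fun i => hs.contra_left van_proj (hX _)
  let φ : (LinearMap.ker f →ₗ[R] W) →ₗ[R] W :=
    { toFun := fun g => (hs.extend (hX 0) g).choose y
      map_add' := fun a b => by
        have key : ∀ g : (Fin m → R) →ₗ[R] W, g ∘ₗ (LinearMap.ker f).subtype = 0 → g y = 0 := fun g hg => by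
          obtain ⟨g', rfl⟩ := (hs2.exact g).1 hg
          exact hx g'
        rw [← sub_eq_zero, ← LinearMap.add_apply, ← LinearMap.sub_apply]
        refine key _ ?_
        rw [LinearMap.sub_comp, LinearMap.add_comp, (hs.extend (hX 0) a).choose_spec,
          (hs.extend (hX 0) b).choose_spec, (hs.extend (hX 0) (a+b)).choose_spec, sub_self]
      map_smul' := fun r a => by
        have key : ∀ g : (Fin m → R) →ₗ[R] W, g ∘ₗ (LinearMap.ker f).subtype = 0 → g y = 0 := fun g hg => by
          obtain ⟨g', rfl⟩ := (hs2.exact g).1 hg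
          exact hx g'
        rw [← sub_eq_zero, RingHom.id_apply, ← LinearMap.smul_apply, ← LinearMap.sub_apply]
        refine key _ ?_
        rw [LinearMap.sub_comp, LinearMap.smul_comp, (hs.extend (hX 0) a).choose_spec,
          (hs.extend (hX 0) (r • a)).choose_spec, sub_self] }
  obtain ⟨z, hz⟩ := bidual_surj h _ hY φ
  have : y - z = 0 := by
    refine free_bidual_inj h m _ fun g => ?_
    rw [map_sub, sub_eq_zero]
    have h1 := hz (g ∘ₗ (LinearMap.ker f).subtype)
    have h2 : (hs.extend (hX 0) (g ∘ₗ (LinearMap.ker f).subtype)).choose y = g y := by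
      have := (hs.extend (hX 0) (g ∘ₗ (LinearMap.ker f).subtype)).choose_spec
      rw [← sub_eq_zero, ← LinearMap.sub_apply]
      obtain ⟨g', hg'⟩ := (hs2.exact ((hs.extend (hX 0) (g ∘ₗ (LinearMap.ker f).subtype)).choose - g)).1 (by
        rw [map_sub, sub_eq_zero]; exact this)
      rw [← hg']
      exact hx g'
    rw [← h2]; exact h1
  rw [sub_eq_zero.1 this]
  exact z.2

/-- biduality equivalence -/
theorem bidual_equiv (h : Om R W d) (X : Type u) [AddCommGroup X] [Module R X] [Module.Finite R X]
    (hX : ∀ i, van R X W (i+1)) : Function.Bijective (LinearMap.applyₗ : X →ₗ[R] (X →ₗ[R] W) →ₗ[R] W) := by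
  constructor
  · rw [← LinearMap.ker_eq_bot, LinearMap.ker_eq_bot']
    intro x hx
    exact bidual_inj h X hX x fun f => LinearMap.congr_fun hx f
  · intro φ
    obtain ⟨x, hx⟩ := bidual_surj h X hX φ
    exact ⟨x, LinearMap.ext fun f => (hx f).symm⟩
end
end GGP

end PartPG

section PartPG2
open CategoryTheory Abelian IsLocalRing TensorProduct RingTheory.Sequence
open scoped Pointwise
namespace GGP

/-- residual dualizing complex data -/
structure Dat (R : Type u) [CommRing R] [IsLocalRing R] (d : ℕ) (h : PrimeSpectrum R → ℕ)
    (W D : ℕ → ModuleCat.{u} R) (ι : ∀ j, W j →ₗ[R] D j) (π : ∀ j, D j →ₗ[R] W (j+1)) : Prop where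
  ses : ∀ j, SES R (ι j) (π j)
  inj : ∀ j, Module.Injective R (D j)
  om : Om R (W 0) d
  ap : ∀ (p : PrimeSpectrum R) n, AP p.asIdeal (D n) → n = h p
  zero : ∀ j, d < j → Subsingleton (W j)
  zeroD : ∀ j, d < j → Subsingleton (D j)
  mono : StrictMono h
  cov : ∀ p q, p ⋖ q → h q = h p + 1
  closed : h (closedPoint R) = d

theorem zero_of_not_ap {R : Type u} [CommRing R] [IsNoetherianRing R] {N : Type u} [AddCommGroup N] [Module R N]
    (h : ∀ p : PrimeSpectrum R, ¬ AP p.asIdeal N) : Subsingleton N := by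
  refine subsingleton_of_forall_eq 0 fun x => ?_
  by_contra hx
  obtain ⟨p, hp, hap, -⟩ := ap_of_ne (R := R) hx
  exact h ⟨p, hp⟩ hap

theorem exists_dat {R : Type u} [CommRing R] [IsLocalRing R] [IsNoetherianRing R] (d : ℕ)
    (hd : ringKrullDim R = d) (hR : GG.HasDualizingComplex R)
    (rs : List R) (hrs : ∀ r ∈ rs, r ∈ maximalIdeal R) (hreg : IsRegular R rs) (hlen : rs.length = d) :
    ∃ (h : PrimeSpectrum R → ℕ) (W D : ℕ → ModuleCat.{u} R) (ι : ∀ j, W j →ₗ[R] D j)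
      (π : ∀ j, D j →ₗ[R] W (j+1)), Dat R d h W D ι π := by
  obtain ⟨A', hAl, hAn, g, hF, hg, hAd⟩ := exists_gor d hd hR
  obtain ⟨A, hA, hAA⟩ : ∃ (A : Type u) (_ : CommRing A), CommRingCat.of A = A' := ⟨A', inferInstance, rfl⟩
  subst hAA
  change IsLocalRing A at hAl
  change IsNoetherianRing A at hAn
  change A →+* R at g
  change FID A A at hF
  change Function.Surjective g at hg
  change ringKrullDim A = d at hAd
  letI : Algebra A R := g.toAlgebra
  have hgs : Function.Surjective (algebraMap A R) := hg
  obtain ⟨Z, J, ι, π, hm, hZ⟩ := exists_minres A A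
  have e : A ≃ₗ[A] Z 0 := by rw [hZ]
  obtain ⟨t, h1, h2, h3, h4⟩ := exists_t hm e hF
  have htd : t (closedPoint A) = d := by
    have := dim_t h4
    rw [hAd] at this
    exact_mod_cast this.symm
  have hle : ∀ p, t p ≤ d := fun p => htd ▸ h2.monotone (IsLocalRing.le_maximalIdeal_of_isPrime _)
  have hz : ∀ j, d < j → Subsingleton (Z j) := fun j hj =>
    zero_of_not_ap fun p hp => by have := (h1 p j).1 hp; have := hle p; omega
  have hzJ : ∀ j, d < j → Subsingleton (J j) := fun j hj => by
    have := hz j hj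
    have := hz (j+1) (by omega)
    refine subsingleton_of_forall_eq 0 fun x => ?_
    obtain ⟨y, rfl⟩ := ((hm.ses j).exact x).1 (Subsingleton.elim _ _)
    rw [Subsingleton.elim y 0, map_zero]
  have hid : ∀ (X : ModuleCat.{u} A) i, d < i → van A X (Z 0) i := fun X i hi => by
    have := hz (d+1) (by omega)
    have := chain_up (X := X) hm.ses (fun n i => van_inj (hm.inj n)) (d+1) (i - (d+1)) van_subsingleton_right
    rwa [show d + 1 + (i - (d+1)) = i by omega] at this
  have hZf : Module.Finite A (Z 0) := Module.Finite.equiv e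
  have hRf : Module.Finite A R := Module.Finite.of_surjective (Algebra.linearMap A R) hgs
  -- lift the regular sequence
  obtain ⟨xs, hxs⟩ : ∃ xs : List A, xs.map (algebraMap A R) = rs := by
    exact (List.map_surjective_iff.2 hgs) rs
  have hloc : IsLocalHom (algebraMap A R) := hgs.isLocalHom
  have hxsm : ∀ x ∈ xs, x ∈ maximalIdeal A := fun x hx => by
    have : algebraMap A R x ∈ maximalIdeal R := hrs _ (by rw [← hxs]; exact List.mem_map_of_mem hx)
    exact fun hu => this (hu.map _)
  have hRv : ∀ i, van A R (Z 0) (i+1) := fun i =>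
    van_depth d hid xs R hxsm ((isWeaklyRegular_map_algebraMap_iff R R xs).1 (by rw [hxs]; exact hreg.1)) _ (by
      rw [← List.length_map (algebraMap A R), hxs, hlen]; omega)
  have hOm : Om A (Z 0) d :=
    { fin := hZf
      id := hid
      self := fun i => van_congr_left e.symm van_proj
      inj := fun r hr => by
        have := hr (e 1)
        rw [← map_smul, map_eq_zero_iff _ e.injective] at this
        simpa using this
      surj := fun f => ⟨e.symm (f (e 1)), fun w => by
        obtain ⟨a, rfl⟩ := e.surjective w
        apply e.symm.injective
        rw [map_smul, e.symm_apply_apply, show e a = a • e 1 by rw [← map_smul, smul_eq_mul, mul_one],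
          map_smul, map_smul, smul_eq_mul, smul_eq_mul, mul_comm]⟩ }
  have hbi := bidual_equiv hOm R hRv
  have hdv : ∀ i, van A (Co A R (Z 0)) (Z 0) (i+1) := fun i => dual_van hOm d R hRv i (by omega)
  have hev : ∀ n, Function.Injective (Co.ev1 : Co A R (J n) →ₗ[A] J n) := by
    intro n
    rw [← LinearMap.ker_eq_bot, LinearMap.ker_eq_bot']
    intro φ hφ
    apply Co.ext
    intro s
    obtain ⟨a, rfl⟩ := hgs s
    rw [Algebra.algebraMap_eq_smul_one, Co.map_smulA]
    rw [Co.ev1_apply] at hφ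
    rw [hφ, smul_zero]; rfl
  have hsub : ∀ N : ModuleCat.{u} A, Subsingleton N → Subsingleton (Co A R N) := fun N hN =>
    ⟨fun a b => Co.ext fun s => Subsingleton.elim _ _⟩
  refine ⟨fun p => t (PrimeSpectrum.comap (algebraMap A R) p), fun n => ModuleCat.of R (Co A R (Z n)),
    fun n => ModuleCat.of R (Co A R (J n)), fun n => Co.map (ι n), fun n => Co.map (π n), ?_⟩
  refine { ses := ?_, inj := fun j => Co.inj (hm.inj j), om := ?_, ap := ?_, zero := fun j hj => hsub _ (hz j hj),
           zeroD := fun j hj => hsub _ (hzJ j hj), mono := h2.comp (comap_strict _ hgs),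
           cov := fun p q hpq => h3 _ _ (comap_cov _ hgs hpq), closed := ?_ }
  · intro n
    exact Co.ses (hm.ses n) ((hm.ses n).lift (chain_down hm.ses (fun n i => van_inj (hm.inj n)) n 0 (hRv n)))
  · have hfA : Module.Finite A (Co A R (Z 0)) := by
      change Module.Finite A (R →ₗ[A] Z 0)
      infer_instance
    refine { fin := Module.Finite.of_restrictScalars_finite A R (Co A R (Z 0)), id := ?_, self := ?_, inj := ?_, surj := ?_ }
    · intro X i hi
      letI : Module A X := Module.compHom X (algebraMap A R)
      haveI : IsScalarTower A R X := ⟨fun a r x => by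
        rw [Algebra.smul_def, mul_smul]; rfl⟩
      exact Co.van hRv i (hid (ModuleCat.of A X) i hi)
    · intro i
      exact Co.van hRv (i+1) (hdv i)
    · intro r hr
      have : (LinearMap.applyₗ : R →ₗ[A] (R →ₗ[A] Z 0) →ₗ[A] Z 0) r = 0 := by
        refine LinearMap.ext fun φ => ?_
        have h6 : ∀ w : Co A R (Z 0), w r = 0 := fun w => by
          have h7 : r • w = 0 := hr w
          have h5 := congrArg Co.ev1 h7
          rwa [Co.ev1_apply, Co.smul_apply, mul_one, map_zero] at h5
        exact h6 φ
      exact hbi.1 (this.trans (map_zero _).symm)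
    · intro f
      obtain ⟨r, hr⟩ := hbi.2 (Co.ev1 ∘ₗ f.restrictScalars A)
      refine ⟨r, fun w => Co.ext1 fun s => ?_⟩
      rw [← map_smul, smul_smul, mul_comm, mul_smul]
      have := LinearMap.congr_fun hr (s • w)
      refine this.symm.trans ?_
      change (s • (w : Co A R (Z 0))) r = Co.ev1 (r • s • (w : Co A R (Z 0)))
      rw [Co.ev1_apply, Co.smul_apply r, mul_one]
  · intro p n hp
    obtain ⟨x, hx⟩ := hp
    refine (h1 _ _).1 (AP.of_ess (hm.ess n) ?_)
    refine AP.of_inj Co.ev1 (hev n) ⟨x, fun a => ?_⟩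
    rw [← algebraMap_smul R a x]
    exact hx _
  · rw [comap_closed _ hgs, htd]
end GGP

end PartPG2

section PartPH
open CategoryTheory Abelian IsLocalRing TensorProduct RingTheory.Sequence
open scoped Pointwise
namespace GGP
section
variable {R : Type u} [CommRing R]
variable {A B C : Type u} [AddCommGroup A] [Module R A] [AddCommGroup B] [Module R B]
    [AddCommGroup C] [Module R C] {f : A →ₗ[R] B} {g : B →ₗ[R] C}

theorem SES.van_char_left (h : SES R f g) {H : Type u} [AddCommGroup H] [Module R H]
    (hB : van R B (CharacterModule H) 1) (hi : Function.Injective (f.rTensor H)) :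
    van R C (CharacterModule H) 1 := by
  refine h.van1_of_extend hB ?_
  exact rTensor_injective_iff_lcomp_surjective.1 hi

variable {W : Type u} [AddCommGroup W] [Module R W] {d : ℕ}

theorem van_char_hom [IsNoetherianRing R] {I : Type u} [AddCommGroup I] [Module R I]
    (hI : Module.Injective R I) : ∀ (i : ℕ) (X : Type u) [AddCommGroup X] [Module R X]
    [Module.Finite R X], (∀ i, van R X W (i+1)) → van R X (CharacterModule (W →ₗ[R] I)) (i+1) := by
  intro i
  induction i with
  | zero =>
    intro X _ _ _ hX
    obtain ⟨m, f, hf⟩ := exists_pres (R := R) X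
    have hs := SES.ofKer f hf
    exact hs.van_char_left van_proj (hev_rTensor_inj hI _ (hs.extend (hX 0)))
  | succ i ih =>
    intro X _ _ _ hX
    obtain ⟨m, f, hf⟩ := exists_pres (R := R) X
    have hs := SES.ofKer f hf
    exact hs.contra_right (ih _ (fun i => hs.contra_left van_proj (hX _))) van_proj

theorem Om.bass_inj [IsNoetherianRing R] (h : Om R W d) {I : Type u} [AddCommGroup I] [Module R I]
    (hI : Module.Injective R I) : Bass R W I where
  ext i := van_inj hI
  tor i := by
    have := h.fin
    exact van_char_hom hI i W h.self
  bij := by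
    have := h.fin
    have key : ∀ x : W ⊗[R] (W →ₗ[R] I), ev W I x = hev W W I x LinearMap.id := by
      intro x
      induction x with
      | zero => simp
      | add x y hx hy => simp [hx, hy]
      | tmul x y => simp
    constructor
    · rw [injective_iff_map_eq_zero]
      intro x hx
      apply hev_inj hI
      refine LinearMap.ext fun θ => ?_
      obtain ⟨r, hr⟩ := h.surj θ
      have : θ = r • LinearMap.id := by ext w; simp [hr]
      rw [this, map_smul, ← key, hx]; simp
    · intro z
      let rr : R →ₗ[R] (W →ₗ[R] W) := LinearMap.toSpanSingleton R _ LinearMap.id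
      have hb : Function.Bijective rr := by
        constructor
        · rw [injective_iff_map_eq_zero]
          intro r hr
          refine h.inj r fun w => ?_
          simpa [rr] using LinearMap.congr_fun hr w
        · intro θ
          obtain ⟨r, hr⟩ := h.surj θ
          exact ⟨r, by ext w; simp [rr, hr]⟩
      let e := LinearEquiv.ofBijective rr hb
      obtain ⟨x, hx⟩ := hev_surj (R := R) (W := W) (U := W) hI
        (LinearMap.toSpanSingleton R I z ∘ₗ e.symm.toLinearMap)
      refine ⟨x, ?_⟩
      rw [key, hx]
      have : e.symm LinearMap.id = 1 := by
        rw [LinearEquiv.symm_apply_eq]; simp [e, rr]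
      simp [this]

theorem Bass.of_gi [IsNoetherianRing R] {h : PrimeSpectrum R → ℕ} [IsLocalRing R]
    {W D : ℕ → ModuleCat.{u} R} {ι : ∀ k, W k →ₗ[R] D k} {π : ∀ k, D k →ₗ[R] W (k+1)}
    (hD : Dat R d h W D ι π) (G : Type u) [AddCommGroup G] [Module R G] (hG : IsGI R G) :
    Bass R (W 0) G := by
  obtain ⟨Z, X, ιZ, πZ, hs, hX, hl, ⟨e⟩⟩ := hG
  have key : ∀ m n, d < n + m → ∀ i k, van R (W n) (Z k) (i+1) := by
    intro m
    induction m with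
    | zero =>
      intro n hn i k
      have := hD.zero n hn
      exact van_subsingleton_left
    | succ m ih =>
      intro n hn i k
      exact (hD.ses n).contra_left (gi_van_inj hs hX (D n) (fun k t => hl (D n) (hD.inj n) k t) i k)
        (ih (n+1) (by omega) _ _)
  refine Bass.congr e (Bass.chain Z X ιZ πZ hs (fun k => hD.om.bass_inj (hX k)) ?_ 0)
  intro k t
  exact (hs k).lift (key (d+1) 0 (by omega) 0 k) t

theorem zero_of_tensor [IsNoetherianRing R] (h : Om R W d) (E : Type u) [AddCommGroup E] [Module R E]
    (hE : Subsingleton (W ⊗[R] E)) : Subsingleton E := by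
  have := h.fin
  have h0 : ∀ f : W →ₗ[R] CharacterModule E, f = 0 := by
    intro f
    apply (CharacterModule.homEquiv (R := R) (A := W) (B := E)).injective
    rw [map_zero]
    apply AddMonoidHom.ext
    intro x
    rw [Subsingleton.elim x 0]; exact (map_zero _).trans (map_zero _).symm
  by_contra hne
  rw [not_subsingleton_iff_nontrivial] at hne
  obtain ⟨x, hx⟩ := exists_ne (0 : E)
  obtain ⟨c, hc⟩ := CharacterModule.exists_character_apply_ne_zero_of_ne_zero hx
  have hc0 : c ≠ 0 := by rintro rfl; exact hc rfl
  obtain ⟨p, hp, hap, -⟩ := ap_of_ne (R := R) (N := CharacterModule E) hc0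
  obtain ⟨j, hj⟩ := hap.map
  have hs : Subsingleton (W →ₗ[R] (R ⧸ p)) := by
    refine subsingleton_of_forall_eq 0 fun f => ?_
    refine LinearMap.ext fun w => hj ?_
    have := LinearMap.congr_fun (h0 (j ∘ₗ f)) w
    simpa using this
  rw [IsSMulRegular.subsingleton_linearMap_iff] at hs
  obtain ⟨r, hr, hreg⟩ := hs
  have : r = 0 := h.inj r (by simpa [Module.mem_annihilator] using hr)
  subst this
  have : (1 : R ⧸ p) = 0 := hreg (by simp)
  exact hp.ne_top ((Ideal.Quotient.eq_zero_iff_mem.1 this : (1:R) ∈ p) |> (Ideal.eq_top_iff_one p).2)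

theorem Bass.of_chain [IsNoetherianRing R] (h : Om R W d) (n : ℕ) :
    ∀ (B G : ℕ → ModuleCat.{u} R) (ι : ∀ k, B k →ₗ[R] G k) (π : ∀ k, G k →ₗ[R] B (k+1)),
    (∀ k, SES R (ι k) (π k)) → (∀ k, Bass R W (G k)) → (∀ k, n ≤ k → Subsingleton (B k)) →
    Bass R W (B 0) := by
  induction n with
  | zero =>
    intro B G ι π hs hG hB
    have := hB 0 le_rfl
    have hz : Subsingleton (W →ₗ[R] B 0) := by
      refine subsingleton_of_forall_eq 0 fun f => LinearMap.ext fun w => Subsingleton.elim _ _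
    have hz2 : Subsingleton (CharacterModule (W →ₗ[R] B 0)) := by
      refine subsingleton_of_forall_eq 0 fun f => AddMonoidHom.ext fun w => ?_
      rw [Subsingleton.elim w 0]; exact (map_zero _).trans (map_zero _).symm
    have hz3 : Subsingleton (W ⊗[R] (W →ₗ[R] B 0)) := by
      refine subsingleton_of_forall_eq 0 fun x => ?_
      induction x with
      | zero => rfl
      | add x y hx hy => simp [hx, hy]
      | tmul x y => rw [Subsingleton.elim y 0]; simp
    exact ⟨fun i => van_subsingleton_right, fun i => van_subsingleton_right,
      fun a b _ => Subsingleton.elim _ _, fun z => ⟨0, Subsingleton.elim _ _⟩⟩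
  | succ n ih =>
    intro B G ι π hs hG hB
    have hB1 : Bass R W (B 1) := ih (fun k => B (k+1)) (fun k => G (k+1)) (fun k => ι (k+1))
      (fun k => π (k+1)) (fun k => hs _) (fun k => hG _) (fun k hk => hB _ (by omega))
    refine Bass.kernel (hs 0) (hG 0) hB1 ?_
    let P : (W →ₗ[R] G 0) →ₗ[R] (W →ₗ[R] B 1) := LinearMap.compRight R (π 0)
    have hsurj : Function.Surjective (P.lTensor W) := by
      intro y
      obtain ⟨g, hg⟩ := (hs 0).surj (ev W (B 1) y)
      obtain ⟨x, rfl⟩ := (hG 0).bij.2 g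
      refine ⟨x, hB1.bij.1 ?_⟩
      rw [← hg]; exact ev_nat W (π 0) x
    have hE : Subsingleton (W ⊗[R] ((W →ₗ[R] B 1) ⧸ LinearMap.range P)) := by
      refine subsingleton_of_forall_eq 0 fun x => ?_
      obtain ⟨y, rfl⟩ := LinearMap.lTensor_surjective W (Submodule.mkQ_surjective (LinearMap.range P)) x
      obtain ⟨z, rfl⟩ := hsurj y
      rw [← LinearMap.comp_apply, ← LinearMap.lTensor_comp]
      have : (LinearMap.range P).mkQ ∘ₗ P = 0 := LinearMap.range_mkQ_comp P
      rw [this]; simp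
    have hE0 := zero_of_tensor h _ hE
    intro k
    have : (Submodule.Quotient.mk k : (W →ₗ[R] B 1) ⧸ LinearMap.range P) = 0 := Subsingleton.elim _ _
    rw [Submodule.Quotient.mk_eq_zero] at this
    exact this

end
end GGP

end PartPH

section PartPH2
open CategoryTheory Abelian IsLocalRing TensorProduct RingTheory.Sequence
open scoped Pointwise
namespace GGP
section
variable {R : Type u} [CommRing R] {W : Type u} [AddCommGroup W] [Module R W] {d : ℕ}

/-- scalars are the endomorphisms -/
theorem Om.exists_end (h : Om R W d) : ∃ e : (W →ₗ[R] W) ≃ₗ[R] R, ∀ f w, f w = e f • w := by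
  let rr : R →ₗ[R] (W →ₗ[R] W) := LinearMap.toSpanSingleton R _ LinearMap.id
  have hb : Function.Bijective rr := by
    constructor
    · rw [injective_iff_map_eq_zero]
      intro r hr
      refine h.inj r fun w => ?_
      simpa [rr] using LinearMap.congr_fun hr w
    · intro θ
      obtain ⟨r, hr⟩ := h.surj θ
      exact ⟨r, by ext w; simp [rr, hr]⟩
  refine ⟨(LinearEquiv.ofBijective rr hb).symm, fun f w => ?_⟩
  obtain ⟨r, rfl⟩ := hb.2 f
  have : (LinearEquiv.ofBijective rr hb).symm (rr r) = r := by
    rw [LinearEquiv.symm_apply_eq]; rfl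
  rw [this]; simp [rr]

theorem Om.smul_inj (h : Om R W d) {a b : R} (hab : ∀ w : W, a • w = b • w) : a = b := by
  rw [← sub_eq_zero]
  refine h.inj _ fun w => ?_
  rw [sub_smul, hab, sub_self]

theorem Om.van_R_tensor [IsNoetherianRing R] (h : Om R W d) : ∀ (i : ℕ) (X : Type u) [AddCommGroup X]
    [Module R X] [Module.Finite R X], (∀ i, van R W (CharacterModule X) (i+1)) →
    (∀ i, van R (W ⊗[R] X) W (i+1)) → van R X R (i+1) := by
  intro i
  induction i with
  | zero =>
    intro X _ _ _ h1 h2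
    obtain ⟨m, f, hf⟩ := exists_pres (R := R) X
    have hs := SES.ofKer f hf
    have hs2 : SES R ((LinearMap.ker f).subtype.lTensor W) (f.lTensor W) :=
      ⟨hs.lTensor_inj (h1 0), lTensor_exact W hs.exact hs.surj, LinearMap.lTensor_surjective W hs.surj⟩
    obtain ⟨e, he⟩ := h.exists_end
    refine hs.van1_of_extend van_proj fun k => ?_
    obtain ⟨κ, hκ⟩ := hs2.extend (h2 0) ((TensorProduct.rid R W).toLinearMap ∘ₗ k.lTensor W)
    refine ⟨e.toLinearMap ∘ₗ LinearMap.llcomp R W (W ⊗[R] (Fin m → R)) W κ ∘ₗ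
      (TensorProduct.mk R W (Fin m → R)).flip, LinearMap.ext fun u => ?_⟩
    refine h.smul_inj fun w => ?_
    have := LinearMap.congr_fun hκ (w ⊗ₜ u)
    simp only [LinearMap.comp_apply, LinearMap.lTensor_tmul, LinearEquiv.coe_coe, TensorProduct.rid_tmul] at this
    rw [← this]
    exact (he _ w).symm
  | succ i ih =>
    intro X _ _ _ h1 h2
    obtain ⟨m, f, hf⟩ := exists_pres (R := R) X
    have hs := SES.ofKer f hf
    have hs2 : SES R ((LinearMap.ker f).subtype.lTensor W) (f.lTensor W) :=
      ⟨hs.lTensor_inj (h1 0), lTensor_exact W hs.exact hs.surj, LinearMap.lTensor_surjective W hs.surj⟩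
    refine hs.contra_right (ih _ (fun i => hs.char.co_right flat_van_char (h1 _)) (fun i => ?_)) van_proj
    refine hs2.contra_left ?_ (h2 (i+1))
    exact van_congr_left (TensorProduct.piScalarRight R R W (Fin m)) (van_pi_left (h.self i) m)

theorem Om.van_R_hom [IsNoetherianRing R] (h : Om R W d) : ∀ (i : ℕ) (X : Type u) [AddCommGroup X]
    [Module R X] [Module.Finite R X], (∀ i, van R X W (i+1)) →
    (∀ i, van R W (X →ₗ[R] W) (i+1)) → van R X R (i+1) := by
  intro i
  induction i with
  | zero =>
    intro X _ _ _ h1 h2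
    obtain ⟨m, f, hf⟩ := exists_pres (R := R) X
    have hs := SES.ofKer f hf
    have hs2 := hs.homc (hs.extend (h1 0))
    obtain ⟨e, he⟩ := h.exists_end
    refine hs.van1_of_extend van_proj fun k => ?_
    obtain ⟨κ, hκ⟩ := hs2.lift (h2 0) ((LinearMap.lsmul R W ∘ₗ k).flip)
    refine ⟨e.toLinearMap ∘ₗ κ.flip, LinearMap.ext fun u => ?_⟩
    refine h.smul_inj fun w => ?_
    have := LinearMap.congr_fun (LinearMap.congr_fun hκ w) u
    exact (he _ w).symm.trans this
  | succ i ih =>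
    intro X _ _ _ h1 h2
    obtain ⟨m, f, hf⟩ := exists_pres (R := R) X
    have hs := SES.ofKer f hf
    have hs2 := hs.homc (hs.extend (h1 0))
    refine hs.contra_right (ih _ (fun i => hs.contra_left van_proj (h1 _)) (fun i => ?_)) van_proj
    refine hs2.co_right ?_ (h2 (i+1))
    have e : ((Fin m → R) →ₗ[R] W) ≃ₗ[R] (Fin m → W) :=
      ((LinearMap.lsum R (fun _ : Fin m => R) R).symm.trans
        (LinearEquiv.piCongrRight fun _ => LinearMap.ringLmapEquivSelf R R W))
    exact van_congr_right e (van_pi_right (h.self i) m)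

/-- perfect totally reflexive pairing -/
structure TP {X Y : Type u} [AddCommGroup X] [Module R X] [AddCommGroup Y] [Module R Y]
    (β : X →ₗ[R] Y →ₗ[R] R) : Prop where
  finX : Module.Finite R X
  finY : Module.Finite R Y
  bX : Function.Bijective β
  bY : Function.Bijective β.flip
  vX : ∀ i, van R X R (i+1)
  vY : ∀ i, van R Y R (i+1)

variable {X Y : Type u} [AddCommGroup X] [Module R X] [AddCommGroup Y] [Module R Y]
    {β : X →ₗ[R] Y →ₗ[R] R}

theorem TP.symm (h : TP β) : TP β.flip :=
  ⟨h.finY, h.finX, h.bY, h.bX, h.vY, h.vX⟩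

theorem Om.exists_TP [IsNoetherianRing R] (h : Om R W d) (M : Type u) [AddCommGroup M] [Module R M]
    [Module.Finite R M] (hM : ∀ i, van R M W (i+1)) (hB : Bass R W M) :
    ∃ β : (M →ₗ[R] W) →ₗ[R] (W →ₗ[R] M) →ₗ[R] R, TP β := by
  have := h.fin
  have fK : Module.Finite R (M →ₗ[R] W) := inferInstance
  have fN : Module.Finite R (W →ₗ[R] M) := inferInstance
  obtain ⟨e, he⟩ := h.exists_end
  let β : (M →ₗ[R] W) →ₗ[R] (W →ₗ[R] M) →ₗ[R] R := (LinearMap.llcomp R W M W).compr₂ e.toLinearMap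
  have hβ : ∀ k n w, β k n • w = k (n w) := fun k n w => (he _ w).symm
  have bd := bidual_equiv h M hM
  refine ⟨β, fK, fN, ⟨?_, ?_⟩, ⟨?_, ?_⟩, ?_, ?_⟩
  · rw [injective_iff_map_eq_zero]
    intro k hk
    ext m
    obtain ⟨x, rfl⟩ := hB.bij.2 m
    induction x with
    | zero => simp
    | add x y hx hy => simp only [map_add, hx, hy]
    | tmul w n => rw [ev_tmul, ← hβ, hk]; simp
  · intro φ
    let E := LinearEquiv.ofBijective _ hB.bij
    refine ⟨(TensorProduct.rid R W).toLinearMap ∘ₗ φ.lTensor W ∘ₗ E.symm.toLinearMap, ?_⟩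
    ext n
    refine h.smul_inj fun w => ?_
    rw [hβ]
    have : E.symm (n w) = w ⊗ₜ n := by rw [LinearEquiv.symm_apply_eq]; rfl
    simp [this]
  · rw [injective_iff_map_eq_zero]
    intro n hn
    ext w
    refine bidual_inj h M hM _ fun k => ?_
    rw [← hβ]
    have := LinearMap.congr_fun hn k
    rw [LinearMap.flip_apply] at this
    rw [this]; simp
  · intro φ
    let E := LinearEquiv.ofBijective _ bd
    refine ⟨E.symm.toLinearMap ∘ₗ (LinearMap.lsmul R W ∘ₗ φ).flip, ?_⟩
    ext k
    refine h.smul_inj fun w => ?_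
    rw [LinearMap.flip_apply, hβ]
    have := E.apply_symm_apply ((LinearMap.lsmul R W ∘ₗ φ).flip w)
    exact LinearMap.congr_fun this k
  · intro i
    refine h.van_R_hom i _ (fun i => dual_van h d M hM i (by omega)) (fun i => ?_)
    exact van_congr_right (LinearEquiv.ofBijective _ bd).symm (hB.ext i)
  · intro i
    refine h.van_R_tensor i _ hB.tor (fun i => ?_)
    exact van_congr_left (LinearEquiv.ofBijective _ hB.bij) (hM i)

theorem TP.syz [IsNoetherianRing R] (h : TP β) : ∃ (m : ℕ) (f : (Fin m → R) →ₗ[R] X),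
    SES R (LinearMap.ker f).subtype f ∧
    SES R (LinearMap.lcomp R R f ∘ₗ β.flip) (LinearMap.lcomp R R (LinearMap.ker f).subtype) ∧
    TP (LinearMap.applyₗ : LinearMap.ker f →ₗ[R] (LinearMap.ker f →ₗ[R] R) →ₗ[R] R) := by
  have := h.finX
  have := h.finY
  obtain ⟨m, f, hf⟩ := exists_pres (R := R) X
  have hs := SES.ofKer f hf
  have hs1 := hs.homc (hs.extend (h.vX 0))
  have hs2 : SES R (LinearMap.lcomp R R f ∘ₗ β.flip) (LinearMap.lcomp R R (LinearMap.ker f).subtype) := by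
    refine ⟨hs1.inj.comp h.bY.1, ?_, hs1.surj⟩
    intro y
    rw [hs1.exact y]
    constructor
    · rintro ⟨a, rfl⟩
      obtain ⟨b, rfl⟩ := h.bY.2 a
      exact ⟨b, rfl⟩
    · rintro ⟨a, rfl⟩
      exact ⟨_, rfl⟩
  refine ⟨m, f, hs, hs2, inferInstance, inferInstance, ⟨?_, ?_⟩, ?_, ?_, ?_⟩
  · rw [injective_iff_map_eq_zero]
    intro u hu
    ext i
    exact LinearMap.congr_fun hu (LinearMap.proj i ∘ₗ (LinearMap.ker f).subtype)
  · intro φ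
    let x : Fin m → R := fun i => φ (LinearMap.proj i ∘ₗ (LinearMap.ker f).subtype)
    have hx : ∀ ψ : (Fin m → R) →ₗ[R] R, φ (ψ ∘ₗ (LinearMap.ker f).subtype) = ψ x := by
      intro ψ
      have hψ : ψ = ∑ i, ψ (Pi.single i 1) • (LinearMap.proj i : (Fin m → R) →ₗ[R] R) := by
        refine LinearMap.pi_ext' fun i => LinearMap.ext_ring ?_
        simp [Pi.single_apply]
      conv_lhs => rw [hψ]
      conv_rhs => rw [hψ]
      have : (∑ i, ψ (Pi.single i 1) • (LinearMap.proj i : (Fin m → R) →ₗ[R] R)) ∘ₗ (LinearMap.ker f).subtype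
         = ∑ i, ψ (Pi.single i 1) • ((LinearMap.proj i : (Fin m → R) →ₗ[R] R) ∘ₗ (LinearMap.ker f).subtype) := by
        ext; simp
      rw [this, map_sum]
      simp [x]
    have hfx : f x = 0 := by
      apply h.bX.1
      rw [map_zero]
      ext y
      have := hx (β.flip y ∘ₗ f)
      refine this.symm.trans ?_
      have h0 : (β.flip y ∘ₗ f) ∘ₗ (LinearMap.ker f).subtype = 0 := by
        ext u; simp
      rw [h0]; simp
    refine ⟨⟨x, hfx⟩, LinearMap.ext fun v => ?_⟩
    obtain ⟨ψ, rfl⟩ := hs2.surj v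
    exact (hx ψ).symm
  · exact Function.bijective_id
  · exact fun i => hs.contra_left van_proj (h.vX _)
  · intro i
    cases i with
    | succ i => exact hs2.contra_right (h.vY i) van_proj
    | zero =>
      refine hs2.van1_of_extend van_proj fun k => ?_
      obtain ⟨a, rfl⟩ := h.bX.2 k
      obtain ⟨z, rfl⟩ := hf a
      exact ⟨LinearMap.applyₗ z, rfl⟩

end
end GGP

end PartPH2

section PartPH3
open CategoryTheory Abelian IsLocalRing TensorProduct RingTheory.Sequence
open scoped Pointwise
namespace GGP
section
variable {R : Type u} [CommRing R]

theorem isGI_of_step (P : ModuleCat.{u} R → Prop)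
    (hr : ∀ G, P G → ∃ (X G' : ModuleCat.{u} R) (ι : G →ₗ[R] X) (π : X →ₗ[R] G'), P G' ∧
      SES R ι π ∧ Module.Injective R X ∧ ∀ (I : ModuleCat.{u} R), Module.Injective R I →
        ∀ t : I →ₗ[R] G', ∃ t' : I →ₗ[R] X, π ∘ₗ t' = t)
    (hl : ∀ G, P G → ∃ (X G' : ModuleCat.{u} R) (ι : G' →ₗ[R] X) (π : X →ₗ[R] G), P G' ∧
      SES R ι π ∧ Module.Injective R X ∧ ∀ (I : ModuleCat.{u} R), Module.Injective R I →
        ∀ t : I →ₗ[R] G, ∃ t' : I →ₗ[R] X, π ∘ₗ t' = t)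
    (G : ModuleCat.{u} R) (hG : P G) : IsGI R G := by
  have hr' : ∀ G : {G // P G}, ∃ G' : {G // P G}, ∃ (X : ModuleCat.{u} R) (ι : G.1 →ₗ[R] X) (π : X →ₗ[R] G'.1),
      SES R ι π ∧ Module.Injective R X ∧ ∀ (I : ModuleCat.{u} R), Module.Injective R I →
        ∀ t : I →ₗ[R] G'.1, ∃ t' : I →ₗ[R] X, π ∘ₗ t' = t := by
    rintro ⟨G, hG⟩
    obtain ⟨X, G', ι, π, h1, h2⟩ := hr G hG
    exact ⟨⟨G', h1⟩, X, ι, π, h2⟩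
  have hl' : ∀ G : {G // P G}, ∃ G' : {G // P G}, ∃ (X : ModuleCat.{u} R) (ι : G'.1 →ₗ[R] X) (π : X →ₗ[R] G.1),
      SES R ι π ∧ Module.Injective R X ∧ ∀ (I : ModuleCat.{u} R), Module.Injective R I →
        ∀ t : I →ₗ[R] G.1, ∃ t' : I →ₗ[R] X, π ∘ₗ t' = t := by
    rintro ⟨G, hG⟩
    obtain ⟨X, G', ι, π, h1, h2⟩ := hl G hG
    exact ⟨⟨G', h1⟩, X, ι, π, h2⟩
  choose s hs using hr'
  choose l hll using hl'
  let r : ℕ → {G // P G} := fun n => Nat.rec ⟨G, hG⟩ (fun _ g => s g) n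
  let q : ℕ → {G // P G} := fun n => Nat.rec ⟨G, hG⟩ (fun _ g => l g) n
  let Z : ℤ → {G // P G} := fun k => match k with
    | Int.ofNat n => r n
    | Int.negSucc n => q (n+1)
  have key : ∀ k : ℤ, ∃ (X : ModuleCat.{u} R) (ι : (Z k).1 →ₗ[R] X) (π : X →ₗ[R] (Z (k+1)).1),
      SES R ι π ∧ Module.Injective R X ∧ ∀ (I : ModuleCat.{u} R), Module.Injective R I →
        ∀ t : I →ₗ[R] (Z (k+1)).1, ∃ t' : I →ₗ[R] X, π ∘ₗ t' = t := by
    intro k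
    match k with
    | Int.ofNat n => exact hs (r n)
    | Int.negSucc 0 => exact hll (q 0)
    | Int.negSucc (n+1) => exact hll (q (n+1))
  choose X ι π h1 h2 h3 using key
  exact ⟨fun k => (Z k).1, X, ι, π, h1, h2, fun I hI k t => h3 k I hI t, ⟨LinearEquiv.refl R G⟩⟩

variable {A B C J : Type u} [AddCommGroup A] [Module R A] [AddCommGroup B] [Module R B]
    [AddCommGroup C] [Module R C] [AddCommGroup J] [Module R J] {f : A →ₗ[R] B} {g : B →ₗ[R] C}

theorem SES.lift_hom [IsNoetherianRing R] [Module.Finite R A] (h : SES R f g) (hv : van R C R 1)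
    (hJ : Module.Injective R J) (I : Type u) [AddCommGroup I] [Module R I] (hI : Module.Injective R I)
    (t : I →ₗ[R] (A →ₗ[R] J)) : ∃ t' : I →ₗ[R] (B →ₗ[R] J), LinearMap.lcomp R J f ∘ₗ t' = t := by
  have hi := hev_rTensor_inj (W := R) hI f (h.extend hv)
  have hi2 : Function.Injective (f.rTensor I) := by
    rw [injective_iff_map_eq_zero]
    intro x hx
    let e := (LinearMap.ringLmapEquivSelf R R I).symm
    have : e.toLinearMap.lTensor A x = 0 := by
      apply hi
      rw [← LinearMap.comp_apply, LinearMap.rTensor_comp_lTensor, ← LinearMap.lTensor_comp_rTensor,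
        LinearMap.comp_apply, hx]; simp
    exact (LinearEquiv.lTensor A e).injective (this.trans (map_zero _).symm)
  obtain ⟨k, hk⟩ := inj_ext hJ _ hi2 (TensorProduct.lift t.flip)
  refine ⟨(TensorProduct.curry k).flip, ?_⟩
  refine LinearMap.ext fun x => LinearMap.ext fun a => ?_
  exact LinearMap.congr_fun hk (a ⊗ₜ x)

theorem inj_hom_free (hJ : Module.Injective R J) (F : Type u) [AddCommGroup F] [Module R F] [Module.Free R F] :
    Module.Injective R (F →ₗ[R] J) := by
  refine inj_congr ((Module.Free.chooseBasis R F).constr R (M' := J)).symm ?_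
  exact Module.Injective.pi R (fun _ : Module.Free.ChooseBasisIndex R F => J)

theorem SES.equiv_left (h : SES R f g) {A' : Type u} [AddCommGroup A'] [Module R A'] (e : A' ≃ₗ[R] A) :
    SES R (f ∘ₗ e.toLinearMap) g := by
  refine ⟨h.inj.comp e.injective, ?_, h.surj⟩
  intro y
  rw [h.exact y]
  constructor
  · rintro ⟨a, rfl⟩
    exact ⟨e.symm a, by simp⟩
  · rintro ⟨a, rfl⟩
    exact ⟨_, rfl⟩

theorem SES.equiv_right (h : SES R f g) {C' : Type u} [AddCommGroup C'] [Module R C'] (e : C ≃ₗ[R] C') :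
    SES R f (e.toLinearMap ∘ₗ g) := by
  refine ⟨h.inj, ?_, e.surjective.comp h.surj⟩
  intro y
  rw [← h.exact y]
  simp

theorem TP.gi [IsNoetherianRing R] {X Y : Type u} [AddCommGroup X] [Module R X] [AddCommGroup Y] [Module R Y]
    {β : X →ₗ[R] Y →ₗ[R] R} (h : TP β) (hJ : Module.Injective R J) : IsGI R (X →ₗ[R] J) := by
  refine isGI_of_step (fun G => ∃ (X Y : ModuleCat.{u} R) (β : X →ₗ[R] Y →ₗ[R] R), TP β ∧
    Nonempty (G ≃ₗ[R] (X →ₗ[R] J))) ?_ ?_ (ModuleCat.of R (X →ₗ[R] J))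
    ⟨ModuleCat.of R X, ModuleCat.of R Y, β, h, ⟨LinearEquiv.refl R _⟩⟩
  · rintro G ⟨X, Y, β, h, ⟨e⟩⟩
    obtain ⟨m, f, hs, hs2, ht⟩ := h.syz
    have := ht.finX
    refine ⟨ModuleCat.of R ((Fin m → R) →ₗ[R] J), ModuleCat.of R (LinearMap.ker f →ₗ[R] J),
      LinearMap.lcomp R J f ∘ₗ e.toLinearMap, LinearMap.lcomp R J (LinearMap.ker f).subtype,
      ⟨ModuleCat.of R (LinearMap.ker f), ModuleCat.of R (LinearMap.ker f →ₗ[R] R), _, ht, ⟨LinearEquiv.refl R _⟩⟩, ?_, ?_, ?_⟩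
    · exact (hs.homc (fun k => inj_ext hJ _ hs.inj k)).equiv_left e
    · exact inj_hom_free hJ _
    · intro I hI t
      exact hs.lift_hom (h.vX 0) hJ I hI t
  · rintro G ⟨X, Y, β, h, ⟨e⟩⟩
    obtain ⟨m, f, hs, hs2, ht⟩ := h.symm.syz
    have := ht.finY
    have := h.finX
    have h3 := (hs2.homc (fun k => inj_ext hJ _ hs2.inj k)).equiv_right e.symm
    refine ⟨ModuleCat.of R (((Fin m → R) →ₗ[R] R) →ₗ[R] J), ModuleCat.of R ((LinearMap.ker f →ₗ[R] R) →ₗ[R] J),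
      _, _,
      ⟨ModuleCat.of R (LinearMap.ker f →ₗ[R] R), ModuleCat.of R (LinearMap.ker f), _, ht.symm, ⟨LinearEquiv.refl R _⟩⟩, h3, ?_, ?_⟩
    · exact inj_hom_free hJ _
    · intro I hI t
      obtain ⟨t', ht'⟩ := hs2.lift_hom (ht.vY 0) hJ I hI (e.toLinearMap ∘ₗ t)
      refine ⟨t', ?_⟩
      refine LinearMap.ext fun x => ?_
      have := LinearMap.congr_fun ht' x
      exact (LinearEquiv.symm_apply_eq _).2 this

end
end GGP

end PartPH3

section PartPI
open CategoryTheory Abelian IsLocalRing TensorProduct RingTheory.Sequence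
open scoped Pointwise
namespace GGP
section
variable {R : Type u} [CommRing R]
variable {N : Type u} [AddCommGroup N] [Module R N]

/-- vanishing of `x` at `p` -/
def van0 (p : PrimeSpectrum R) (x : N) : Prop := ∃ u ∉ p.asIdeal, u • x = 0

theorem ap_of_minimal [IsNoetherianRing R] {x : N} {q : Ideal R}
    (hq : q ∈ Ideal.minimalPrimes (LinearMap.ker (LinearMap.toSpanSingleton R N x) : Ideal R)) : AP q N := by
  have h1 : Module.annihilator R (Submodule.span R {x}) = LinearMap.ker (LinearMap.toSpanSingleton R N x) :=
    Submodule.annihilator_span_singleton x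
  rw [← h1] at hq
  have h2 := Module.associatedPrimes.minimalPrimes_annihilator_subset_associatedPrimes R _ hq
  obtain ⟨-, f, hf⟩ := (isAssociatedPrime_iff_exists_injective_linearMap q _).1 h2
  exact AP.of_inj (Submodule.subtype _) (Submodule.subtype_injective _) (AP.of_map f hf)

theorem exists_min_of_not_van0 [IsNoetherianRing R] {x : N} {p : PrimeSpectrum R} (hx : ¬ van0 p x) :
    ∃ q : PrimeSpectrum R, q ≤ p ∧ AP q.asIdeal N ∧
      q.asIdeal ∈ Ideal.minimalPrimes (LinearMap.ker (LinearMap.toSpanSingleton R N x) : Ideal R) := by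
  have hle : LinearMap.ker (LinearMap.toSpanSingleton R N x) ≤ p.asIdeal := by
    intro r hr
    by_contra hrp
    exact hx ⟨r, hrp, by simpa using hr⟩
  obtain ⟨q, hq, hqp⟩ := Ideal.exists_minimalPrimes_le hle
  exact ⟨⟨q, hq.1.1⟩, hqp, ap_of_minimal hq, hq⟩

theorem min_pow {I q : Ideal R} (hq : q ∈ I.minimalPrimes) {x : R} (hx : x ∈ q) :
    ∃ n, ∃ y ∉ q, y * x ^ n ∈ I := by
  have hp : q.IsPrime := hq.1.1
  by_contra hc
  push Not at hc
  obtain ⟨p, hpp, hIp, hd⟩ := Ideal.exists_le_prime_disjoint I (q.primeCompl ⊔ Submonoid.powers x) (by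
    rw [Set.disjoint_left]
    rintro z hz hz2
    obtain ⟨y, hy, w, ⟨n, rfl⟩, rfl⟩ := Submonoid.mem_sup.1 hz2
    exact hc n y hy hz)
  rw [Set.disjoint_left] at hd
  have hle : p ≤ q := by
    intro r hr
    by_contra hrq
    exact hd hr (Submonoid.mem_sup_left (S := q.primeCompl) hrq)
  exact hd (hq.2 ⟨hpp, hIp⟩ hle hx) (Submonoid.mem_sup_right (Submonoid.mem_powers x))

variable {S : Set (PrimeSpectrum R)}

theorem theta_good [IsNoetherianRing R] (h1 : ∀ p : PrimeSpectrum R, AP p.asIdeal N → p ∈ S)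
    (h2 : ∀ p ∈ S, ∀ q ∈ S, p ≤ q → p = q)
    (h3 : ∀ (x : N), ∀ p ∈ S, (∀ q ∈ S, q ≠ p → van0 q x) → ∀ t ∉ p.asIdeal,
      ∃ y : N, t • y = x ∧ ∀ q ∈ S, q ≠ p → van0 q y) :
    Function.Injective (GG.thetaFull R S N) ∧ LinearMap.range (GG.thetaFull R S N) = GG.finSupp R S N := by
  have hth : ∀ x (p : S), GG.thetaFull R S N x p = LocalizedModule.mk x 1 := fun x p => rfl
  have hz : ∀ x (p : S), GG.thetaFull R S N x p = 0 ↔ van0 p.1 x := fun x p => by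
    rw [hth, lm_zero]; rfl
  have hmin : ∀ (x : N) p, p ∈ S → ¬ van0 p x →
      p.asIdeal ∈ Ideal.minimalPrimes (LinearMap.ker (LinearMap.toSpanSingleton R N x) : Ideal R) := by
    intro x p hp hx
    obtain ⟨q, hqp, hap, hm⟩ := exists_min_of_not_van0 hx
    rwa [← h2 q (h1 q hap) p hp hqp]
  have hfin : ∀ x : N, {p : PrimeSpectrum R | p ∈ S ∧ ¬ van0 p x}.Finite := by
    intro x
    refine Set.Finite.of_finite_image (f := PrimeSpectrum.asIdeal) ?_ (fun a _ b _ hab => PrimeSpectrum.ext hab)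
    refine (Ideal.finite_minimalPrimes_of_isNoetherianRing R
      (LinearMap.ker (LinearMap.toSpanSingleton R N x))).subset ?_
    rintro _ ⟨p, ⟨hp, hx⟩, rfl⟩
    exact hmin x p hp hx
  refine ⟨?_, le_antisymm ?_ ?_⟩
  · rw [injective_iff_map_eq_zero]
    intro x hx
    by_contra hne
    obtain ⟨p, hp, hap, s, hs⟩ := ap_of_ne (R := R) hne
    obtain ⟨u, hu, hux⟩ := (hz x ⟨⟨p, hp⟩, h1 ⟨p, hp⟩ hap⟩).1 (by rw [hx]; rfl)
    refine hu ((hs u).1 ?_)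
    rw [smul_comm, hux, smul_zero]
  · rintro _ ⟨x, rfl⟩
    change {p : S | _}.Finite
    refine Set.Finite.of_finite_image (f := Subtype.val) ?_ (Subtype.val_injective.injOn)
    refine (hfin x).subset ?_
    rintro _ ⟨p, hp, rfl⟩
    exact ⟨p.2, fun h => hp ((hz x p).2 h)⟩
  · intro f hf
    classical
    have key : ∀ (p : S) (c : LocalizedModule p.1.asIdeal.primeCompl N),
        (Pi.single p c : GG.locProd R S N) ∈ LinearMap.range (GG.thetaFull R S N) := by
      intro p c
      induction c using LocalizedModule.induction_on with
      | _ b s =>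
      have ha : ∀ q ∈ (hfin b).toFinset, ∃ a : R, a ∉ p.1.asIdeal ∧ (q ≠ p.1 → van0 q (a • b)) := by
        intro q hq
        rw [Set.Finite.mem_toFinset] at hq
        by_cases hqp : q = p.1
        · exact ⟨1, fun h => p.1.2.ne_top ((Ideal.eq_top_iff_one _).2 h), fun h => (h hqp).elim⟩
        · obtain ⟨x, hxq, hxp⟩ := Set.not_subset.1 (fun hle => hqp (h2 q hq.1 p.1 p.2 hle))
          obtain ⟨n, y, hy, hyx⟩ := min_pow (hmin b q hq.1 hq.2) hxq
          refine ⟨x ^ n, fun h => hxp (p.1.2.mem_of_pow_mem n h), fun _ => ⟨y, hy, ?_⟩⟩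
          rw [smul_smul]; simpa using hyx
      choose! a ha1 ha2 using ha
      let A := ∏ q ∈ (hfin b).toFinset, a q
      have hA : A ∉ p.1.asIdeal := by
        intro h
        obtain ⟨q, hq, hq2⟩ := (p.1.2.prod_mem_iff).1 h
        exact ha1 q hq hq2
      have hAv : ∀ q ∈ S, q ≠ p.1 → van0 q (A • b) := by
        intro q hq hqp
        by_cases hv : van0 q b
        · obtain ⟨u, hu, hub⟩ := hv
          exact ⟨u, hu, by rw [smul_comm, hub, smul_zero]⟩
        · have hm : q ∈ (hfin b).toFinset := by rw [Set.Finite.mem_toFinset]; exact ⟨hq, hv⟩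
          obtain ⟨u, hu, hub⟩ := ha2 q hm hqp
          refine ⟨u, hu, ?_⟩
          change u • (∏ q ∈ (hfin b).toFinset, a q) • b = 0
          rw [← Finset.prod_erase_mul _ _ hm, mul_smul, smul_comm, hub, smul_zero]
      obtain ⟨y, hy, hyv⟩ := h3 (A • b) p.1 p.2 hAv (A * s.1) (fun h => by
        rcases p.1.2.mem_or_mem h with h | h
        · exact hA h
        · exact s.2 h)
      refine ⟨y, funext fun q => ?_⟩
      by_cases hqp : q = p
      · subst hqp
        rw [Pi.single_eq_same, hth, LocalizedModule.mk_eq]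
        refine ⟨⟨A, hA⟩, ?_⟩
        rw [one_smul]
        change A • s.1 • y = A • b
        rw [smul_smul, hy]
      · rw [Pi.single_eq_of_ne hqp, hz]
        exact hyv q.1 q.2 (fun h => hqp (Subtype.ext h))
    have hf' : {p : S | f p ≠ 0}.Finite := hf
    have : f = ∑ p ∈ hf'.toFinset, Pi.single p (f p) := by
      funext q
      rw [Finset.sum_apply]
      by_cases hq : f q = 0
      · rw [hq, Finset.sum_eq_zero]
        intro p hp
        by_cases hpq : q = p
        · subst hpq; rw [Pi.single_eq_same, hq]
        · rw [Pi.single_eq_of_ne hpq]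
      · rw [Finset.sum_eq_single_of_mem q (by rw [Set.Finite.mem_toFinset]; exact hq), Pi.single_eq_same]
        intro p _ hpq
        rw [Pi.single_eq_of_ne hpq.symm]
    rw [this]
    exact Submodule.sum_mem _ fun p _ => key p _

variable {A B C : Type u} [AddCommGroup A] [Module R A] [AddCommGroup B] [Module R B]
    [AddCommGroup C] [Module R C] {f : A →ₗ[R] B} {g : B →ₗ[R] C}

theorem SES.cousin (h : SES R f g) (hi : Function.Injective (GG.thetaFull R S B))
    (hr : LinearMap.range (GG.thetaFull R S B) = GG.finSupp R S B)
    (hC : ∀ p ∈ S, ∀ c : C, van0 p c) :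
    Function.Injective (GG.thetaFull R S A) ∧ LinearMap.range (GG.thetaFull R S A) ≤ GG.finSupp R S A ∧
    Nonempty (GG.finSupp R S A ≃ₗ[R] B) ∧ Nonempty (GG.nextKType R S A ≃ₗ[R] C) := by
  let φ : ∀ p : S, LocalizedModule p.1.asIdeal.primeCompl A →ₗ[R] LocalizedModule p.1.asIdeal.primeCompl B :=
    fun p => (LocalizedModule.map p.1.asIdeal.primeCompl f).restrictScalars R
  have hφm : ∀ p a s, φ p (LocalizedModule.mk a s) = LocalizedModule.mk (f a) s := fun p a s =>
    LocalizedModule.map_mk _ _ _ _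
  have hφi : ∀ p, Function.Injective (φ p) := fun p => LocalizedModule.map_injective _ f h.inj
  have hφs : ∀ p, Function.Surjective (φ p) := by
    intro p y
    refine (((h.loc p.1.asIdeal.primeCompl).exact y).1 ?_)
    induction y using LocalizedModule.induction_on with
    | _ b s =>
    rw [LocalizedModule.map_mk, lm_zero]
    exact hC p.1 p.2 (g b)
  let Φ : GG.locProd R S A ≃ₗ[R] GG.locProd R S B :=
    LinearEquiv.piCongrRight fun p => LinearEquiv.ofBijective (φ p) ⟨hφi p, hφs p⟩
  have hΦa : ∀ x p, Φ x p = φ p (x p) := fun _ _ => rfl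
  have hΦ : ∀ a, Φ (GG.thetaFull R S A a) = GG.thetaFull R S B (f a) := by
    intro a
    funext p
    rw [hΦa]; exact hφm p a 1
  have hfs : ∀ x, Φ x ∈ GG.finSupp R S B ↔ x ∈ GG.finSupp R S A := by
    intro x
    change {p : S | Φ x p ≠ 0}.Finite ↔ {p : S | x p ≠ 0}.Finite
    have : {p : S | Φ x p ≠ 0} = {p : S | x p ≠ 0} := by
      ext p
      simp only [Set.mem_setOf_eq, hΦa, ne_eq]
      rw [map_eq_zero_iff _ (hφi p)]
    rw [this]
  have hmem : ∀ a, GG.thetaFull R S A a ∈ GG.finSupp R S A := by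
    intro a
    rw [← hfs, hΦ, ← hr]; exact ⟨_, rfl⟩
  have hinj : Function.Injective (GG.thetaFull R S A) := by
    intro a b hab
    apply h.inj; apply hi
    rw [← hΦ, ← hΦ, hab]
  -- the map from B
  let ψ : B →ₗ[R] GG.finSupp R S A :=
    (Φ.symm.toLinearMap ∘ₗ GG.thetaFull R S B).codRestrict _ (fun b => by
      rw [← hfs]
      simp only [LinearMap.comp_apply, LinearEquiv.coe_coe, LinearEquiv.apply_symm_apply]
      rw [← hr]; exact ⟨_, rfl⟩)
  have hψv : ∀ b, Φ (ψ b).1 = GG.thetaFull R S B b := fun b => Φ.apply_symm_apply _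
  have hψ : Function.Bijective ψ := by
    constructor
    · intro a b hab
      apply hi
      rw [← hψv, ← hψv, hab]
    · intro x
      have hx : Φ x.1 ∈ LinearMap.range (GG.thetaFull R S B) := by rw [hr, hfs]; exact x.2
      obtain ⟨b, hb⟩ := hx
      refine ⟨b, Subtype.ext (Φ.injective ?_)⟩
      rw [hψv, hb]
  refine ⟨hinj, ?_, ⟨(LinearEquiv.ofBijective ψ hψ).symm⟩, ?_⟩
  · rintro _ ⟨a, rfl⟩; exact hmem a
  · let Q := Submodule.comap (GG.finSupp R S A).subtype (LinearMap.range (GG.thetaFull R S A))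
    have hker : LinearMap.ker (Q.mkQ ∘ₗ ψ) = LinearMap.ker g := by
      ext b
      simp only [LinearMap.mem_ker, LinearMap.comp_apply, Submodule.mkQ_apply, Submodule.Quotient.mk_eq_zero]
      rw [h.exact b]
      change (∃ a, GG.thetaFull R S A a = (ψ b).1) ↔ _
      constructor
      · rintro ⟨a, ha⟩
        refine ⟨a, hi ?_⟩
        rw [← hΦ, ha, hψv]
      · rintro ⟨a, rfl⟩
        exact ⟨a, Φ.injective (by rw [hΦ, hψv])⟩
    exact ⟨((Q.mkQ ∘ₗ ψ).quotKerEquivOfSurjective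
      ((Submodule.mkQ_surjective Q).comp hψ.2)).symm.trans
      ((Submodule.quotEquivOfEq _ _ hker).trans (g.quotKerEquivOfSurjective h.surj))⟩

end
end GGP

end PartPI

section PartPI2
open CategoryTheory Abelian IsLocalRing TensorProduct RingTheory.Sequence
open scoped Pointwise
namespace GGP
section
variable {R : Type u} [CommRing R] [IsLocalRing R] [IsNoetherianRing R]
variable {d : ℕ} {h : PrimeSpectrum R → ℕ} {W D : ℕ → ModuleCat.{u} R} {ι : ∀ j, W j →ₗ[R] D j}
  {π : ∀ j, D j →ₗ[R] W (j+1)}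

/-- The support of `M` in codimension `n`. -/
def sset (R : Type u) [CommRing R] (h : PrimeSpectrum R → ℕ) (M : Type u) [AddCommGroup M] [Module R M] (n : ℕ) :
    Set (PrimeSpectrum R) := {p | p ∈ Module.support R M ∧ h p = n}

variable {M : Type u} [AddCommGroup M] [Module R M]

theorem ap_hom (K : Type u) [AddCommGroup K] [Module R K] [Module.Finite R K] {N : Type u} [AddCommGroup N] [Module R N]
    (p : PrimeSpectrum R) (hp : AP p.asIdeal (K →ₗ[R] N)) :
    AP p.asIdeal N ∧ ∀ r : R, (∀ k : K, r • k = 0) → r ∈ p.asIdeal := by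
  obtain ⟨y, hy⟩ := hp
  obtain ⟨s, hs⟩ := Module.Finite.fg_top (R := R) (M := K)
  refine ⟨?_, fun r hr => (hy r).1 (LinearMap.ext fun k => ?_)⟩
  · have h1 : s.inf (fun k => (LinearMap.ker (LinearMap.toSpanSingleton R N (y k)) : Ideal R)) ≤ p.asIdeal := by
      intro r hr
      rw [← hy]
      have : ∀ k ∈ s, r • y k = 0 := by
        intro k hk
        have := (Finset.inf_le (f := fun k => (LinearMap.ker (LinearMap.toSpanSingleton R N (y k)) : Ideal R)) hk) hr
        simpa using this
      refine LinearMap.ext_on hs fun k hk => ?_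
      simpa using this k hk
    obtain ⟨k, hk, hkp⟩ := (Ideal.IsPrime.inf_le' p.2).1 h1
    refine ⟨y k, fun r => ⟨fun hr => hkp (by simpa using hr), fun hr => ?_⟩⟩
    have := LinearMap.congr_fun ((hy r).2 hr) k
    simpa using this
  · rw [LinearMap.smul_apply, ← map_smul, hr, map_zero]; rfl

theorem mem_supp_of_dual [Module.Finite R M] {W : Type u} [AddCommGroup W] [Module R W] (p : PrimeSpectrum R)
    (hp : ∀ r : R, (∀ k : M →ₗ[R] W, r • k = 0) → r ∈ p.asIdeal) : p ∈ Module.support R M := by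
  rw [Module.mem_support_iff_of_finite]
  intro r hr
  rw [Module.mem_annihilator] at hr
  refine hp r fun k => LinearMap.ext fun m => ?_
  rw [LinearMap.smul_apply, ← map_smul, hr, map_zero]; rfl

theorem Dat.ap_mem (hD : Dat R d h W D ι π) [Module.Finite R M] (n : ℕ) (p : PrimeSpectrum R)
    (hp : AP p.asIdeal ((M →ₗ[R] W 0) →ₗ[R] D n)) : p ∈ sset R h M n := by
  have := hD.om.fin
  obtain ⟨h1, h2⟩ := ap_hom _ p hp
  exact ⟨mem_supp_of_dual p h2, (hD.ap p n h1).symm⟩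

theorem Dat.anti (hD : Dat R d h W D ι π) (n : ℕ) :
    ∀ p ∈ sset R h M n, ∀ q ∈ sset R h M n, p ≤ q → p = q := by
  intro p hp q hq hpq
  by_contra hne
  have := hD.mono (lt_of_le_of_ne hpq hne)
  rw [hp.2, hq.2] at this
  exact lt_irrefl _ this

theorem Dat.div (hD : Dat R d h W D ι π) [Module.Finite R M] (n : ℕ) :
    ∀ (x : (M →ₗ[R] W 0) →ₗ[R] D n), ∀ p ∈ sset R h M n, (∀ q ∈ sset R h M n, q ≠ p → van0 q x) →
      ∀ t ∉ p.asIdeal,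
      ∃ y : (M →ₗ[R] W 0) →ₗ[R] D n, t • y = x ∧ ∀ q ∈ sset R h M n, q ≠ p → van0 q y := by
  intro x p hp hx t ht
  have := hD.om.fin
  let K := M →ₗ[R] W 0
  let I : Ideal R := LinearMap.ker (LinearMap.toSpanSingleton R (K →ₗ[R] D n) x)
  have hI : ∀ r, r ∈ I ↔ r • x = 0 := fun r => Iff.rfl
  let Q := I • (⊤ : Submodule R K)
  have hQx : Q ≤ LinearMap.ker x := by
    rw [Submodule.smul_le]
    intro r hr k _
    rw [LinearMap.mem_ker, map_smul]
    exact LinearMap.congr_fun ((hI r).1 hr) k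
  let xb : (K ⧸ Q) →ₗ[R] D n := Q.liftQ x hQx
  let tt : (K ⧸ Q) →ₗ[R] (K ⧸ Q) := t • LinearMap.id
  have hker : LinearMap.ker tt ≤ LinearMap.ker xb := by
    intro k hk
    obtain ⟨k, rfl⟩ := Submodule.Quotient.mk_surjective Q k
    have h1 : t • k ∈ Q := by
      rw [← Submodule.Quotient.mk_eq_zero, Submodule.Quotient.mk_smul]; exact hk
    have h2 : t • x k = 0 := by rw [← map_smul]; exact hQx h1
    change x k = 0
    by_contra hne
    obtain ⟨q, hq, hap, s, hs⟩ := ap_of_ne (R := R) hne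
    have hqS : (⟨q, hq⟩ : PrimeSpectrum R) ∈ sset R h M n := by
      refine ⟨mem_supp_of_dual (W := W 0) _ fun r hr => (hs r).1 ?_, (hD.ap ⟨q, hq⟩ n hap).symm⟩
      rw [smul_comm, ← map_smul x, hr, map_zero, smul_zero]
    by_cases hqp : (⟨q, hq⟩ : PrimeSpectrum R) = p
    · rw [← hqp] at ht
      exact ht ((hs t).1 (by rw [smul_comm, h2, smul_zero]))
    · obtain ⟨v, hv, hvx⟩ := hx _ hqS hqp
      refine hv ((hs v).1 ?_)
      have := LinearMap.congr_fun hvx k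
      rw [LinearMap.smul_apply, LinearMap.zero_apply] at this
      rw [smul_comm, this, smul_zero]
  let e := (LinearMap.ker tt).liftQ tt le_rfl
  have he : Function.Injective e := by
    rw [← LinearMap.ker_eq_bot]; exact Submodule.ker_liftQ_eq_bot _ _ _ le_rfl
  obtain ⟨y, hy⟩ := inj_ext (hD.inj n) e he ((LinearMap.ker tt).liftQ xb hker)
  have hty : ∀ k : K, t • y (Q.mkQ k) = x k := by
    intro k
    have := LinearMap.congr_fun hy ((LinearMap.ker tt).mkQ (Q.mkQ k))
    rw [← map_smul]
    exact this
  refine ⟨y ∘ₗ Q.mkQ, LinearMap.ext hty, fun q hq hqp => ?_⟩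
  obtain ⟨v, hv, hvx⟩ := hx q hq hqp
  refine ⟨v, hv, LinearMap.ext fun k => ?_⟩
  change v • y (Q.mkQ k) = 0
  rw [← map_smul, ← map_smul]
  have : Q.mkQ (v • k) = 0 := by
    rw [Submodule.mkQ_apply, Submodule.Quotient.mk_eq_zero]
    exact Submodule.smul_mem_smul ((hI v).2 hvx) trivial
  rw [this, map_zero]

theorem Dat.zc (hD : Dat R d h W D ι π) [Module.Finite R M] (hM : ∀ i, van R M (W 0) (i+1)) (n : ℕ) :
    SES R (LinearMap.compRight R (ι n) : ((M →ₗ[R] W 0) →ₗ[R] W n) →ₗ[R] _)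
      (LinearMap.compRight R (π n) : _ →ₗ[R] ((M →ₗ[R] W 0) →ₗ[R] W (n+1))) := by
  have := hD.om.fin
  refine (hD.ses n).hom fun k => (hD.ses n).lift ?_ k
  refine chain_down hD.ses (fun n i => van_inj (hD.inj n)) n 0 ?_
  exact dual_van hD.om d M hM _ (by omega)

theorem Dat.zvan (hD : Dat R d h W D ι π) [Module.Finite R M] (n : ℕ) (p : PrimeSpectrum R)
    (hp : p ∈ sset R h M n) (c : (M →ₗ[R] W 0) →ₗ[R] W (n+1)) : van0 p c := by
  by_contra hc
  have hc2 : ¬ van0 p (ι (n+1) ∘ₗ c) := by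
    rintro ⟨v, hv, hvc⟩
    refine hc ⟨v, hv, LinearMap.ext fun k => (hD.ses (n+1)).inj ?_⟩
    have := LinearMap.congr_fun hvc k
    exact (map_smul _ _ _).trans (this.trans (map_zero (ι (n+1))).symm)
  obtain ⟨q, hqp, hq, -⟩ := exists_min_of_not_van0 hc2
  have h1 := (hD.ap_mem (n+1) q hq).2
  have h2 := hD.mono.monotone hqp
  have := hp.2
  omega

theorem Dat.htM (hD : Dat R d h W D ι π) [Module.Finite R M] (hM : ∀ i, van R M (W 0) (i+1))
    (p : PrimeSpectrum R) (hp : p ∈ Module.support R M) : GG.htM R M p = h p := by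
  have hs := hD.om.fin
  have hz : ∀ q : PrimeSpectrum R, AP q.asIdeal M → h q = 0 := by
    intro q hq
    have h1 := AP.of_inj _ (hD.zc hM 0).inj (AP.of_inj _ (bidual_equiv hD.om M hM).1 hq)
    exact (hD.ap_mem 0 q h1).2
  unfold GG.htM
  rw [iSup_pos hp]
  apply le_antisymm
  · have hm : StrictMono (fun q : Module.support R M => h q.1) := fun a b hab => hD.mono hab
    refine (Order.height_le_height_apply_of_strictMono _ hm ⟨p, hp⟩).trans ?_
    rw [Order.height_nat]
  · have key : ∀ (k : ℕ) (q : PrimeSpectrum R) (hq : q ∈ Module.support R M), q ≤ p → h p = h q + k →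
        (h q : ℕ∞) ≤ Order.height (⟨q, hq⟩ : Module.support R M) →
        (h p : ℕ∞) ≤ Order.height (⟨p, hp⟩ : Module.support R M) := by
      intro k
      induction k with
      | zero =>
        intro q hq hqp hk hle
        have : q = p := by
          by_contra hne
          have := hD.mono (lt_of_le_of_ne hqp hne)
          omega
        subst this; exact hle
      | succ k ih =>
        intro q hq hqp hk hle
        have hlt : q < p := lt_of_le_of_ne hqp (by rintro rfl; omega)
        obtain ⟨c, hc, hcp⟩ := exists_cov_up hD.mono q _ p rfl hlt
        have hcS := Module.mem_support_mono hc.le hq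
        have hcov := hD.cov q c hc
        refine ih c hcS hcp (by omega) ?_
        rw [hcov]
        push_cast
        have hlt2 : (⟨q, hq⟩ : Module.support R M) < ⟨c, hcS⟩ := hc.lt
        exact (add_le_add_left hle 1).trans (Order.height_add_one_le hlt2)
    have hann : Module.annihilator R M ≤ p.asIdeal := Module.mem_support_iff_of_finite.1 hp
    obtain ⟨q, hq, hqp⟩ := Ideal.exists_minimalPrimes_le hann
    have h2 := Module.associatedPrimes.minimalPrimes_annihilator_subset_associatedPrimes R _ hq
    obtain ⟨hqpr, f, hf⟩ := (isAssociatedPrime_iff_exists_injective_linearMap q _).1 h2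
    have hap : AP q M := AP.of_map f hf
    have h0 := hz ⟨q, hqpr⟩ hap
    have hle : (⟨q, hqpr⟩ : PrimeSpectrum R) ≤ p := hqp
    refine key (h p) ⟨q, hqpr⟩ (Module.mem_support_iff_of_finite.2 hq.1.2) hle (by omega) ?_
    rw [h0]; simp

theorem Dat.filt (hD : Dat R d h W D ι π) [Module.Finite R M] (hM : ∀ i, van R M (W 0) (i+1)) (n : ℕ) :
    GG.heightFiltration R M n \ GG.heightFiltration R M (n+1) = sset R h M n := by
  ext p
  constructor
  · rintro ⟨⟨h1, h2⟩, h3⟩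
    refine ⟨h1, ?_⟩
    have h4 : ¬ ((n+1 : ℕ) : ℕ∞) ≤ GG.htM R M p := fun hh => h3 ⟨h1, hh⟩
    rw [hD.htM hM p h1, Nat.cast_le] at h2 h4
    omega
  · rintro ⟨h1, h2⟩
    have h5 := hD.htM hM p h1
    refine ⟨⟨h1, ?_⟩, fun h3 => ?_⟩
    · rw [h5, Nat.cast_le]; omega
    · have := h3.2
      rw [h5, Nat.cast_le] at this
      omega

theorem Dat.cousin (hD : Dat R d h W D ι π) (M : ModuleCat.{u} R) [Module.Finite R M]
    (hM : ∀ i, van R M (W 0) (i+1)) (hGI : ∀ n, IsGI R ((M →ₗ[R] W 0) →ₗ[R] D n)) :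
    GG.CousinResolves R (GG.heightFiltration R M) M (fun N => GG.IsGorensteinInjective R N) := by
  let F := GG.heightFiltration R M
  have hfin := hD.om.fin
  have step : ∀ (n : ℕ) (A : ModuleCat.{u} R), Nonempty (A ≃ₗ[R] ((M →ₗ[R] W 0) →ₗ[R] W n)) →
      Function.Injective (GG.thetaFull R (F n \ F (n+1)) A) ∧
      LinearMap.range (GG.thetaFull R (F n \ F (n+1)) A) ≤ GG.finSupp R (F n \ F (n+1)) A ∧
      Nonempty (GG.finSupp R (F n \ F (n+1)) A ≃ₗ[R] ((M →ₗ[R] W 0) →ₗ[R] D n)) ∧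
      Nonempty (GG.nextKType R (F n \ F (n+1)) A ≃ₗ[R] ((M →ₗ[R] W 0) →ₗ[R] W (n+1))) := by
    rintro n A ⟨e⟩
    rw [hD.filt hM n]
    obtain ⟨hi, hr⟩ := theta_good (hD.ap_mem n) (hD.anti (M := M) n) (hD.div n)
    exact ((hD.zc hM n).equiv_left e).cousin hi hr (hD.zvan n)
  have hK : ∀ n, Nonempty (GG.cousinK R F M n ≃ₗ[R] ((M →ₗ[R] W 0) →ₗ[R] W n)) := by
    intro n
    induction n with
    | zero => exact ⟨LinearEquiv.ofBijective _ (bidual_equiv hD.om M hM)⟩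
    | succ n ih => exact (step n _ ih).2.2.2
  refine ⟨fun n => (step n _ (hK n)).2.1, (step 0 _ (hK 0)).1, fun n => ?_, fun n => ?_⟩
  · exact (LinearMap.ker_comp_of_ker_eq_bot _
      (LinearMap.ker_eq_bot.2 (step (n+1) _ (hK (n+1))).1)).trans (Submodule.ker_mkQ _)
  · obtain ⟨e⟩ := (step n _ (hK n)).2.2.1
    rw [isGI_iff]
    obtain ⟨Z, X, i, p, h1, h2, h3, ⟨e'⟩⟩ := hGI n
    exact ⟨Z, X, i, p, h1, h2, h3, ⟨e.trans e'⟩⟩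
end
end GGP

end PartPI2

section PartPJ
open CategoryTheory Abelian IsLocalRing TensorProduct RingTheory.Sequence
open scoped Pointwise
namespace GGP
section
variable {R : Type u} [CommRing R]

/-- the complex computing Ext, in the opposite category -/
noncomputable abbrev ocx (P : ChainComplex (ModuleCat.{u} R) ℕ) (Y : ModuleCat.{u} R) :
    ChainComplex (ModuleCat.{u} R)ᵒᵖ ℕ :=
  (((linearYoneda R (ModuleCat.{u} R)).obj Y).rightOp.mapHomologicalComplex _).obj P

/-- underlying cochain of an opcycle -/
noncomputable def oz (P : ChainComplex (ModuleCat.{u} R) ℕ) (Y : ModuleCat.{u} R) (n : ℕ) :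
    ((ocx P Y).opcycles n).unop →ₗ[R] (P.X n ⟶ Y) :=
  ((ocx P Y).pOpcycles n).unop.hom

/-- the identification with Ext -/
noncomputable def oi {X : ModuleCat.{u} R} (P : ProjectiveResolution X) (Y : ModuleCat.{u} R) (n : ℕ) :
    ((ocx P.complex Y).homology n).unop ⟶ ((_root_.Ext R (ModuleCat.{u} R) n).obj (Opposite.op X)).obj Y :=
  (P.isoLeftDerivedObj ((linearYoneda R (ModuleCat.{u} R)).obj Y).rightOp n).hom.unop

instance {X : ModuleCat.{u} R} (P : ProjectiveResolution X) (Y : ModuleCat.{u} R) (n : ℕ) : IsIso (oi P Y n) :=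
  inferInstanceAs (IsIso (P.isoLeftDerivedObj ((linearYoneda R (ModuleCat.{u} R)).obj Y).rightOp n).hom.unop)

/-- class of an opcycle -/
noncomputable def oe {X : ModuleCat.{u} R} (P : ProjectiveResolution X) (Y : ModuleCat.{u} R) (n : ℕ) :
    ((ocx P.complex Y).opcycles n).unop →ₗ[R] ((_root_.Ext R (ModuleCat.{u} R) n).obj (Opposite.op X)).obj Y :=
  (oi P Y n).hom ∘ₗ ((ocx P.complex Y).homologyι n).unop.hom

/-- class relation -/
def CL {X : ModuleCat.{u} R} (P : ProjectiveResolution X) (Y : ModuleCat.{u} R) (n : ℕ)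
    (c : P.complex.X n ⟶ Y) (e : ((_root_.Ext R (ModuleCat.{u} R) n).obj (Opposite.op X)).obj Y) : Prop :=
  ∃ z, oz P.complex Y n z = c ∧ oe P Y n z = e

variable {X : ModuleCat.{u} R} {P : ProjectiveResolution X} {Y : ModuleCat.{u} R} {n : ℕ}

theorem oz_inj (P : ChainComplex (ModuleCat.{u} R) ℕ) (Y : ModuleCat.{u} R) (n : ℕ) :
    Function.Injective (oz P Y n) := by
  have : Mono ((ocx P Y).pOpcycles n).unop := inferInstance
  exact (ModuleCat.mono_iff_injective _).1 this

theorem oz_exact (P : ChainComplex (ModuleCat.{u} R) ℕ) (Y : ModuleCat.{u} R) (n : ℕ) (c : P.X n ⟶ Y) :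
    P.d (n+1) n ≫ c = 0 ↔ ∃ z, oz P Y n z = c := by
  have h1 : (ShortComplex.mk ((ocx P Y).d (n+1) n) ((ocx P Y).pOpcycles n) ((ocx P Y).d_pOpcycles _ _)).Exact :=
    ShortComplex.exact_of_g_is_cokernel _ ((ocx P Y).opcyclesIsCokernel (n+1) n (by simp))
  have h2 := (ShortComplex.ShortExact.moduleCat_exact_iff_function_exact _).1 h1.unop
  exact h2 c

theorem oi_bij (P : ProjectiveResolution X) (Y : ModuleCat.{u} R) (n : ℕ) : Function.Bijective (oi P Y n).hom :=
  (ConcreteCategory.isIso_iff_bijective (oi P Y n)).1 inferInstance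

theorem oe_surj (P : ProjectiveResolution X) (Y : ModuleCat.{u} R) (n : ℕ) : Function.Surjective (oe P Y n) := by
  have h1 : Function.Surjective ((ocx P.complex Y).homologyι n).unop.hom := by
    have : Epi ((ocx P.complex Y).homologyι n).unop := inferInstance
    exact (ModuleCat.epi_iff_surjective _).1 this
  exact (oi_bij P Y n).2.comp h1

theorem oe_exact (P : ProjectiveResolution X) (Y : ModuleCat.{u} R) (n m : ℕ)
    (hm : (ComplexShape.down ℕ).next n = m) (z) :
    oe P Y n z = 0 ↔ ∃ b : P.complex.X m ⟶ Y, oz P.complex Y n z = P.complex.d n m ≫ b := by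
  have h1 : (ShortComplex.mk ((ocx P.complex Y).homologyι n) ((ocx P.complex Y).fromOpcycles n m)
      ((ocx P.complex Y).homologyι_comp_fromOpcycles n m)).Exact :=
    ShortComplex.exact_of_f_is_kernel _ ((ocx P.complex Y).homologyIsKernel n m hm)
  have h2 := (ShortComplex.ShortExact.moduleCat_exact_iff_function_exact _).1 h1.unop
  have h3 : oe P Y n z = 0 ↔ ((ocx P.complex Y).homologyι n).unop.hom z = 0 :=
    map_eq_zero_iff (oi P Y n).hom (oi_bij P Y n).1
  rw [h3]
  refine (h2 z).trans ?_
  have h4 : ∀ b : P.complex.X m ⟶ Y, oz P.complex Y n (((ocx P.complex Y).fromOpcycles n m).unop.hom b) =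
      P.complex.d n m ≫ b := by
    intro b
    have := congrArg (fun f => f.unop.hom b) ((ocx P.complex Y).p_fromOpcycles n m)
    exact this
  constructor
  · rintro ⟨b, rfl⟩
    exact ⟨b, h4 b⟩
  · rintro ⟨b, hb⟩
    exact ⟨b, oz_inj _ _ _ ((h4 b).trans hb.symm)⟩

theorem CL.ex (e) : ∃ c, CL P Y n c e := by
  obtain ⟨z, rfl⟩ := oe_surj P Y n e
  exact ⟨_, z, rfl, rfl⟩

theorem CL.coc {c e} (h : CL P Y n c e) : P.complex.d (n+1) n ≫ c = 0 := by
  obtain ⟨z, hz, -⟩ := h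
  exact (oz_exact _ _ _ _).2 ⟨z, hz⟩

theorem CL.of_coc {c} (h : P.complex.d (n+1) n ≫ c = 0) : ∃ e, CL P Y n c e := by
  obtain ⟨z, hz⟩ := (oz_exact _ _ _ _).1 h
  exact ⟨_, z, hz, rfl⟩

theorem CL.add {c e c' e'} (h : CL P Y n c e) (h' : CL P Y n c' e') : CL P Y n (c + c') (e + e') := by
  obtain ⟨z, rfl, rfl⟩ := h
  obtain ⟨z', rfl, rfl⟩ := h'
  exact ⟨z + z', map_add _ _ _, map_add _ _ _⟩

theorem CL.smul {c e} (r : R) (h : CL P Y n c e) : CL P Y n (r • c) (r • e) := by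
  obtain ⟨z, rfl, rfl⟩ := h
  exact ⟨r • z, map_smul _ _ _, map_smul _ _ _⟩

theorem CL.zero_iff {m : ℕ} (hm : (ComplexShape.down ℕ).next n = m) {c e} (h : CL P Y n c e) :
    e = 0 ↔ ∃ b : P.complex.X m ⟶ Y, c = P.complex.d n m ≫ b := by
  obtain ⟨z, rfl, rfl⟩ := h
  exact oe_exact _ _ _ _ hm z

theorem CL.nat {X' : ModuleCat.{u} R} {P' : ProjectiveResolution X'} (f : X' ⟶ X)
    (φ : P'.complex ⟶ P.complex) (comm : φ.f 0 ≫ P.π.f 0 = P'.π.f 0 ≫ f) {c e} (h : CL P Y n c e) :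
    CL P' Y n (φ.f n ≫ c) ((((_root_.Ext R (ModuleCat.{u} R) n).map f.op).app Y).hom e) := by
  obtain ⟨z, rfl, rfl⟩ := h
  let F := ((linearYoneda R (ModuleCat.{u} R)).obj Y).rightOp
  let ψ : ocx P'.complex Y ⟶ ocx P.complex Y := (F.mapHomologicalComplex _).map φ
  refine ⟨(HomologicalComplex.opcyclesMap ψ n).unop.hom z, ?_, ?_⟩
  · have := congrArg (fun f => f.unop.hom z) (HomologicalComplex.p_opcyclesMap ψ n)
    exact this
  · have h1 := congrArg (fun f => f.unop.hom z) (HomologicalComplex.homologyι_naturality ψ n)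
    have h2 := ProjectiveResolution.isoLeftDerivedObj_hom_naturality f P' P φ comm F n
    have h3 := congrArg (fun f => f.unop.hom (((ocx P.complex Y).homologyι n).unop.hom z)) h2
    refine Eq.trans ?_ h3.symm
    exact congrArg (oi P' Y n).hom h1.symm
end
end GGP

end PartPJ

section PartPJ2
open CategoryTheory Abelian IsLocalRing TensorProduct RingTheory.Sequence
open scoped Pointwise
namespace GGP
section
variable {R : Type u} [CommRing R]

/-- elementary projective resolutions -/
structure PRes (R : Type u) [CommRing R] (X : Type u) [AddCommGroup X] [Module R X] (p : ℕ → ModuleCat.{u} R)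
    (del : ∀ n, p (n+1) →ₗ[R] p n) (ε : p 0 →ₗ[R] X) : Prop where
  proj : ∀ n, Module.Projective R (p n)
  surj : Function.Surjective ε
  ex0 : Function.Exact (del 0) ε
  ex : ∀ n, Function.Exact (del (n+1)) (del n)

variable {p : ℕ → ModuleCat.{u} R} {del : ∀ n, p (n+1) →ₗ[R] p n}

/-- coboundaries -/
def bnd (del : ∀ n, p (n+1) →ₗ[R] p n) {Y : Type u} [AddCommGroup Y] [Module R Y] :
    ∀ (n : ℕ), (p n →ₗ[R] Y) → Prop
  | 0, c => c = 0
  | n+1, c => ∃ b : p n →ₗ[R] Y, c = b ∘ₗ del n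

/-- acyclicity -/
def acyc (del : ∀ n, p (n+1) →ₗ[R] p n) (Y : Type u) [AddCommGroup Y] [Module R Y] : Prop :=
  ∀ n (c : p n →ₗ[R] Y), c ∘ₗ del n = 0 → bnd del n c

theorem PRes.acyc {X : Type u} [AddCommGroup X] [Module R X] {ε : p 0 →ₗ[R] X} (h : PRes R X p del ε)
    {Y : Type u} [AddCommGroup Y] [Module R Y] (hv : ∀ i, van R X Y i) : acyc del Y := by
  have s0 : SES R (LinearMap.range (del 0)).subtype ε :=
    ⟨Submodule.subtype_injective _, fun x => by rw [h.ex0 x]; simp, h.surj⟩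
  have s1 : ∀ n, SES R (LinearMap.range (del (n+1))).subtype (del n).rangeRestrict :=
    fun n => ⟨Submodule.subtype_injective _, fun x => by
      have := h.ex n x
      rw [← Subtype.val_injective.eq_iff]
      simpa using this, LinearMap.surjective_rangeRestrict _⟩
  have hv1 : ∀ n i, van R (LinearMap.range (del n)) Y (i+1) := by
    intro n
    have := h.proj
    induction n with
    | zero => intro i; exact s0.contra_left (van_proj) (hv _)
    | succ n ih => intro i; exact (s1 n).contra_left (van_proj) (ih _)
  have hf : ∀ n (c : p (n+1) →ₗ[R] Y), c ∘ₗ del (n+1) = 0 →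
      ∃ c' : LinearMap.range (del n) →ₗ[R] Y, c' ∘ₗ (del n).rangeRestrict = c := by
    intro n c hc
    have hk : LinearMap.ker (del n).rangeRestrict ≤ LinearMap.ker c := by
      intro x hx
      obtain ⟨y, rfl⟩ := (h.ex n x).1 (by simpa using hx)
      exact LinearMap.congr_fun hc y
    refine ⟨(LinearMap.ker (del n).rangeRestrict).liftQ c hk ∘ₗ
      ((del n).rangeRestrict.quotKerEquivOfSurjective (LinearMap.surjective_rangeRestrict _)).symm.toLinearMap, ?_⟩
    refine LinearMap.ext fun x => ?_
    have : ((del n).rangeRestrict.quotKerEquivOfSurjective (LinearMap.surjective_rangeRestrict _)).symm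
        ((del n).rangeRestrict x) = Submodule.Quotient.mk x := by
      rw [LinearEquiv.symm_apply_eq]; rfl
    simp only [LinearMap.comp_apply, LinearEquiv.coe_coe]
    rw [this]; rfl
  intro n c hc
  match n, c, hc with
  | 0, c, hc =>
    have hk : LinearMap.ker ε ≤ LinearMap.ker c := by
      intro x hx
      obtain ⟨y, rfl⟩ := (h.ex0 x).1 hx
      exact LinearMap.congr_fun hc y
    have h0 := van_zero_iff.1 (hv 0) ((LinearMap.ker ε).liftQ c hk ∘ₗ
      (ε.quotKerEquivOfSurjective h.surj).symm.toLinearMap)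
    refine LinearMap.ext fun x => ?_
    have := LinearMap.congr_fun h0 (ε x)
    have h2 : (ε.quotKerEquivOfSurjective h.surj).symm (ε x) = Submodule.Quotient.mk x := by
      rw [LinearEquiv.symm_apply_eq]; rfl
    simp only [LinearMap.comp_apply, LinearEquiv.coe_coe] at this
    rw [h2] at this
    exact this
  | 1, c, hc =>
    obtain ⟨c', rfl⟩ := hf 0 c hc
    obtain ⟨k, hk⟩ := s0.extend (hv 1) c'
    exact ⟨k, by rw [← hk]; rfl⟩
  | n+2, c, hc =>
    obtain ⟨c', rfl⟩ := hf (n+1) c hc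
    obtain ⟨k, hk⟩ := (s1 n).extend (hv1 n 0) c'
    exact ⟨k, by rw [← hk]; rfl⟩

section step
variable {A B C : Type u} [AddCommGroup A] [Module R A] [AddCommGroup B] [Module R B]
    [AddCommGroup C] [Module R C] {f : A →ₗ[R] B} {g : B →ₗ[R] C}

/-- one dimension shift -/
def Stp (del : ∀ n, p (n+1) →ₗ[R] p n) (f : A →ₗ[R] B) (g : B →ₗ[R] C) (n : ℕ)
    (a : p (n+1) →ₗ[R] A) (c : p n →ₗ[R] C) : Prop :=
  ∃ b : p n →ₗ[R] B, g ∘ₗ b = c ∧ f ∘ₗ a = b ∘ₗ del n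

theorem SES.fac (h : SES R f g) {X : Type u} [AddCommGroup X] [Module R X] (b : X →ₗ[R] B) (hb : g ∘ₗ b = 0) :
    ∃ a : X →ₗ[R] A, f ∘ₗ a = b := by
  have h1 : ∀ x, ∃ a, f a = b x := fun x => (h.exact (b x)).1 (LinearMap.congr_fun hb x)
  choose a ha using h1
  refine ⟨⟨⟨a, fun x y => h.inj ?_⟩, fun r x => h.inj ?_⟩, LinearMap.ext ha⟩
  · rw [ha, map_add, map_add, ha, ha]
  · simp only [RingHom.id_apply]
    rw [ha, map_smul, map_smul, ha]

theorem SES.gf (h : SES R f g) : g ∘ₗ f = 0 := LinearMap.ext fun x => (h.exact _).2 ⟨x, rfl⟩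

theorem SES.finj (h : SES R f g) {X : Type u} [AddCommGroup X] [Module R X] {a a' : X →ₗ[R] A}
    (hb : f ∘ₗ a = f ∘ₗ a') : a = a' := LinearMap.ext fun x => h.inj (LinearMap.congr_fun hb x)

variable (hp : ∀ n, Module.Projective R (p n)) (hdd : ∀ n, del n ∘ₗ del (n+1) = 0)
include hp hdd

theorem Stp.ex_a (h : SES R f g) {n : ℕ} (c : p n →ₗ[R] C) (hc : c ∘ₗ del n = 0) :
    ∃ a, a ∘ₗ del (n+1) = 0 ∧ Stp del f g n a c := by
  have := hp n
  obtain ⟨b, hb⟩ := Module.projective_lifting_property g c h.surj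
  obtain ⟨a, ha⟩ := h.fac (b ∘ₗ del n) (by rw [← LinearMap.comp_assoc, hb, hc])
  refine ⟨a, h.finj ?_, b, hb, ha⟩
  rw [← LinearMap.comp_assoc, ha, LinearMap.comp_assoc, hdd, LinearMap.comp_zero, LinearMap.comp_zero]

omit hp in
theorem Stp.ex_c (h : SES R f g) (hB : acyc del B) {n : ℕ} (a : p (n+1) →ₗ[R] A) (ha : a ∘ₗ del (n+1) = 0) :
    ∃ c, c ∘ₗ del n = 0 ∧ Stp del f g n a c := by
  obtain ⟨b, hb⟩ := hB (n+1) (f ∘ₗ a) (by rw [LinearMap.comp_assoc, ha, LinearMap.comp_zero])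
  refine ⟨g ∘ₗ b, ?_, b, rfl, hb⟩
  rw [LinearMap.comp_assoc, ← hb, ← LinearMap.comp_assoc, h.gf, LinearMap.zero_comp]

theorem Stp.bnd_a (h : SES R f g) {n : ℕ} {a : p (n+1) →ₗ[R] A} {c : p n →ₗ[R] C} (hs : Stp del f g n a c)
    (hc : bnd del n c) : bnd del (n+1) a := by
  obtain ⟨b, hb, hab⟩ := hs
  match n, a, c, b, hb, hab, hc with
  | 0, a, c, b, hb, hab, hc =>
    obtain ⟨a', rfl⟩ := h.fac b (hb.trans hc)
    exact ⟨a', h.finj hab⟩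
  | n+1, a, c, b, hb, hab, hc =>
    obtain ⟨e, rfl⟩ := hc
    have := hp n
    obtain ⟨e', he⟩ := Module.projective_lifting_property g e h.surj
    obtain ⟨a', ha'⟩ := h.fac (b - e' ∘ₗ del n) (by
      rw [LinearMap.comp_sub, hb, ← LinearMap.comp_assoc, he, sub_self])
    refine ⟨a', h.finj ?_⟩
    rw [← LinearMap.comp_assoc, ha', LinearMap.sub_comp, LinearMap.comp_assoc, hdd, LinearMap.comp_zero, sub_zero, hab]

omit hp hdd in
theorem Stp.bnd_c (h : SES R f g) (hB : acyc del B) {n : ℕ} {a : p (n+1) →ₗ[R] A} {c : p n →ₗ[R] C}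
    (hs : Stp del f g n a c) (ha : bnd del (n+1) a) : bnd del n c := by
  obtain ⟨b, rfl, hab⟩ := hs
  obtain ⟨a', rfl⟩ := ha
  have h1 := hB n (b - f ∘ₗ a') (by rw [LinearMap.sub_comp, ← hab, LinearMap.comp_assoc, sub_self])
  have h2 : g ∘ₗ b = g ∘ₗ (b - f ∘ₗ a') := by
    rw [LinearMap.comp_sub, ← LinearMap.comp_assoc, h.gf, LinearMap.zero_comp, sub_zero]
  rw [h2]
  match n, b - f ∘ₗ a', h1 with
  | 0, x, h1 => 
    have : x = 0 := h1
    rw [this]; exact LinearMap.comp_zero _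
  | n+1, x, h1 =>
    obtain ⟨y, rfl⟩ := h1
    exact ⟨g ∘ₗ y, rfl⟩

omit hp hdd in
theorem Stp.add {n : ℕ} {a a' : p (n+1) →ₗ[R] A} {c c' : p n →ₗ[R] C}
    (hs : Stp del f g n a c) (hs' : Stp del f g n a' c') : Stp del f g n (a + a') (c + c') := by
  obtain ⟨b, rfl, hab⟩ := hs
  obtain ⟨b', rfl, hab'⟩ := hs'
  exact ⟨b + b', LinearMap.comp_add _ _ _, by rw [LinearMap.comp_add, LinearMap.add_comp, hab, hab']⟩

omit hp hdd in
theorem Stp.smul (r : R) {n : ℕ} {a : p (n+1) →ₗ[R] A} {c : p n →ₗ[R] C}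
    (hs : Stp del f g n a c) : Stp del f g n (r • a) (r • c) := by
  obtain ⟨b, rfl, hab⟩ := hs
  exact ⟨r • b, LinearMap.comp_smul _ _ _, by rw [LinearMap.comp_smul, LinearMap.smul_comp, hab]⟩

omit hp hdd in
theorem Stp.nat {p' : ℕ → ModuleCat.{u} R} {del' : ∀ n, p' (n+1) →ₗ[R] p' n} (φ : ∀ n, p' n →ₗ[R] p n)
    (hφ : ∀ n, φ n ∘ₗ del' n = del n ∘ₗ φ (n+1)) {n : ℕ} {a : p (n+1) →ₗ[R] A} {c : p n →ₗ[R] C}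
    (hs : Stp del f g n a c) : Stp del' f g n (a ∘ₗ φ (n+1)) (c ∘ₗ φ n) := by
  obtain ⟨b, rfl, hab⟩ := hs
  exact ⟨b ∘ₗ φ n, rfl, by rw [← LinearMap.comp_assoc, hab, LinearMap.comp_assoc, LinearMap.comp_assoc, hφ]⟩
end step

section rel
variable {Z J : ℕ → ModuleCat.{u} R} {ι : ∀ j, Z j →ₗ[R] J j} {π : ∀ j, J j →ₗ[R] Z (j+1)}

/-- iterated dimension shift -/
inductive Rel (del : ∀ n, p (n+1) →ₗ[R] p n) (ι : ∀ j, Z j →ₗ[R] J j) (π : ∀ j, J j →ₗ[R] Z (j+1)) (N : ℕ)  :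
    ∀ n k, (p n →ₗ[R] Z k) → (p 0 →ₗ[R] Z N) → Prop
  | base (φ : p 0 →ₗ[R] Z N) (h : φ ∘ₗ del 0 = 0) : Rel del ι π N 0 N φ φ
  | step (n k) (a : p (n+1) →ₗ[R] Z k) (c : p n →ₗ[R] Z (k+1)) (φ : p 0 →ₗ[R] Z N) (hr : Rel del ι π N n (k+1) c φ)
      (ha : a ∘ₗ del (n+1) = 0) (hs : Stp del (ι k) (π k) n a c) : Rel del ι π N (n+1) k a φ

variable {N n k : ℕ} {a a' : p n →ₗ[R] Z k} {φ φ' : p 0 →ₗ[R] Z N}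

theorem Rel.eq (h : Rel del ι π N n k a φ) : n + k = N := by
  induction h with
  | base => omega
  | step => omega

theorem Rel.coc (h : Rel del ι π N n k a φ) : a ∘ₗ del n = 0 := by
  cases h with
  | base => assumption
  | step => assumption

theorem Rel.coc0 (h : Rel del ι π N n k a φ) : φ ∘ₗ del 0 = 0 := by
  induction h with
  | base => assumption
  | step => assumption

theorem Rel.smul (r : R) (h : Rel del ι π N n k a φ) : Rel del ι π N n k (r • a) (r • φ) := by
  induction h with
  | base φ h => exact Rel.base _ (by rw [LinearMap.smul_comp, h, smul_zero])
  | step n k a c φ hr ha hs ih =>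
    exact Rel.step _ _ _ _ _ ih (by rw [LinearMap.smul_comp, ha, smul_zero]) (hs.smul r)

theorem Rel.add (h : Rel del ι π N n k a φ) (h' : Rel del ι π N n k a' φ') :
    Rel del ι π N n k (a + a') (φ + φ') := by
  induction h with
  | base φ h =>
    cases h' with
    | base _ h' => exact Rel.base _ (by rw [LinearMap.add_comp, h, h', add_zero])
  | step n k a c φ hr ha hs ih =>
    cases h' with
    | step _ _ _ c' _ hr' ha' hs' =>
    exact Rel.step _ _ _ _ _ (ih hr') (by rw [LinearMap.add_comp, ha, ha', add_zero]) (hs.add hs')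

theorem Rel.nat {p' : ℕ → ModuleCat.{u} R} {del' : ∀ n, p' (n+1) →ₗ[R] p' n} (f : ∀ n, p' n →ₗ[R] p n)
    (hf : ∀ n, f n ∘ₗ del' n = del n ∘ₗ f (n+1)) (h : Rel del ι π N n k a φ) :
    Rel del' ι π N n k (a ∘ₗ f n) (φ ∘ₗ f 0) := by
  induction h with
  | base φ h => exact Rel.base _ (by rw [LinearMap.comp_assoc, hf, ← LinearMap.comp_assoc, h, LinearMap.zero_comp])
  | step n k a c φ hr ha hs ih =>
    exact Rel.step _ _ _ _ _ ih (by rw [LinearMap.comp_assoc, hf, ← LinearMap.comp_assoc, ha, LinearMap.zero_comp])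
      (hs.nat f hf)

variable (hp : ∀ n, Module.Projective R (p n)) (hdd : ∀ n, del n ∘ₗ del (n+1) = 0)
  (hS : ∀ j, SES R (ι j) (π j)) (hJ : ∀ j < N, acyc del (J j))
include hp hdd hS

theorem Rel.ex_a (φ : p 0 →ₗ[R] Z N) (hφ : φ ∘ₗ del 0 = 0) (n : ℕ) : ∀ k, n + k = N → ∃ a, Rel del ι π N n k a φ := by
  induction n with
  | zero => 
    intro k hk
    obtain rfl : k = N := by omega
    exact ⟨φ, Rel.base φ hφ⟩
  | succ n ih =>
    intro k hk
    obtain ⟨c, hc⟩ := ih (k+1) (by omega)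
    obtain ⟨a, ha, hs⟩ := Stp.ex_a hp hdd (hS k) c hc.coc
    exact ⟨a, Rel.step _ _ _ _ _ hc ha hs⟩

include hJ
omit hp in
theorem Rel.ex_φ (n : ℕ) : ∀ k, n + k = N → ∀ a : p n →ₗ[R] Z k, a ∘ₗ del n = 0 → ∃ φ, Rel del ι π N n k a φ := by
  induction n with
  | zero => 
    intro k hk a ha
    obtain rfl : k = N := by omega
    exact ⟨a, Rel.base a ha⟩
  | succ n ih =>
    intro k hk a ha
    obtain ⟨c, hc, hs⟩ := Stp.ex_c hdd (hS k) (hJ k (by omega)) a ha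
    obtain ⟨φ, hr⟩ := ih (k+1) (by omega) c hc
    exact ⟨φ, Rel.step _ _ _ _ _ hr ha hs⟩

theorem Rel.bnd_iff (h : Rel del ι π N n k a φ) : bnd del n a ↔ φ = 0 := by
  induction h with
  | base φ h => exact Iff.rfl
  | step n k a c φ hr ha hs ih =>
    rw [← ih]
    have := hr.eq
    exact ⟨hs.bnd_c (hS k) (hJ k (by omega)), hs.bnd_a hp hdd (hS k)⟩
end rel
end
end GGP

end PartPJ2

section PartPJ3
open CategoryTheory Abelian IsLocalRing TensorProduct RingTheory.Sequence
open scoped Pointwise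
namespace GGP
section
variable {R : Type u} [CommRing R]

/-- differential as linear map -/
noncomputable abbrev dl {X : ModuleCat.{u} R} (P : ProjectiveResolution X) (n : ℕ) :
    P.complex.X (n+1) →ₗ[R] P.complex.X n := (P.complex.d (n+1) n).hom

/-- augmentation as linear map -/
noncomputable abbrev ep {X : ModuleCat.{u} R} (P : ProjectiveResolution X) : P.complex.X 0 →ₗ[R] X := (P.π.f 0).hom

theorem pres {X : ModuleCat.{u} R} (P : ProjectiveResolution X) : PRes R X P.complex.X (dl P) (ep P) where
  proj n := by
    have := P.projective n
    exact (IsProjective.iff_projective _).2 this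
  surj := by
    have : Epi (P.π.f 0) := inferInstance
    exact (ModuleCat.epi_iff_surjective _).1 this
  ex0 := (ShortComplex.ShortExact.moduleCat_exact_iff_function_exact _).1 P.exact₀
  ex n := by
    have := P.exact_succ n
    exact (ShortComplex.ShortExact.moduleCat_exact_iff_function_exact _).1 this

theorem dl_dl {X : ModuleCat.{u} R} (P : ProjectiveResolution X) (n : ℕ) : dl P n ∘ₗ dl P (n+1) = 0 :=
  LinearMap.ext fun x => ((pres P).ex n _).2 ⟨x, rfl⟩

theorem CL.zero_iff' {X Y : ModuleCat.{u} R} {P : ProjectiveResolution X} {n : ℕ} {c : P.complex.X n ⟶ Y} {e}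
    (h : CL P Y n c e) : e = 0 ↔ bnd (dl P) n c.hom := by
  cases n with
  | zero =>
    rw [h.zero_iff (m := 0) (by simp)]
    constructor
    · rintro ⟨b, rfl⟩
      change (P.complex.d 0 0 ≫ b).hom = 0
      rw [P.complex.shape 0 0 (by simp)]
      simp
    · intro hc
      refine ⟨0, ?_⟩
      rw [Limits.comp_zero]
      exact ModuleCat.hom_ext hc
  | succ n =>
    rw [h.zero_iff (m := n) (by simp)]
    constructor
    · rintro ⟨b, rfl⟩
      exact ⟨b.hom, rfl⟩
    · rintro ⟨b, hb⟩
      exact ⟨ModuleCat.ofHom b, ModuleCat.hom_ext hb⟩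

variable {Z J : ℕ → ModuleCat.{u} R} {ι : ∀ j, Z j →ₗ[R] J j} {π : ∀ j, J j →ₗ[R] Z (j+1)}

/-- comparison relation -/
def TT (ι : ∀ j, Z j →ₗ[R] J j) (π : ∀ j, J j →ₗ[R] Z (j+1)) (N : ℕ) (X : ModuleCat.{u} R)
    (e : ((_root_.Ext R (ModuleCat.{u} R) N).obj (Opposite.op X)).obj (Z 0)) (φ : X →ₗ[R] Z N) : Prop :=
  ∃ a, CL (projectiveResolution X) (Z 0) N a e ∧
    Rel (dl (projectiveResolution X)) ι π N N 0 a.hom (φ ∘ₗ ep (projectiveResolution X))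

variable {N : ℕ} {X : ModuleCat.{u} R}

theorem TT.add {e e' φ φ'} (h : TT ι π N X e φ) (h' : TT ι π N X e' φ') : TT ι π N X (e + e') (φ + φ') := by
  obtain ⟨a, h1, h2⟩ := h
  obtain ⟨a', h1', h2'⟩ := h'
  exact ⟨a + a', h1.add h1', h2.add h2'⟩

theorem TT.smul (r : R) {e φ} (h : TT ι π N X e φ) : TT ι π N X (r • e) (r • φ) := by
  obtain ⟨a, h1, h2⟩ := h
  exact ⟨r • a, h1.smul r, h2.smul r⟩

theorem TT.nat {X' : ModuleCat.{u} R} (f : X' ⟶ X) {e φ} (h : TT ι π N X e φ) :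
    TT ι π N X' ((((_root_.Ext R (ModuleCat.{u} R) N).map f.op).app (Z 0)).hom e) (φ ∘ₗ f.hom) := by
  obtain ⟨a, h1, h2⟩ := h
  let P := projectiveResolution X
  let P' := projectiveResolution X'
  let l := ProjectiveResolution.lift f P' P
  have hl : l.f 0 ≫ P.π.f 0 = P'.π.f 0 ≫ f := ProjectiveResolution.lift_commutes_zero f P' P
  refine ⟨l.f N ≫ a, h1.nat f l hl, ?_⟩
  have h3 := h2.nat (del' := dl P') (fun n => (l.f n).hom) (fun n => congrArg ModuleCat.Hom.hom (l.comm (n+1) n).symm)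
  have h4 : (φ ∘ₗ f.hom) ∘ₗ ep P' = (φ ∘ₗ ep P) ∘ₗ (l.f 0).hom := by
    rw [LinearMap.comp_assoc, LinearMap.comp_assoc]
    exact congrArg (fun k => φ ∘ₗ k) (congrArg ModuleCat.Hom.hom hl.symm)
  rw [h4]
  exact h3

variable (hS : ∀ j, SES R (ι j) (π j)) (hJ : ∀ j < N, ∀ i, van R X (J j) i)
include hS hJ

theorem TT.zero_iff {e φ} (h : TT ι π N X e φ) : e = 0 ↔ φ = 0 := by
  obtain ⟨a, h1, h2⟩ := h
  rw [h1.zero_iff', h2.bnd_iff (pres _).proj (dl_dl _) hS (fun j hj => (pres _).acyc (hJ j hj))]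
  constructor
  · intro h
    refine LinearMap.ext fun x => ?_
    obtain ⟨y, rfl⟩ := (pres (projectiveResolution X)).surj x
    exact LinearMap.congr_fun h y
  · rintro rfl; exact LinearMap.zero_comp _

omit hJ in
theorem TT.ex_e (φ) : ∃ e, TT ι π N X e φ := by
  obtain ⟨a, ha⟩ := Rel.ex_a (del := dl (projectiveResolution X)) (pres _).proj (dl_dl _) hS
    (φ ∘ₗ ep (projectiveResolution X)) (LinearMap.ext fun x => by
      have := ((pres (projectiveResolution X)).ex0 _).2 ⟨x, rfl⟩
      simp only [LinearMap.comp_apply]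
      rw [this, map_zero]; rfl) N 0 (by omega)
  obtain ⟨e, he⟩ := CL.of_coc (P := projectiveResolution X) (c := ModuleCat.ofHom a) (ModuleCat.hom_ext ha.coc)
  exact ⟨e, _, he, ha⟩

theorem TT.ex_φ (e) : ∃ φ, TT ι π N X e φ := by
  obtain ⟨a, ha⟩ := CL.ex (P := projectiveResolution X) e
  obtain ⟨ψ, hψ⟩ := Rel.ex_φ (del := dl (projectiveResolution X)) (dl_dl _) hS (fun j hj => (pres _).acyc (hJ j hj))
    N 0 (by omega) a.hom (congrArg ModuleCat.Hom.hom ha.coc)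
  have hc := hψ.coc0
  let ε := ep (projectiveResolution X)
  have hs : Function.Surjective ε := (pres (projectiveResolution X)).surj
  have hk : LinearMap.ker ε ≤ LinearMap.ker ψ := by
    intro x hx
    obtain ⟨y, rfl⟩ := ((pres (projectiveResolution X)).ex0 x).1 hx
    exact LinearMap.congr_fun hc y
  refine ⟨(LinearMap.ker ε).liftQ ψ hk ∘ₗ (ε.quotKerEquivOfSurjective hs).symm.toLinearMap, a, ha, ?_⟩
  have : ((LinearMap.ker ε).liftQ ψ hk ∘ₗ (ε.quotKerEquivOfSurjective hs).symm.toLinearMap) ∘ₗ ε = ψ := by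
    refine LinearMap.ext fun x => ?_
    have h2 : (ε.quotKerEquivOfSurjective hs).symm (ε x) = Submodule.Quotient.mk x := by
      rw [LinearEquiv.symm_apply_eq]; rfl
    simp only [LinearMap.comp_apply, LinearEquiv.coe_coe]
    rw [h2]; rfl
  rw [this]; exact hψ

/-- The comparison isomorphism, as an injective-surjective linear map. -/
theorem TT.exists_eta : ∃ η : ((_root_.Ext R (ModuleCat.{u} R) N).obj (Opposite.op X)).obj (Z 0) →ₗ[R] (X →ₗ[R] Z N),
    Function.Bijective η ∧ ∀ e φ, TT ι π N X e φ ↔ η e = φ := by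
  have huniq : ∀ {e φ φ'}, TT ι π N X e φ → TT ι π N X e φ' → φ = φ' := by
    intro e φ φ' h h'
    have h1 := h.add (h'.smul (-1))
    have h2 := (h1.zero_iff hS hJ).1 (by simp)
    have h3 : φ - φ' = 0 := by rw [← h2]; module
    exact sub_eq_zero.1 h3
  choose η hη using TT.ex_φ (X := X) hS hJ
  refine ⟨⟨⟨η, fun x y => huniq (hη _) ((hη x).add (hη y))⟩, fun r x => huniq (hη _) ((hη x).smul r)⟩, ⟨?_, ?_⟩, ?_⟩
  · rw [injective_iff_map_eq_zero]
    intro e he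
    exact ((hη e).zero_iff hS hJ).2 he
  · intro φ
    obtain ⟨e, he⟩ := TT.ex_e (X := X) hS φ
    exact ⟨e, huniq (hη e) he⟩
  · intro e φ
    constructor
    · intro h; exact huniq (hη e) h
    · rintro rfl; exact hη e
end
end GGP

end PartPJ3

section PartPJ4
open CategoryTheory Abelian IsLocalRing TensorProduct RingTheory.Sequence
open scoped Pointwise
namespace GGP
section
variable {R : Type u} [CommRing R]
variable {Z J : ℕ → ModuleCat.{u} R} {ι : ∀ j, Z j →ₗ[R] J j} {π : ∀ j, J j →ₗ[R] Z (j+1)}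

theorem lc_equiv (I : Ideal R) (N : ℕ) (hS : ∀ j, SES R (ι j) (π j))
    (hJ : ∀ t : ℕ, ∀ j < N, ∀ i, van R (R ⧸ I ^ t) (J j) i)
    (htors : ∀ z : Z N, ∃ t : ℕ, ∀ r ∈ I ^ t, r • z = 0) :
    Nonempty (((localCohomology I N).obj (Z 0)) ≃ₗ[R] Z N) := by
  let Dg := localCohomology.diagram (localCohomology.idealPowersDiagram I) N
  have hcol : Limits.HasColimit Dg := localCohomology.hasColimitDiagram _ _
  let ev := (evaluation (ModuleCat.{u} R) (ModuleCat.{u} R)).obj (Z 0)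
  have hL := Limits.isColimitOfPreserves ev (Limits.colimit.isColimit Dg)
  let X : ℕ → ModuleCat.{u} R := fun t => ModuleCat.of R (R ⧸ I ^ t)
  have hJ' : ∀ t : ℕ, ∀ j < N, ∀ i, van R (X t) (J j) i := hJ
  choose η hη hT using fun t => TT.exists_eta (X := X t) hS (hJ' t)
  let evl : ∀ t : ℕ, ((R ⧸ I ^ t) →ₗ[R] Z N) →ₗ[R] Z N := fun t =>
    LinearMap.applyₗ (Ideal.Quotient.mk (I ^ t) 1)
  let co : Limits.Cocone (Dg ⋙ ev) :=
    { pt := Z N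
      ι := { app := fun t => ModuleCat.ofHom (evl t.unop.unop ∘ₗ η t.unop.unop)
             naturality := by
              intro s t f
              refine ModuleCat.hom_ext (LinearMap.ext fun e => ?_)
              let g : X t.unop.unop ⟶ X s.unop.unop :=
                (localCohomology.ringModIdeals (localCohomology.idealPowersDiagram I)).map f.unop
              have h1 := (hT s.unop.unop e _).2 rfl
              have h2 := (hT t.unop.unop _ _).1 (h1.nat g)
              exact LinearMap.congr_fun h2 (Ideal.Quotient.mk _ 1) } }
  let δ := (hL.desc co).hom
  have hδ : ∀ (t) (e : (Dg ⋙ ev).obj t), δ (((ev.mapCocone (Limits.colimit.cocone Dg)).ι.app t).hom e)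
      = η t.unop.unop e (Ideal.Quotient.mk _ 1) := by
    intro t e
    exact LinearMap.congr_fun (congrArg ModuleCat.Hom.hom (hL.fac co t)) e
  have hinj : Function.Injective δ := by
    rw [injective_iff_map_eq_zero]
    intro x hx
    have : Limits.PreservesFilteredColimitsOfSize.{0,0} (forget (ModuleCat.{u} R)) :=
      Limits.preservesSmallestFilteredColimits_of_preservesFilteredColimits _
    obtain ⟨t, e, rfl⟩ := Limits.Concrete.isColimit_exists_rep (Dg ⋙ ev) hL x
    have h1 := hδ t e
    have h2 : η t.unop.unop e (Ideal.Quotient.mk _ 1) = 0 := h1.symm.trans hx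
    have h3 : η t.unop.unop e = 0 := by
      refine LinearMap.ext fun y => ?_
      obtain ⟨r, rfl⟩ := Ideal.Quotient.mk_surjective y
      have h4 : (Ideal.Quotient.mk (I ^ t.unop.unop) r) = r • (Ideal.Quotient.mk (I ^ t.unop.unop) 1) := by
        change _ = Ideal.Quotient.mk _ (r * 1)
        rw [mul_one]
      rw [h4]
      refine (map_smul (η t.unop.unop e) r _).trans ?_
      rw [h2, smul_zero]; rfl
    have h5 : e = 0 := (hη t.unop.unop).1 (h3.trans (map_zero _).symm)
    rw [h5]
    exact map_zero _
  have hsurj : Function.Surjective δ := by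
    intro z
    obtain ⟨t, ht⟩ := htors z
    let φ : (R ⧸ I ^ t) →ₗ[R] Z N := Submodule.liftQ _ (LinearMap.toSpanSingleton R (Z N) z) (fun r hr => by
      rw [LinearMap.mem_ker, LinearMap.toSpanSingleton_apply]; exact ht r hr)
    obtain ⟨e, he⟩ := (hη t).2 φ
    refine ⟨((ev.mapCocone (Limits.colimit.cocone Dg)).ι.app (Opposite.op (Opposite.op t))).hom e, ?_⟩
    refine (hδ (Opposite.op (Opposite.op t)) e).trans ?_
    refine (LinearMap.congr_fun he _).trans ?_
    change (1 : R) • z = z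
    exact one_smul _ _
  exact ⟨LinearEquiv.ofBijective δ ⟨hinj, hsurj⟩⟩
end

section
variable {R : Type u} [CommRing R] [IsLocalRing R] [IsNoetherianRing R]
variable {d : ℕ} {h : PrimeSpectrum R → ℕ} {W D : ℕ → ModuleCat.{u} R} {ι : ∀ j, W j →ₗ[R] D j}
  {π : ∀ j, D j →ₗ[R] W (j+1)}

theorem Dat.van_pow (hD : Dat R d h W D ι π) (t : ℕ) {k : ℕ} (hk : k < d) :
    ∀ (i : ℕ) (K : Type u) [AddCommGroup K] [Module R K] [Module.Finite R K],
      van R (R ⧸ maximalIdeal R ^ t) (K →ₗ[R] D k) i := by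
  intro i
  induction i with
  | zero =>
    intro K _ _ _
    rw [van_zero_iff]
    intro f
    by_contra hf
    have : ∃ y, f y ≠ 0 := by
      by_contra hc
      push Not at hc
      exact hf (LinearMap.ext hc)
    obtain ⟨y, hy⟩ := this
    obtain ⟨p, hp, hap, s, hs⟩ := ap_of_ne (R := R) hy
    have h1 : maximalIdeal R ^ t ≤ p := by
      intro r hr
      rw [← hs, smul_comm, ← map_smul]
      have : r • y = 0 := by
        obtain ⟨a, rfl⟩ := Ideal.Quotient.mk_surjective y
        change Ideal.Quotient.mk _ (r * a) = 0
        rw [Ideal.Quotient.eq_zero_iff_mem]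
        exact Ideal.mul_mem_right _ _ hr
      rw [this, map_zero, smul_zero]
    have h2 : p = maximalIdeal R :=
      le_antisymm (IsLocalRing.le_maximalIdeal_of_isPrime _) (hp.le_of_pow_le h1)
    subst h2
    have h3 := (ap_hom K (closedPoint R) hap).1
    have h4 := hD.ap _ _ h3
    rw [hD.closed] at h4
    omega
  | succ i ih =>
    intro K _ _ _
    obtain ⟨n, f, hf⟩ := exists_pres (R := R) K
    have hs := (SES.ofKer f hf).homc (X := D k) (fun g => inj_ext (hD.inj k) _ (SES.ofKer f hf).inj g)
    exact hs.co_left (ih _) (van_inj (inj_hom_free (hD.inj k) _))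

theorem Dat.tors (hD : Dat R d h W D ι π) (x : W d) : ∃ t : ℕ, ∀ r ∈ maximalIdeal R ^ t, r • x = 0 := by
  have h1 : maximalIdeal R ≤ Ideal.radical (LinearMap.ker (LinearMap.toSpanSingleton R (D d) (ι d x)) : Ideal R) := by
    rw [← Ideal.sInf_minimalPrimes]
    refine le_sInf fun q hq => ?_
    have hqp : q.IsPrime := hq.1.1
    have h2 := hD.ap ⟨q, hqp⟩ d (ap_of_minimal hq)
    have h3 : (⟨q, hqp⟩ : PrimeSpectrum R) ≤ closedPoint R := IsLocalRing.le_maximalIdeal_of_isPrime _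
    rcases h3.lt_or_eq with h4 | h4
    · have := hD.mono h4
      rw [hD.closed] at this
      omega
    · exact (congrArg PrimeSpectrum.asIdeal h4).ge
  obtain ⟨t, ht⟩ := Ideal.exists_pow_le_of_le_radical_of_fg h1 (IsNoetherian.noetherian _)
  refine ⟨t, fun r hr => (hD.ses d).inj ?_⟩
  rw [map_smul, map_zero]
  have := ht hr
  rwa [LinearMap.mem_ker, LinearMap.toSpanSingleton_apply] at this

theorem Dat.tors_hom (hD : Dat R d h W D ι π) (K : Type u) [AddCommGroup K] [Module R K] [Module.Finite R K]
    (z : K →ₗ[R] W d) : ∃ t : ℕ, ∀ r ∈ maximalIdeal R ^ t, r • z = 0 := by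
  choose t ht using hD.tors
  obtain ⟨s, hs⟩ := Module.Finite.fg_top (R := R) (M := K)
  refine ⟨s.sup fun k => t (z k), fun r hr => LinearMap.ext_on hs fun k hk => ?_⟩
  exact ht (z k) r (Ideal.pow_le_pow_right (Finset.le_sup (f := fun k => t (z k)) hk) hr)

theorem Dat.lc (hD : Dat R d h W D ι π) (M : ModuleCat.{u} R) [Module.Finite R M]
    (hM : ∀ i, van R M (W 0) (i+1)) :
    Nonempty ((localCohomology (maximalIdeal R) d).obj M ≃ₗ[R] ((M →ₗ[R] W 0) →ₗ[R] D d)) := by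
  have hfin := hD.om.fin
  let Z : ℕ → ModuleCat.{u} R := fun n => ModuleCat.of R ((M →ₗ[R] W 0) →ₗ[R] W n)
  let J : ℕ → ModuleCat.{u} R := fun n => ModuleCat.of R ((M →ₗ[R] W 0) →ₗ[R] D n)
  obtain ⟨e1⟩ := lc_equiv (Z := Z) (J := J) (maximalIdeal R) d (fun j => hD.zc hM j)
    (fun t j hj i => hD.van_pow t hj i (M →ₗ[R] W 0)) (fun z => hD.tors_hom (M →ₗ[R] W 0) z)
  let e0 : M ≃ₗ[R] Z 0 := LinearEquiv.ofBijective _ (bidual_equiv hD.om M hM)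
  let e2 := ((localCohomology (maximalIdeal R) d).mapIso e0.toModuleIso).toLinearEquiv
  have := hD.zero (d+1) (by omega)
  have hb : Function.Bijective (ι d) := by
    refine ⟨(hD.ses d).inj, fun y => ((hD.ses d).exact y).1 (Subsingleton.elim _ _)⟩
  let e3 : W d ≃ₗ[R] D d := LinearEquiv.ofBijective (ι d) hb
  exact ⟨e2.trans (e1.trans (e3.congrRight))⟩
end
end GGP

end PartPJ4

section PartPK
open CategoryTheory Abelian IsLocalRing TensorProduct RingTheory.Sequence
open scoped Pointwise
namespace GGP

theorem exists_of_sSup_eq {S : Set ℕ∞} {d : ℕ} (h : sSup S = d) (hne : S.Nonempty) : (d : ℕ∞) ∈ S := by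
  by_contra hn
  have h1 : ∀ c ∈ S, c < d := fun c hc => lt_of_le_of_ne (h ▸ le_sSup hc) (fun hcd => hn (hcd ▸ hc))
  cases d with
  | zero =>
    obtain ⟨c, hc⟩ := hne
    have := h1 c hc
    simp at this
  | succ d =>
    have h2 : sSup S ≤ (d : ℕ∞) := by
      refine sSup_le fun c hc => ?_
      have := h1 c hc
      push_cast at this
      exact Order.le_of_lt_add_one this
    rw [h] at h2
    have : d + 1 ≤ d := by exact_mod_cast h2
    omega

theorem wb_le {a : WithBot ℕ∞} {n d : ℕ} (h : a + n = d) : n ≤ d := by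
  obtain rfl | ⟨b, rfl⟩ : a = ⊥ ∨ ∃ b : ℕ∞, a = b := by
    cases a
    · exact Or.inl rfl
    · exact Or.inr ⟨_, rfl⟩
  · simp at h
  · have h' : b + (n : ℕ∞) = d := by exact_mod_cast h
    have : (n : ℕ∞) ≤ d := h' ▸ le_add_self
    exact_mod_cast this

theorem final (R : Type u) [CommRing R] [IsLocalRing R] [IsNoetherianRing R] (d : ℕ)
    (hd : ringKrullDim R = d) (hR : GG.HasDualizingComplex R) (M : ModuleCat.{u} R)
    (hM0 : ∃ x : M, x ≠ 0) (hMf : Module.Finite R M) (hMCM : GG.IsMaximalCM R M)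
    (hGid : ∃ n, GG.gidLE R M n) :
    GG.IsGGorenstein R M ∧ GG.IsCMLocalRing R ∧
      GG.IsGorensteinInjective R ((localCohomology (maximalIdeal R) d).obj M) := by
  obtain ⟨hcm, hmax⟩ := hMCM
  have hdim : Module.supportDim R M = d := hmax.trans hd
  have hdep : GG.mdepth R M = d := by
    have h1 : (GG.mdepth R M : WithBot ℕ∞) = d := hcm.trans (hmax.trans hd)
    exact_mod_cast h1
  have hnt : Nontrivial M := by
    obtain ⟨x, hx⟩ := hM0
    exact ⟨x, 0, hx⟩
  obtain ⟨xs, hlen, hxs, hreg⟩ := exists_of_sSup_eq hdep ⟨0, [], by simp, by simp, IsRegular.nil R M⟩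
  have hlen : xs.length = d := by exact_mod_cast hlen.symm
  obtain ⟨g, hg⟩ := hGid
  obtain ⟨B, G, ιB, πB, hs, hG, hB, ⟨e⟩⟩ := cores_chain hg
  have hG' : ∀ j, IsGI R (G j) := fun j => (isGI_iff _).1 (hG j)
  obtain ⟨rs, hrs, hrr, hrl⟩ := cm_main d hd M xs hxs hreg hlen hdim B G ιB πB hs hG' g hB e
  obtain ⟨h, W, D, ι, π, hD⟩ := exists_dat d hd hR rs hrs hrr hrl
  have hfin := hD.om.fin
  have hM : ∀ i, van R M (W 0) (i+1) := fun i =>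
    van_depth d hD.om.id xs M hxs hreg.toIsWeaklyRegular (i+1) (by omega)
  have hBass : Bass R (W 0) M := by
    refine Bass.congr e ?_
    exact Bass.of_chain hD.om (g+1) B G ιB πB hs (fun k => Bass.of_gi hD _ (hG' k)) (fun k hk => hB k (by omega))
  obtain ⟨β, hβ⟩ := hD.om.exists_TP M hM hBass
  have hGI : ∀ n, IsGI R ((M →ₗ[R] W 0) →ₗ[R] D n) := fun n => hβ.gi (hD.inj n)
  refine ⟨⟨hM0, hMf, hD.cousin M hM hGI⟩, ?_, ?_⟩
  · have h1 : GG.mdepth R R = d := by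
      refine le_antisymm (sSup_le ?_) (le_sSup ⟨rs, by rw [hrl], hrs, hrr⟩)
      rintro c ⟨qs, rfl, hqs, hqr⟩
      have := ringKrullDim_add_length_eq_ringKrullDim_of_isRegular qs hqr
      rw [hd] at this
      exact_mod_cast wb_le this
    change (GG.mdepth R R : WithBot ℕ∞) = _
    rw [h1, hd]; rfl
  · rw [isGI_iff]
    obtain ⟨e⟩ := hD.lc M hM
    obtain ⟨Z, X, i, p, h1, h2, h3, ⟨e'⟩⟩ := hGI d
    exact ⟨Z, X, i, p, h1, h2, h3, ⟨e.trans e'⟩⟩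
end GGP

end PartPK

open GG IsLocalRing in
/-- A maximal Cohen–Macaulay module of finite Gorenstein injective dimension over a local
ring with a dualizing complex is G–Gorenstein, the ring is Cohen–Macaulay, and the top
local cohomology module is Gorenstein injective. -/
theorem stmt6 (R : Type u) [CommRing R] [IsLocalRing R] [IsNoetherianRing R]
    (d : ℕ) (hd : ringKrullDim R = d) (hR : HasDualizingComplex R)
    (M : ModuleCat.{u} R) (hM0 : ∃ x : M, x ≠ 0) (hMf : Module.Finite R M)
    (hMCM : IsMaximalCM R M) (hGid : ∃ n, gidLE R M n) :
    IsGGorenstein R M ∧ IsCMLocalRing R ∧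
      IsGorensteinInjective R ((localCohomology (maximalIdeal R) d).obj M) := by
  exact GGP.final R d hd hR M hM0 hMf hMCM hGid
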